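/- Assume GRH. Let Φ: ℝ → ℝ be a fixed smooth compactly supported function with support contained in (0,∞), and fix δ > 0 and ε > 0. Then there exist constants C > 0 and x₀ such that for all x ≥ x₀, all y with (log x)^{2+δ} ≤ y ≤ exp((log x)^{1/2−δ}), and all real α ∈ [0,1] of the form α = a/q + γ with integers a, q satisfying gcd(a,q)=1, 1 ≤ q ≤ √x, and with x^{δ−1} ≤ |γ| ≤ 1/(q√x), one has |E(x,y;α)| ≤ C·x^{3/4+ε}. -/

import Mathlib

noncomputable section

/-- The Generalized Riemann Hypothesis. -/
def GRH : Prop :=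
  (∀ s : ℂ, 0 < s.re → s.re < 1 → riemannZeta s = 0 → s.re = 1 / 2) ∧
  (∀ (N : ℕ) [NeZero N] (χ : DirichletCharacter ℂ N) (s : ℂ),
    0 < s.re → s.re < 1 → DirichletCharacter.LFunction χ s = 0 → s.re = 1 / 2)

/-- The weighted exponential sum `E(x,y;α)` over `y`-smooth positive integers. -/
def Esum (x y : ℝ) (Φ : ℝ → ℝ) (α : ℝ) : ℂ :=
  ∑' n : {n : ℕ // 0 < n ∧ ∀ p : ℕ, p.Prime → p ∣ n → (p : ℝ) ≤ y},
    Complex.exp (2 * (Real.pi : ℂ) * Complex.I * ((n : ℕ) : ℂ) * (α : ℂ)) *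
      ((Φ (((n : ℕ) : ℝ) / x) : ℝ) : ℂ)

open Complex Set MeasureTheory Filter Topology Asymptotics

/-- If the partial sums of `f` stay within `B` of `c n`, the Dirichlet series of `f` continues to
`0 < re s`, up to the pole at `1`, with linear growth in `‖s‖`. -/
lemma exists_continuation_of_partial_sums (f : ℕ → ℂ) (c : ℂ) (B : ℝ) (hB : 0 ≤ B)
    (hf : ∀ n : ℕ, ‖∑ k ∈ Finset.Icc 1 n, f k - c * n‖ ≤ B)
    (hS : ∀ s : ℂ, 1 < s.re → LSeriesSummable f s) :
    ∃ H : ℂ → ℂ, DifferentiableOn ℂ H {s | 0 < s.re} ∧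
      (∀ s : ℂ, 0 < s.re → ‖H s‖ ≤ (B + ‖c‖) / s.re) ∧
      ∀ s : ℂ, 1 < s.re → (s - 1) * LSeries f s = c * s + (s - 1) * s * H s := by
  set E : ℝ → ℂ := fun u => ∑ k ∈ Finset.Icc 1 ⌊u⌋₊, f k - c * u with hE
  have hEb : ∀ u : ℝ, 0 ≤ u → ‖E u‖ ≤ B + ‖c‖ := by
    intro u hu
    have h1 : E u = (∑ k ∈ Finset.Icc 1 ⌊u⌋₊, f k - c * (⌊u⌋₊ : ℕ)) + c * ((⌊u⌋₊ : ℝ) - u : ℝ) := by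
      simp only [hE]; push_cast; ring
    rw [h1]
    refine (norm_add_le _ _).trans (add_le_add (hf _) ?_)
    rw [norm_mul]
    have : ‖(((⌊u⌋₊ : ℝ) - u : ℝ) : ℂ)‖ ≤ 1 := by
      rw [Complex.norm_real, Real.norm_eq_abs, abs_le]
      constructor <;> linarith [Nat.floor_le hu, (Nat.lt_floor_add_one u).le]
    nlinarith [norm_nonneg c]
  set φ : ℝ → ℂ := (Ioi (1 : ℝ)).indicator E with hφ
  have hEloc : LocallyIntegrableOn E (Ici 0) := by
    have h1 := locallyIntegrableOn_mul_sum_Icc (m := 1) f (le_refl (0:ℝ))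
      (g := fun _ => (1:ℂ)) (by
        exact (continuous_const.continuousOn).locallyIntegrableOn measurableSet_Ici)
    have h2 : LocallyIntegrableOn (fun u : ℝ => c * (u:ℂ)) (Ici (0:ℝ)) :=
      (Continuous.continuousOn (by fun_prop)).locallyIntegrableOn measurableSet_Ici
    simp only [one_mul] at h1
    exact h1.sub h2
  have hφloc : LocallyIntegrableOn φ (Ioi 0) := by
    have : LocallyIntegrableOn E (Ioi 0) := hEloc.mono_set Ioi_subset_Ici_self
    rw [locallyIntegrableOn_iff isOpen_Ioi.isLocallyClosed] at this ⊢
    intro k hk hkc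
    exact (this k hk hkc).indicator measurableSet_Ioi
  have hφtop : φ =O[atTop] (fun x : ℝ => x ^ (-(0:ℝ))) := by
    refine IsBigO.of_bound (B + ‖c‖) ?_
    filter_upwards [eventually_ge_atTop (0:ℝ)] with u hu
    simp only [neg_zero, Real.rpow_zero, norm_one, mul_one]
    refine (norm_indicator_le_norm_self _ _).trans (hEb u hu)
  have hφbot : ∀ b : ℝ, φ =O[𝓝[>] 0] (fun x : ℝ => x ^ (-b)) := by
    intro b
    refine EventuallyEq.trans_isBigO (f₂ := fun _ => (0:ℂ)) ?_ (isBigO_zero _ _)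
    filter_upwards [mem_nhdsWithin_of_mem_nhds (Iio_mem_nhds (zero_lt_one (α := ℝ)))] with u hu
    exact indicator_of_notMem (by simpa using le_of_lt hu) _
  have hmel : ∀ s : ℂ, mellin φ (-s) = ∫ u in Ioi (1:ℝ), E u * (u : ℂ) ^ (-(s + 1)) := by
    intro s
    rw [mellin, ← integral_indicator measurableSet_Ioi, ← integral_indicator measurableSet_Ioi]
    congr 1; ext u
    by_cases hu : 1 < u
    · have hu0 : 0 < u := by linarith
      rw [indicator_of_mem (by exact hu0), indicator_of_mem (by exact hu), hφ,
        indicator_of_mem (by exact hu), smul_eq_mul, mul_comm]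
      ring_nf
    · by_cases hu0 : 0 < u
      · rw [indicator_of_mem (by exact hu0), indicator_of_notMem (by exact hu), hφ,
          indicator_of_notMem (by exact hu), smul_zero]
      · rw [indicator_of_notMem (by exact hu0), indicator_of_notMem (by exact hu)]
  have h_int : ∀ s : ℂ, 0 < s.re →
      IntegrableOn (fun u : ℝ => E u * (u : ℂ) ^ (-(s + 1))) (Ioi (1:ℝ)) := by
    intro s hs
    have hb : IntegrableOn (fun u : ℝ => (u : ℂ) ^ (-(s + 1))) (Ioi (1:ℝ)) :=
      integrableOn_Ioi_cpow_of_lt (by simp; linarith) zero_lt_one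
    refine Integrable.bdd_mul (c := B + ‖c‖) hb ?_ ?_
    · exact (hEloc.mono_set (fun u (hu : 1 < u) => (by simp; linarith : u ∈ Ici (0:ℝ)))).aestronglyMeasurable
    · refine (ae_restrict_iff' measurableSet_Ioi).mpr (Eventually.of_forall fun u hu => hEb u ?_)
      have : (1:ℝ) < u := hu
      linarith
  refine ⟨fun s => mellin φ (-s), ?_, ?_, ?_⟩
  · intro s hs
    have h0 : 0 < s.re := hs
    have := mellin_differentiableAt_of_isBigO_rpow (s := -s) hφloc hφtop (by simpa using h0)
      (hφbot (-s.re - 1)) (by simp)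
    exact (this.comp s differentiableAt_id.neg).differentiableWithinAt
  · intro s hs
    simp only [hmel]
    refine (norm_integral_le_integral_norm _).trans ?_
    have : ∫ u in Ioi (1:ℝ), (B + ‖c‖) * u ^ (-(s.re + 1)) = (B + ‖c‖) / s.re := by
      rw [integral_const_mul, integral_Ioi_rpow_of_lt (by linarith) zero_lt_one]
      simp [div_eq_mul_inv]
    rw [← this]
    refine setIntegral_mono_on (h_int s hs).norm ?_ measurableSet_Ioi ?_
    · exact (integrableOn_Ioi_rpow_of_lt (by linarith) zero_lt_one).const_mul _
    · intro u hu
      have hu1 : (1:ℝ) < u := hu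
      rw [norm_mul, norm_cpow_eq_rpow_re_of_pos (by linarith)]
      simp only [neg_re, add_re, one_re]
      gcongr
      exact hEb u (by linarith)
  · intro s hs
    have hO : (fun n ↦ ∑ k ∈ Finset.Icc 1 n, f k) =O[atTop] fun n ↦ (n : ℝ) ^ (1:ℝ) := by
      refine IsBigO.of_bound (B + ‖c‖) ?_
      filter_upwards [eventually_ge_atTop 1] with n hn
      have hn' : (1:ℝ) ≤ n := by exact_mod_cast hn
      have h2 := norm_add_le (∑ k ∈ Finset.Icc 1 n, f k - c * n) (c * n)
      rw [sub_add_cancel, norm_mul, Complex.norm_natCast] at h2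
      rw [Real.rpow_one, Real.norm_eq_abs, abs_of_nonneg (by positivity)]
      nlinarith [hf n]
    have h1 := LSeries_eq_mul_integral f zero_le_one hs (hS s hs) hO
    have h2 : ∫ t in Ioi (1 : ℝ), (∑ k ∈ Finset.Icc 1 ⌊t⌋₊, f k) * (t:ℂ) ^ (-(s + 1)) =
        (∫ u in Ioi (1:ℝ), E u * (u : ℂ) ^ (-(s + 1))) + c * (1 / (s - 1)) := by
      have h3 : ∫ u in Ioi (1:ℝ), c * (u : ℂ) ^ (-s) = c * (1 / (s - 1)) := by
        rw [integral_const_mul, integral_Ioi_cpow_of_lt (by simpa using hs) zero_lt_one]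
        simp only [ofReal_one, one_cpow]
        rw [show -s + 1 = -(s - 1) by ring, neg_div_neg_eq]
      rw [← h3, ← integral_add (h_int s (by linarith))
        ((integrableOn_Ioi_cpow_of_lt (by simpa using hs) zero_lt_one).const_mul c)]
      refine setIntegral_congr_fun measurableSet_Ioi fun u hu => ?_
      have hu0 : (u:ℂ) ≠ 0 := by
        have : (1:ℝ) < u := hu
        exact_mod_cast (by linarith : u ≠ 0)
      have : (u:ℂ) ^ (-s) = u * (u:ℂ) ^ (-(s+1)) := by
        rw [show -s = 1 + -(s+1) by ring, cpow_add _ _ hu0, cpow_one]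
      simp only [this, hE]
      ring
    simp only [hmel]
    have hs1 : s - 1 ≠ 0 := by
      intro h
      have : s = 1 := by linear_combination h
      rw [this] at hs; simp at hs
    rw [h1, h2]
    field_simp
    ring

lemma norm_dirichletCharacter_sum_le {N : ℕ} [NeZero N] {χ : DirichletCharacter ℂ N} (hχ : χ ≠ 1)
    (n : ℕ) : ‖∑ k ∈ Finset.Icc 1 n, χ k‖ ≤ N := by
  have hper : ∑ k ∈ Finset.range N, χ (k : ℕ) = 0 := by
    rw [← MulChar.sum_eq_zero_of_ne_one hχ]
    refine Finset.sum_nbij' (fun k => (k : ZMod N)) (fun a => a.val) ?_ ?_ ?_ ?_ ?_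
    · simp
    · intro a _; simpa using ZMod.val_lt a
    · intro k hk; exact ZMod.val_cast_of_lt (by simpa using hk)
    · intro a _; simp
    · simp
  have hmul : ∀ m : ℕ, ∀ r : ℕ, ∑ k ∈ Finset.range (N * m + r), χ (k : ℕ) =
      ∑ k ∈ Finset.range r, χ (k : ℕ) := by
    intro m
    induction m with
    | zero => simp
    | succ m ih =>
      intro r
      rw [show N * (m + 1) + r = N * m + (N + r) by ring, ih, Finset.sum_range_add, hper, zero_add]
      exact Finset.sum_congr rfl fun k _ => by simp
  have key : ∀ m : ℕ, ‖∑ k ∈ Finset.range m, χ (k + 1 : ℕ)‖ ≤ N := by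
    intro m
    have e1 : ∑ k ∈ Finset.range m, χ (k + 1 : ℕ) =
        ∑ k ∈ Finset.range (m + 1), χ (k : ℕ) - χ (0 : ℕ) := by
      rw [Finset.sum_range_succ']; ring
    have e3 : ∑ k ∈ Finset.range m, χ (k + 1 : ℕ) =
        ∑ k ∈ Finset.range (m % N), χ (k + 1 : ℕ) := by
      have := Nat.div_add_mod m N
      rw [e1, show m + 1 = N * (m / N) + (m % N + 1) by omega, hmul, Finset.sum_range_succ']
      ring
    rw [e3]
    refine (norm_sum_le _ _).trans ?_
    refine (Finset.sum_le_sum fun k _ => DirichletCharacter.norm_le_one χ _).trans ?_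
    simp only [Finset.sum_const, Finset.card_range, nsmul_eq_mul, mul_one, Nat.cast_le]
    exact (Nat.mod_lt _ (NeZero.pos N)).le
  have := key n
  rwa [Finset.range_eq_Ico, Finset.sum_Ico_add' (fun k : ℕ => χ (k:ℕ)) 0 n 1] at this

/-- The `L`-function of `χ`, with the pole at `1` removed when `χ` is trivial. -/
def regL {N : ℕ} [NeZero N] (χ : DirichletCharacter ℂ N) : ℂ → ℂ :=
  open Classical in
  if χ = 1 then DirichletCharacter.LFunctionTrivChar₁ N else DirichletCharacter.LFunction χ

lemma eqOn_re_pos_of_eqOn {f g : ℂ → ℂ} (hf : DifferentiableOn ℂ f {s | 0 < s.re})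
    (hg : DifferentiableOn ℂ g {s | 0 < s.re}) (h : ∀ s : ℂ, 1 < s.re → f s = g s) :
    ∀ s : ℂ, 0 < s.re → f s = g s := by
  have ho : IsOpen {s : ℂ | 0 < s.re} := isOpen_lt continuous_const continuous_re
  have hc : IsPreconnected {s : ℂ | 0 < s.re} := (convex_halfSpace_re_gt 0).isPreconnected
  have := (hf.analyticOnNhd ho).eqOn_of_preconnected_of_eventuallyEq (hg.analyticOnNhd ho) hc
    (z₀ := 2) (by simp) (by
      have : {s : ℂ | 1 < s.re} ∈ 𝓝 (2:ℂ) :=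
        (isOpen_lt continuous_const continuous_re).mem_nhds (by simp)
      filter_upwards [this] with s hs using h s hs)
  exact fun s hs => this hs

lemma norm_LFunction_le {N : ℕ} [NeZero N] {χ : DirichletCharacter ℂ N} (hχ : χ ≠ 1) {s : ℂ}
    (hs : 1 / 2 ≤ s.re) : ‖DirichletCharacter.LFunction χ s‖ ≤ 2 * N * ‖s‖ := by
  obtain ⟨H, hH, hHb, hHs⟩ := exists_continuation_of_partial_sums (fun n => χ n) 0 N (by positivity)
    (fun n => by simpa using norm_dirichletCharacter_sum_le hχ n)
    (fun s hs => by
      exact LSeriesSummable_of_bounded_of_one_lt_re (m := 1)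
        (fun n _ => DirichletCharacter.norm_le_one χ _) hs)
  have h1 : ∀ s : ℂ, 0 < s.re → DirichletCharacter.LFunction χ s = s * H s := by
    refine eqOn_re_pos_of_eqOn (DirichletCharacter.differentiable_LFunction hχ).differentiableOn
      (differentiableOn_id.mul hH) fun s hs => ?_
    have hs1 : s - 1 ≠ 0 := by
      intro h
      have : s = 1 := by linear_combination h
      rw [this] at hs; simp at hs
    have := hHs s hs
    rw [DirichletCharacter.LFunction_eq_LSeries χ hs]
    refine mul_left_cancel₀ hs1 ?_
    rw [this]; ring
  have h0 : 0 < s.re := by linarith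
  rw [h1 s h0, norm_mul]
  have h2 : ‖H s‖ ≤ 2 * N := by
    refine (hHb s h0).trans ?_
    rw [div_le_iff₀ h0]
    simp only [norm_zero, add_zero]
    nlinarith [(Nat.cast_nonneg N : (0:ℝ) ≤ N)]
  nlinarith [norm_nonneg s]

lemma norm_LFunctionTrivChar₁_one_le {s : ℂ} (hs : 1 / 2 ≤ s.re) :
    ‖DirichletCharacter.LFunctionTrivChar₁ 1 s‖ ≤ ‖s‖ + 2 * ‖s - 1‖ * ‖s‖ := by
  obtain ⟨H, hH, hHb, hHs⟩ := exists_continuation_of_partial_sums (fun n => 1) 1 0 le_rfl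
    (fun n => by simp)
    (fun s hs => by
      exact LSeriesSummable_of_bounded_of_one_lt_re (m := 1) (fun n _ => by simp) hs)
  have h1 : ∀ s : ℂ, 0 < s.re →
      DirichletCharacter.LFunctionTrivChar₁ 1 s = s + (s - 1) * s * H s := by
    refine eqOn_re_pos_of_eqOn
      (DirichletCharacter.differentiable_LFunctionTrivChar₁ 1).differentiableOn
      (differentiableOn_id.add (((differentiableOn_id.sub_const 1).mul differentiableOn_id).mul hH))
      fun s hs => ?_
    have hs1 : s ≠ 1 := by
      intro h
      rw [h] at hs; simp at hs
    rw [DirichletCharacter.LFunctionTrivChar₁, Function.update_of_ne hs1]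
    have := hHs s hs
    rw [one_mul] at this
    rw [← this, DirichletCharacter.LFunctionTrivChar, DirichletCharacter.LFunction_eq_LSeries _ hs]
    congr 1
    refine LSeries_congr (fun {n} hn => ?_) s
    rw [MulChar.one_apply (isUnit_of_subsingleton _)]
  have h0 : 0 < s.re := by linarith
  rw [h1 s h0]
  refine (norm_add_le _ _).trans ?_
  have h2 : ‖H s‖ ≤ 2 := by
    refine (hHb s h0).trans ?_
    rw [div_le_iff₀ h0]
    simp only [norm_one, zero_add]
    linarith
  rw [norm_mul, norm_mul]
  have : 0 ≤ ‖s - 1‖ * ‖s‖ := by positivity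
  nlinarith

lemma LFunctionTrivChar₁_eq_prod_mul (N : ℕ) [NeZero N] (s : ℂ) :
    DirichletCharacter.LFunctionTrivChar₁ N s = (∏ p ∈ N.primeFactors, (1 - (p : ℂ) ^ (-s))) *
      DirichletCharacter.LFunctionTrivChar₁ 1 s := by
  by_cases hs : s = 1
  · subst hs
    simp [DirichletCharacter.LFunctionTrivChar₁, cpow_neg_one]
  · simp only [DirichletCharacter.LFunctionTrivChar₁, Function.update_of_ne hs]
    rw [DirichletCharacter.LFunctionTrivChar_eq_mul_riemannZeta hs,
      DirichletCharacter.LFunctionTrivChar_eq_mul_riemannZeta hs]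
    simp
    ring

lemma norm_regL_le {N : ℕ} [NeZero N] (χ : DirichletCharacter ℂ N) {s : ℂ}
    (hs : 1 / 2 ≤ s.re) : ‖regL χ s‖ ≤ 2 * N * (‖s‖ + 1) ^ 2 := by
  have hN : (1:ℝ) ≤ N := by exact_mod_cast NeZero.one_le
  rw [regL]
  split_ifs with h
  · rw [LFunctionTrivChar₁_eq_prod_mul, norm_mul, norm_prod]
    have h1 : ∏ p ∈ N.primeFactors, ‖1 - (p : ℂ) ^ (-s)‖ ≤ N := by
      calc ∏ p ∈ N.primeFactors, ‖1 - (p : ℂ) ^ (-s)‖ ≤ ∏ p ∈ N.primeFactors, (p : ℝ) := by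
            refine Finset.prod_le_prod (fun _ _ => norm_nonneg _) fun p hp => ?_
            have hp2 : (2:ℝ) ≤ p := by exact_mod_cast (Nat.prime_of_mem_primeFactors hp).two_le
            refine (norm_sub_le _ _).trans ?_
            rw [norm_one, norm_natCast_cpow_of_pos (Nat.prime_of_mem_primeFactors hp).pos]
            have : (p:ℝ) ^ (-s).re ≤ 1 := Real.rpow_le_one_of_one_le_of_nonpos (by linarith)
              (by simp; linarith)
            linarith
        _ ≤ N := by
            rw [← Nat.cast_prod]
            exact_mod_cast Nat.le_of_dvd (NeZero.pos N) (Nat.prod_primeFactors_dvd N)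
    have h2 := norm_LFunctionTrivChar₁_one_le hs
    have h3 : ‖s - 1‖ ≤ ‖s‖ + 1 := by simpa using norm_sub_le s 1
    have h4 : ‖s‖ + 2 * ‖s - 1‖ * ‖s‖ ≤ 2 * (‖s‖ + 1) ^ 2 := by
      nlinarith [norm_nonneg s]
    calc _ ≤ N * (2 * (‖s‖ + 1) ^ 2) := by
          gcongr
          exact h2.trans h4
      _ = _ := by ring
  · refine (norm_LFunction_le h hs).trans ?_
    gcongr
    nlinarith [norm_nonneg s]

/-- A zero-free holomorphic function of bounded size on a disc has a bounded logarithmic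
derivative on smaller discs. -/
lemma norm_logDeriv_le_of_ball {g : ℂ → ℂ} {c : ℂ} {r R M : ℝ} (hr : 0 < r) (hrR : r < R)
    (hM : 1 < M) (hg : DifferentiableOn ℂ g (Metric.ball c R))
    (hg0 : ∀ z ∈ Metric.ball c R, g z ≠ 0)
    (hgM : ∀ z ∈ Metric.ball c R, ‖g z‖ ≤ M * ‖g c‖) {z : ℂ} (hz : z ∈ Metric.closedBall c r) :
    ‖deriv g z / g z‖ ≤ 4 * (R + r) / (R - r) ^ 2 * Real.log M := by
  have hR : 0 < R := hr.trans hrR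
  have hcR : c ∈ Metric.ball c R := Metric.mem_ball_self hR
  have hlogM : 0 < Real.log M := Real.log_pos hM
  have hq : DifferentiableOn ℂ (fun z => deriv g z / g z) (Metric.ball c R) :=
    (hg.deriv Metric.isOpen_ball).div hg hg0
  obtain ⟨h, hh⟩ := hq.isExactOn_ball
  have hexp : ∀ w ∈ Metric.ball c R, g w * exp (-(h w)) = g c * exp (-(h c)) := by
    intro w hw
    have hd : ∀ w ∈ Metric.ball c R, HasDerivAt (fun w => g w * exp (-(h w))) 0 w := by
      intro w hw
      have h1 : HasDerivAt g (deriv g w) w :=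
        (hg.differentiableAt (Metric.isOpen_ball.mem_nhds hw)).hasDerivAt
      refine (h1.mul (hh w hw).neg.cexp).congr_deriv ?_
      have := mul_div_cancel₀ (deriv g w) (hg0 w hw)
      linear_combination (-exp (-(h w))) * this
    refine (convex_ball c R).is_const_of_fderivWithin_eq_zero (𝕜 := ℂ) (f := fun w => g w * exp (-(h w)))
      (fun w hw => (hd w hw).differentiableAt.differentiableWithinAt) (fun w hw => ?_) hw hcR
    have := (hd w hw).hasFDerivAt.hasFDerivWithinAt (s := Metric.ball c R)
    rw [this.fderivWithin (Metric.isOpen_ball.uniqueDiffWithinAt hw)]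
    ext; simp
  set H : ℂ → ℂ := fun w => h (c + w) - h c with hHdef
  have hmem : ∀ w ∈ Metric.ball (0:ℂ) R, c + w ∈ Metric.ball c R := by
    intro w hw; simpa [Metric.mem_ball, dist_eq_norm] using hw
  have hHd : DifferentiableOn ℂ H (Metric.ball 0 R) := by
    intro w hw
    have h1 : HasDerivAt (fun w => h (c + w)) _ w := (hh _ (hmem w hw)).comp_const_add c w
    exact (h1.sub_const (h c)).differentiableAt.differentiableWithinAt
  have hHre : MapsTo H (Metric.ball 0 R) {z | z.re ≤ Real.log M} := by
    intro w hw
    have h1 := hexp _ (hmem w hw)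
    have h2 : exp (H w) = g (c + w) / g c := by
      rw [eq_div_iff (hg0 c hcR), hHdef]
      simp only [sub_eq_add_neg, exp_add]
      calc exp (h (c + w)) * exp (-h c) * g c = exp (h (c + w)) * (g c * exp (-h c)) := by ring
        _ = exp (h (c + w)) * (g (c + w) * exp (-(h (c + w)))) := by rw [h1]
        _ = g (c + w) * (exp (h (c + w)) * exp (-(h (c + w)))) := by ring
        _ = g (c + w) := by rw [← exp_add]; simp
    have h3 : Real.exp (H w).re ≤ M := by
      rw [← Complex.norm_exp, h2, norm_div]
      exact div_le_of_le_mul₀ (norm_nonneg _) (by linarith) (hgM _ (hmem w hw))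
    exact (Real.le_log_iff_exp_le (by linarith)).mpr h3
  set ρ : ℝ := (R + r) / 2 with hρ
  have hBC : ∀ w : ℂ, ‖w‖ ≤ ρ → ‖H w‖ ≤ 2 * Real.log M * ρ / (R - ρ) := by
    intro w hw
    have hwR : ‖w‖ < R := by rw [hρ] at hw; linarith
    have := Complex.borelCaratheodory_zero hlogM hHd hHre hR (by simpa using hwR)
      (by simp [hHdef])
    refine this.trans ?_
    have : 0 < R - ρ := by rw [hρ]; linarith
    gcongr
  have hzd : dist z c ≤ r := hz
  have hz' : z ∈ Metric.ball c R := lt_of_le_of_lt hzd hrR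
  have hder : deriv g z / g z = deriv H (z - c) := by
    have h1 : HasDerivAt (fun w => h (c + w)) (deriv g (c + (z - c)) / g (c + (z - c))) (z - c) :=
      (hh _ (by simpa using hz')).comp_const_add c (z - c)
    rw [(h1.sub_const (h c)).deriv]
    simp
  rw [hder]
  have hρr : 0 < ρ - r := by rw [hρ]; linarith
  have hzn : ‖z - c‖ ≤ r := by rwa [← dist_eq_norm]
  have hsub : ∀ w ∈ Metric.closedBall (z - c) (ρ - r), ‖w‖ ≤ ρ := by
    intro w hw
    have : ‖w - (z - c)‖ ≤ ρ - r := by rwa [← dist_eq_norm]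
    have := norm_add_le (w - (z - c)) (z - c)
    rw [sub_add_cancel] at this
    linarith
  have hC := Complex.norm_deriv_le_of_forall_mem_sphere_norm_le (f := H) (c := z - c) hρr
    (C := 2 * Real.log M * ρ / (R - ρ)) ?_ (fun w hw => hBC w (hsub w (Metric.sphere_subset_closedBall hw)))
  · refine hC.trans (le_of_eq ?_)
    have h1 : R - ρ = (R - r) / 2 := by rw [hρ]; ring
    have h2 : ρ - r = (R - r) / 2 := by rw [hρ]; ring
    have : R - r ≠ 0 := by linarith
    rw [h1, h2, hρ]
    field_simp
    ring
  · refine DifferentiableOn.diffContOnCl_ball (U := Metric.ball 0 R) hHd ?_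
    intro w hw
    have := hsub w hw
    simp only [Metric.mem_ball, dist_zero_right]
    rw [hρ] at this
    linarith

lemma differentiable_regL {N : ℕ} [NeZero N] (χ : DirichletCharacter ℂ N) :
    Differentiable ℂ (regL χ) := by
  rw [regL]
  split_ifs with h
  · exact DirichletCharacter.differentiable_LFunctionTrivChar₁ N
  · exact DirichletCharacter.differentiable_LFunction h

lemma regL_eq_of_ne_one {N : ℕ} [NeZero N] (χ : DirichletCharacter ℂ N) {s : ℂ} (hs : s ≠ 1) :
    regL χ s = (if χ = 1 then s - 1 else 1) * DirichletCharacter.LFunction χ s := by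
  rw [regL]
  split_ifs with h
  · rw [DirichletCharacter.LFunctionTrivChar₁, Function.update_of_ne hs, h]
  · simp

lemma regL_ne_zero (hGRH : GRH) {N : ℕ} [NeZero N] (χ : DirichletCharacter ℂ N) {s : ℂ}
    (hs : 1 / 2 < s.re) : regL χ s ≠ 0 := by
  by_cases hs1 : s = 1
  · subst hs1
    rw [regL]
    split_ifs with h
    · exact DirichletCharacter.LFunctionTrivChar₁_apply_one_ne_zero N
    · exact DirichletCharacter.LFunction_apply_one_ne_zero h
  · rw [regL_eq_of_ne_one χ hs1]
    refine mul_ne_zero ?_ ?_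
    · split_ifs
      · exact sub_ne_zero.mpr hs1
      · exact one_ne_zero
    · rcases lt_or_ge s.re 1 with h | h
      · intro h0
        have := hGRH.2 N χ s (by linarith) h h0
        linarith
      · exact DirichletCharacter.LFunction_ne_zero_of_one_le_re χ (Or.inr hs1) h

lemma exists_le_norm_LFunction_three : ∃ c > (0:ℝ), ∀ (N : ℕ) [NeZero N]
    (χ : DirichletCharacter ℂ N) (s : ℂ), s.re = 3 → c ≤ ‖DirichletCharacter.LFunction χ s‖ := by
  have hsum : Summable (fun n : ℕ => 1 / (n:ℝ) ^ (3:ℝ)) :=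
    Real.summable_one_div_nat_rpow.mpr (by norm_num)
  set K := ∑' n : ℕ, 1 / (n:ℝ) ^ (3:ℝ) with hK
  have hK0 : 0 ≤ K := tsum_nonneg fun n => by positivity
  refine ⟨1 / (K + 1), by positivity, fun N _ χ s hs => ?_⟩
  have hs1 : 1 < s.re := by rw [hs]; norm_num
  have h1 := DirichletCharacter.LSeries.mul_mu_eq_one χ hs1
  rw [DirichletCharacter.LFunction_eq_LSeries χ hs1]
  have h2 : ‖LSeries ((fun n : ℕ => χ n) * fun n : ℕ => ((ArithmeticFunction.moebius n : ℤ) : ℂ)) s‖ ≤ K := by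
    rw [LSeries]
    refine tsum_of_norm_bounded hsum.hasSum fun n => ?_
    rw [LSeries.norm_term_eq]
    split_ifs with hn
    · subst hn; simp
    · rw [hs]
      gcongr
      rw [Pi.mul_apply, norm_mul]
      have h3 : ‖((ArithmeticFunction.moebius n : ℤ) : ℂ)‖ ≤ 1 := by
        rw [Complex.norm_intCast]
        exact_mod_cast ArithmeticFunction.abs_moebius_le_one
      calc _ ≤ (1:ℝ) * 1 := by
            gcongr
            exact DirichletCharacter.norm_le_one χ _
        _ = 1 := by ring
  have h3 := congrArg norm h1
  rw [norm_mul, norm_one] at h3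
  rw [div_le_iff₀ (by positivity)]
  calc (1:ℝ) = _ := h3.symm
    _ ≤ _ := by
      gcongr
      linarith

theorem exists_norm_logDeriv_regL_le (hGRH : GRH) {κ : ℝ} (hκ : 0 < κ) (hκ1 : κ < 1) :
    ∃ C > (0:ℝ), ∀ (N : ℕ) [NeZero N] (χ : DirichletCharacter ℂ N) (s : ℂ),
      1 / 2 + κ ≤ s.re → s.re ≤ 3 →
      ‖deriv (regL χ) s / regL χ s‖ ≤ C * Real.log (N * (|s.im| + 2)) := by
  obtain ⟨c, hc, hcL⟩ := exists_le_norm_LFunction_three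
  set A : ℝ := 4 * (5 / 2 + (5 / 2 - κ)) / (5 / 2 - (5 / 2 - κ)) ^ 2 with hA
  have hA0 : 0 < A := by
    have : 0 < 5 / 2 + (5 / 2 - κ) := by linarith
    rw [hA]
    have : (5:ℝ) / 2 - (5 / 2 - κ) = κ := by ring
    rw [this]
    positivity
  set B : ℝ := 1 + 32 / c with hB
  have hB1 : 1 < B := by
    have : 0 < 32 / c := by positivity
    linarith
  have hlB : 0 < Real.log B := Real.log_pos hB1
  have hl2 : 0 < Real.log 2 := Real.log_pos (by norm_num)
  refine ⟨A * (Real.log B / Real.log 2 + 2), by positivity, fun N _ χ s hs1 hs2 => ?_⟩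
  have hN : (1:ℝ) ≤ N := by exact_mod_cast NeZero.one_le
  set t := s.im with ht
  set Q : ℝ := N * (|t| + 2) with hQ
  have hQ2 : 2 ≤ Q := by
    rw [hQ]; nlinarith [abs_nonneg t]
  set z₀ : ℂ := 3 + t * I with hz₀
  have hz₀re : z₀.re = 3 := by simp [hz₀]
  have hz₀im : z₀.im = t := by simp [hz₀]
  have hball : ∀ z ∈ Metric.ball z₀ (5 / 2), 1 / 2 < z.re := by
    intro z hz
    have h1 : ‖z - z₀‖ < 5 / 2 := by rwa [← dist_eq_norm]
    have h2 := (Complex.abs_re_le_norm (z - z₀))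
    rw [sub_re, hz₀re] at h2
    have := (abs_le.mp (h2.trans h1.le))
    have h3 := lt_of_le_of_lt h2 h1
    rw [abs_lt] at h3
    linarith [h3.1]
  have hlow : c ≤ ‖regL χ z₀‖ := by
    have hz1 : z₀ ≠ 1 := by
      intro h
      rw [h] at hz₀re; norm_num at hz₀re
    rw [regL_eq_of_ne_one χ hz1, norm_mul]
    have h1 : (1:ℝ) ≤ ‖(if χ = 1 then z₀ - 1 else 1 : ℂ)‖ := by
      split_ifs
      · have := Complex.abs_re_le_norm (z₀ - 1)
        rw [sub_re, hz₀re] at this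
        norm_num at this
        linarith
      · simp
    have h2 := hcL N χ z₀ hz₀re
    nlinarith
  have hup : ∀ z ∈ Metric.ball z₀ (5 / 2), ‖regL χ z‖ ≤ B * Q ^ 2 * ‖regL χ z₀‖ := by
    intro z hz
    have h1 : ‖z - z₀‖ < 5 / 2 := by rwa [← dist_eq_norm]
    have h2 : ‖z₀‖ ≤ 3 + |t| := by
      rw [hz₀]
      refine (norm_add_le _ _).trans ?_
      simp
    have h3 : ‖z‖ + 1 ≤ 4 * (|t| + 2) := by
      have := norm_add_le (z - z₀) z₀
      rw [sub_add_cancel] at this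
      linarith [abs_nonneg t]
    calc ‖regL χ z‖ ≤ 2 * N * (‖z‖ + 1) ^ 2 := norm_regL_le χ (hball z hz).le
      _ ≤ 2 * N * (4 * (|t| + 2)) ^ 2 := by gcongr
      _ = 32 * (N * (|t| + 2) ^ 2) := by ring
      _ ≤ 32 * (N ^ 2 * (|t| + 2) ^ 2) := by
          gcongr
          nlinarith
      _ = (32 / c) * Q ^ 2 * c := by rw [hQ]; field_simp
      _ ≤ B * Q ^ 2 * ‖regL χ z₀‖ := by
          gcongr
          rw [hB]; linarith
  have hM1 : 1 < B * Q ^ 2 := by nlinarith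
  have hfin := norm_logDeriv_le_of_ball (g := regL χ) (c := z₀) (r := 5 / 2 - κ) (R := 5 / 2)
    (M := B * Q ^ 2) (by linarith) (by linarith) hM1 (differentiable_regL χ).differentiableOn
    (fun z hz => regL_ne_zero hGRH χ (hball z hz)) hup (z := s) (by
      rw [Metric.mem_closedBall, dist_eq_norm]
      have : s - z₀ = ((s.re - 3 : ℝ) : ℂ) := by
        apply Complex.ext <;> simp [hz₀, ht]
      rw [this, Complex.norm_real, Real.norm_eq_abs, abs_le]
      constructor <;> linarith)
  refine hfin.trans ?_
  rw [← hA, mul_assoc]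
  gcongr
  rw [Real.log_mul (by linarith) (by positivity), Real.log_pow]
  have : Real.log 2 ≤ Real.log Q := Real.log_le_log (by norm_num) hQ2
  have : Real.log B ≤ Real.log B / Real.log 2 * Real.log Q := by
    rw [div_mul_eq_mul_div, le_div_iff₀ hl2]
    gcongr
  push_cast
  linarith

lemma one_add_abs_le_mul_norm {c : ℝ} (hc : c ≠ 0) (τ : ℝ) :
    1 + |τ| ≤ (1 / |c| + 1) * ‖(c + τ * I : ℂ)‖ := by
  have h1 : |c| ≤ ‖(c + τ * I : ℂ)‖ := by simpa using Complex.abs_re_le_norm (c + τ * I : ℂ)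
  have h2 : |τ| ≤ ‖(c + τ * I : ℂ)‖ := by simpa using Complex.abs_im_le_norm (c + τ * I : ℂ)
  have h3 : 1 ≤ 1 / |c| * ‖(c + τ * I : ℂ)‖ := by
    rw [div_mul_eq_mul_div, one_mul, le_div_iff₀ (abs_pos.mpr hc)]; linarith
  linarith

lemma norm_rpow_neg_le {c : ℝ} (hc : c ≠ 0) {p : ℝ} (hp : 0 ≤ p) (τ : ℝ) :
    ‖(c + τ * I : ℂ)‖ ^ (-p) ≤ (1 / |c| + 1) ^ p * (1 + |τ|) ^ (-p) := by
  have hK : 0 < 1 / |c| + 1 := by positivity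
  have h1 : 0 < 1 + |τ| := by positivity
  have h2 := one_add_abs_le_mul_norm hc τ
  have h3 : (1 + |τ|) / (1 / |c| + 1) ≤ ‖(c + τ * I : ℂ)‖ := by
    rw [div_le_iff₀ hK]; linarith
  calc _ ≤ ((1 + |τ|) / (1 / |c| + 1)) ^ (-p) :=
        Real.rpow_le_rpow_of_nonpos (by positivity) h3 (by linarith)
    _ = _ := by
        rw [Real.div_rpow h1.le hK.le, Real.rpow_neg hK.le p, div_inv_eq_mul, mul_comm]

lemma integrable_one_add_abs_rpow {p : ℝ} (hp : 1 < p) :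
    Integrable (fun τ : ℝ => (1 + |τ|) ^ (-p)) := by
  simpa using integrable_one_add_norm (E := ℝ) (μ := volume) (r := p) (by simpa using hp)

lemma add_mul_I_ne_zero {c : ℝ} (hc : c ≠ 0) (τ : ℝ) : (c + τ * I : ℂ) ≠ 0 := by
  intro h
  have := congrArg re h
  simp at this
  exact hc this

lemma integrable_inv_sq_vertical {c : ℝ} (hc : c ≠ 0) :
    Integrable (fun τ : ℝ => ((c + τ * I : ℂ) ^ 2)⁻¹) := by
  refine Integrable.mono' ((integrable_one_add_abs_rpow (p := 2) (by norm_num)).const_mul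
    ((1 / |c| + 1) ^ (2:ℝ))) ?_ (Eventually.of_forall fun τ => ?_)
  · refine Continuous.aestronglyMeasurable (Continuous.inv₀ (by fun_prop) fun τ => ?_)
    exact pow_ne_zero _ (add_mul_I_ne_zero hc τ)
  · have := norm_rpow_neg_le hc (p := 2) (by norm_num) τ
    rw [norm_inv, norm_pow]
    rw [Real.rpow_neg (norm_nonneg _), Real.rpow_ofNat] at this
    exact this

lemma norm_cpow_vertical {c u : ℝ} (hu : 0 < u) (τ : ℝ) : ‖(u : ℂ) ^ (c + τ * I : ℂ)‖ = u ^ c := by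
  rw [norm_cpow_eq_rpow_re_of_pos hu]; simp

lemma integrable_perron_kernel {c : ℝ} (hc : c ≠ 0) {u : ℝ} (hu : 0 < u) :
    Integrable (fun τ : ℝ => (u : ℂ) ^ (c + τ * I : ℂ) * ((c + τ * I : ℂ) ^ 2)⁻¹) := by
  refine (integrable_inv_sq_vertical hc).bdd_mul (c := u ^ c) ?_
    (Eventually.of_forall fun τ => (norm_cpow_vertical hu τ).le)
  refine Continuous.aestronglyMeasurable (Continuous.const_cpow (by fun_prop) (Or.inl ?_))
  exact_mod_cast hu.ne'

/-- Perron's formula with the kernel `u ^ w / w ^ 2`. -/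
lemma integral_perron_kernel {c : ℝ} (hc : 0 < c) {u : ℝ} (hu : 0 < u) :
    ∫ τ : ℝ, (u : ℂ) ^ (c + τ * I : ℂ) * ((c + τ * I : ℂ) ^ 2)⁻¹ =
      2 * Real.pi * (max (Real.log u) 0 : ℝ) := by
  set f : ℝ → ℂ := (Ioc (0:ℝ) 1).indicator (fun _ => (1:ℂ)) with hf
  have hfloc : LocallyIntegrableOn f (Ioi 0) := by
    have : LocallyIntegrable f := (locallyIntegrable_const (1:ℂ)).indicator measurableSet_Ioc
    exact this.locallyIntegrableOn _
  have hftop : f =O[atTop] (fun x : ℝ => x ^ (-(10 + c))) := by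
    refine EventuallyEq.trans_isBigO (f₂ := fun _ => (0:ℂ)) ?_ (isBigO_zero _ _)
    filter_upwards [eventually_gt_atTop (1:ℝ)] with x hx
    exact indicator_of_notMem (by simp [hx]) _
  have hfbot : f =O[𝓝[>] 0] (fun x : ℝ => x ^ (-(0:ℝ))) := by
    refine IsBigO.of_bound 1 (Eventually.of_forall fun x => ?_)
    simp only [neg_zero, Real.rpow_zero, norm_one, mul_one]
    exact (norm_indicator_le_norm_self _ _).trans (by simp)
  have hmel : ∀ s : ℂ, 0 < s.re → s.re < 10 + c →
      MellinConvergent (fun t => Real.log t • f t) s ∧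
      mellin (fun t => Real.log t • f t) s = -(s ^ 2)⁻¹ := by
    intro s hs hs'
    obtain ⟨h1, h2⟩ := mellin_hasDerivAt_of_isBigO_rpow hfloc hftop hs' hfbot hs
    refine ⟨h1, ?_⟩
    have h3 : HasDerivAt (fun s : ℂ => s⁻¹) (-(s ^ 2)⁻¹) s :=
      hasDerivAt_inv (by intro h; rw [h] at hs; simp at hs)
    have h4 : (mellin f) =ᶠ[𝓝 s] fun s => s⁻¹ := by
      have : {s : ℂ | 0 < s.re} ∈ 𝓝 s := (isOpen_lt continuous_const continuous_re).mem_nhds hs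
      filter_upwards [this] with z hz
      have := (hasMellin_one_Ioc hz).2
      rw [hf, this, one_div]
    exact h2.unique (h3.congr_of_eventuallyEq h4)
  set g : ℝ → ℂ := fun t => Real.log t • f t with hg
  have hcre : ((c:ℂ)).re = c := by simp
  obtain ⟨hconv, -⟩ := hmel c (by simpa using hc) (by simp)
  have hline : ∀ τ : ℝ, mellin g (c + τ * I) = -((c + τ * I : ℂ) ^ 2)⁻¹ := fun τ =>
    (hmel (c + τ * I) (by simpa using hc) (by simp)).2
  have hu' : 0 < u⁻¹ := inv_pos.mpr hu
  have hgeq : ∀ t : ℝ, 0 < t → g t = ((min (Real.log t) 0 : ℝ) : ℂ) := by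
    intro t ht
    by_cases h1 : t ≤ 1
    · rw [hg]
      simp only [hf]
      rw [indicator_of_mem (show t ∈ Ioc (0:ℝ) 1 from ⟨ht, h1⟩), min_eq_left (Real.log_nonpos ht.le h1)]
      simp
    · rw [hg]
      simp only [hf]
      rw [indicator_of_notMem (by simp [h1]), min_eq_right (Real.log_nonneg (by linarith))]
      simp
  have hgc : ContinuousAt g u⁻¹ := by
    have h1 : ContinuousAt (fun t : ℝ => ((min (Real.log t) 0 : ℝ) : ℂ)) u⁻¹ :=
      continuous_ofReal.continuousAt.comp
        ((Real.continuousAt_log hu'.ne').min continuousAt_const)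
    refine h1.congr ?_
    filter_upwards [Ioi_mem_nhds hu'] with t ht using (hgeq t ht).symm
  have hinv := mellinInv_mellin_eq c g hu' hconv (by
    refine (integrable_inv_sq_vertical hc.ne').neg.congr (Eventually.of_forall fun τ => ?_)
    simp [hline]) hgc
  rw [hgeq _ hu', mellinInv] at hinv
  simp only [hline, smul_eq_mul, mul_neg, integral_neg, Real.log_inv] at hinv
  have h5 : ∀ τ : ℝ, ((u⁻¹ : ℝ) : ℂ) ^ (-(c + τ * I : ℂ)) = (u : ℂ) ^ (c + τ * I : ℂ) := by
    intro τ
    rw [ofReal_inv, inv_cpow _ _ (by rw [arg_ofReal_of_nonneg hu.le]; exact Real.pi_pos.ne), cpow_neg, inv_inv]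
  simp only [h5] at hinv
  have h6 : (min (-Real.log u) 0 : ℝ) = - max (Real.log u) 0 := by
    rw [← neg_zero, min_neg_neg, neg_zero]
  rw [h6, Complex.real_smul] at hinv
  push_cast at hinv ⊢
  have hpi : (Real.pi : ℂ) ≠ 0 := by exact_mod_cast Real.pi_pos.ne'
  have h7 := congrArg (fun z => -(2 * (Real.pi : ℂ)) * z) hinv
  rw [← mul_assoc, show -(2 * (Real.pi : ℂ)) * (1 / (2 * Real.pi)) = -1 by field_simp] at h7
  linear_combination h7

/-- Moving a contour integral across a vertical strip. -/
lemma integral_vertical_eq_of_differentiableOn {g : ℂ → ℂ} {a b : ℝ} (hab : a ≤ b)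
    (hg : ∀ z : ℂ, a ≤ z.re → z.re ≤ b → DifferentiableAt ℂ g z) {M p : ℝ} (hp : 0 < p)
    (hM : ∀ x τ : ℝ, a ≤ x → x ≤ b → 1 ≤ |τ| → ‖g (x + τ * I)‖ ≤ M * |τ| ^ (-p))
    (ha : Integrable (fun τ : ℝ => g (a + τ * I))) (hb : Integrable (fun τ : ℝ => g (b + τ * I))) :
    ∫ τ : ℝ, g (a + τ * I) = ∫ τ : ℝ, g (b + τ * I) := by
  have hrect : ∀ T : ℝ, (((∫ x in a..b, g (x + (-T : ℝ) * I)) - ∫ x in a..b, g (x + T * I)) +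
      I • ∫ τ in (-T)..T, g (b + τ * I)) - I • ∫ τ in (-T)..T, g (a + τ * I) = 0 := by
    intro T
    have := Complex.integral_boundary_rect_eq_zero_of_differentiableOn g (a + (-T : ℝ) * I)
      (b + T * I) (by
        intro z hz
        rw [mem_reProdIm] at hz
        have h1 := hz.1
        simp only [add_re, ofReal_re, mul_re, I_re, mul_zero, ofReal_im, I_im, mul_one,
          sub_self, add_zero] at h1
        rw [uIcc_of_le hab] at h1
        exact (hg z h1.1 h1.2).differentiableWithinAt)
    simpa using this
  have hlimb := intervalIntegral_tendsto_integral hb tendsto_neg_atTop_atBot tendsto_id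
  have hlima := intervalIntegral_tendsto_integral ha tendsto_neg_atTop_atBot tendsto_id
  have hhor : ∀ ε : ℝ, |ε| = 1 → Tendsto (fun T : ℝ => ∫ x in a..b, g (x + (ε * T : ℝ) * I)) atTop (𝓝 0) := by
    intro ε hε
    have h0 : Tendsto (fun T : ℝ => M * T ^ (-p) * |b - a|) atTop (𝓝 0) := by
      have := ((tendsto_rpow_neg_atTop hp).const_mul M).mul_const |b - a|
      simpa using this
    refine squeeze_zero_norm' ?_ h0
    filter_upwards [eventually_ge_atTop (1:ℝ)] with T hT
    refine intervalIntegral.norm_integral_le_of_norm_le_const fun x hx => ?_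
    rw [uIoc_of_le hab] at hx
    have hT' : |ε * T| = T := by rw [abs_mul, hε, one_mul, abs_of_pos (by linarith)]
    have := hM x (ε * T) hx.1.le hx.2 (by rw [hT']; exact hT)
    rwa [hT'] at this
  have h1 := hhor 1 (by simp)
  have h2 := hhor (-1) (by simp)
  simp only [one_mul, neg_one_mul] at h1 h2
  have hall := ((h2.sub h1).add (hlimb.const_smul I)).sub (hlima.const_smul I)
  have hz : Tendsto (fun _ : ℝ => (0:ℂ)) atTop
      (𝓝 (0 - 0 + I • (∫ τ : ℝ, g (b + τ * I)) - I • ∫ τ : ℝ, g (a + τ * I))) := by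
    refine hall.congr fun T => ?_
    exact hrect T
  have h3 := tendsto_nhds_unique hz tendsto_const_nhds
  simp only [smul_eq_mul] at h3
  have h4 : I * ((∫ τ : ℝ, g (b + τ * I)) - ∫ τ : ℝ, g (a + τ * I)) = 0 := by
    linear_combination h3
  rcases mul_eq_zero.mp h4 with h | h
  · exact absurd h I_ne_zero
  · exact (sub_eq_zero.mp h).symm

lemma LSeries_term_add_mul_cpow {a : ℕ → ℂ} {s w : ℂ} {Y : ℝ} (hY : 0 < Y) (n : ℕ) :
    LSeries.term a (s + w) n * (Y : ℂ) ^ w = LSeries.term a s n * ((Y / n : ℝ) : ℂ) ^ w := by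
  rcases eq_or_ne n 0 with rfl | hn
  · simp
  have hn' : (n : ℂ) ≠ 0 := by exact_mod_cast hn
  have hn0 : (0:ℝ) < n := by exact_mod_cast Nat.pos_of_ne_zero hn
  rw [LSeries.term_of_ne_zero hn, LSeries.term_of_ne_zero hn, cpow_add _ _ hn', div_eq_mul_inv Y,
    ofReal_mul, mul_cpow_ofReal_nonneg hY.le (by positivity), ofReal_inv, inv_cpow _ _ (by
      rw [arg_ofReal_of_nonneg hn0.le]; exact Real.pi_pos.ne)]
  simp only [ofReal_natCast]
  have h1 : (n : ℂ) ^ s ≠ 0 := by simp [cpow_eq_zero_iff, hn']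
  have h2 : (n : ℂ) ^ w ≠ 0 := by simp [cpow_eq_zero_iff, hn']
  field_simp

/-- Perron's formula for logarithmically smoothed sums of a Dirichlet series. -/
lemma hasSum_log_perron {a : ℕ → ℂ} {s : ℂ} {c : ℝ} (hc : 0 < c) (ha : LSeriesSummable a (s + c))
    {Y : ℝ} (hY : 0 < Y) :
    HasSum (fun n : ℕ => LSeries.term a s n * (2 * Real.pi * (max (Real.log (Y / n)) 0 : ℝ)))
      (∫ τ : ℝ, LSeries a (s + (c + τ * I)) * ((Y : ℂ) ^ (c + τ * I : ℂ) * ((c + τ * I : ℂ) ^ 2)⁻¹)) := by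
  have hterm : ∀ (n : ℕ) (τ : ℝ), LSeries.term a (s + (c + τ * I)) n *
      ((Y : ℂ) ^ (c + τ * I : ℂ) * ((c + τ * I : ℂ) ^ 2)⁻¹) =
      LSeries.term a s n * (((Y / n : ℝ) : ℂ) ^ (c + τ * I : ℂ) * ((c + τ * I : ℂ) ^ 2)⁻¹) := by
    intro n τ
    rw [← mul_assoc, LSeries_term_add_mul_cpow hY, mul_assoc]
  have h_int : ∀ n : ℕ, Integrable (fun τ : ℝ => LSeries.term a (s + (c + τ * I)) n *
      ((Y : ℂ) ^ (c + τ * I : ℂ) * ((c + τ * I : ℂ) ^ 2)⁻¹)) := by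
    intro n
    simp only [hterm]
    rcases eq_or_ne n 0 with rfl | hn
    · simp
    have hn0 : (0:ℝ) < n := by exact_mod_cast Nat.pos_of_ne_zero hn
    exact (integrable_perron_kernel hc.ne' (div_pos hY hn0)).const_mul _
  have hnorm : ∀ n : ℕ, ∫ τ : ℝ, ‖LSeries.term a (s + (c + τ * I)) n *
      ((Y : ℂ) ^ (c + τ * I : ℂ) * ((c + τ * I : ℂ) ^ 2)⁻¹)‖ =
      ‖LSeries.term a (s + c) n‖ * (Y ^ c * ∫ τ : ℝ, ‖((c + τ * I : ℂ) ^ 2)⁻¹‖) := by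
    intro n
    rw [← integral_const_mul, ← integral_const_mul]
    congr 1
    ext τ
    rw [norm_mul, norm_mul, norm_cpow_vertical hY, LSeries.norm_term_eq, LSeries.norm_term_eq]
    simp
  have hval : ∀ n : ℕ, ∫ τ : ℝ, LSeries.term a (s + (c + τ * I)) n *
      ((Y : ℂ) ^ (c + τ * I : ℂ) * ((c + τ * I : ℂ) ^ 2)⁻¹) =
      LSeries.term a s n * (2 * Real.pi * (max (Real.log (Y / n)) 0 : ℝ)) := by
    intro n
    simp only [hterm]
    rcases eq_or_ne n 0 with rfl | hn
    · simp
    have hn0 : (0:ℝ) < n := by exact_mod_cast Nat.pos_of_ne_zero hn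
    rw [integral_const_mul, integral_perron_kernel hc (div_pos hY hn0)]
  have := hasSum_integral_of_summable_integral_norm h_int (by
    simp only [hnorm]
    exact (Summable.norm ha).mul_right _)
  simp only [hval, tsum_mul_right] at this
  exact this

/-- The kernel whose Perron integral is the sharp cut-off at a positive integer. -/
def cutKernel (Y : ℕ) (w : ℂ) : ℂ :=
  (((Y + 1 : ℝ) : ℂ) ^ w - ((Y : ℝ) : ℂ) ^ w) / Real.log ((Y + 1) / Y)

lemma inv_le_log_add_one_div {Y : ℕ} (hY : 1 ≤ Y) :
    1 / (2 * (Y : ℝ)) ≤ Real.log (((Y : ℝ) + 1) / Y) := by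
  have hY' : (1:ℝ) ≤ Y := by exact_mod_cast hY
  refine le_trans ?_ (Real.one_sub_inv_le_log_of_pos (by positivity))
  rw [inv_div, one_sub_div (by positivity), add_sub_cancel_left,
    div_le_div_iff₀ (by positivity) (by positivity)]
  linarith

lemma log_add_one_div_pos {Y : ℕ} (hY : 1 ≤ Y) : 0 < Real.log (((Y : ℝ) + 1) / Y) := by
  have hY' : (1:ℝ) ≤ Y := by exact_mod_cast hY
  exact lt_of_lt_of_le (by positivity) (inv_le_log_add_one_div hY)

lemma integrable_LSeries_mul_vertical {a : ℕ → ℂ} {s : ℂ} {c : ℝ} (hc : 0 < c)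
    (ha : LSeries.abscissaOfAbsConv a < (s + c).re)
    {Y : ℝ} (hY : 0 < Y) :
    Integrable (fun τ : ℝ => LSeries a (s + (c + τ * I)) *
      ((Y : ℂ) ^ (c + τ * I : ℂ) * ((c + τ * I : ℂ) ^ 2)⁻¹)) := by
  have hs : LSeriesSummable a (s + c) := LSeriesSummable_of_abscissaOfAbsConv_lt_re ha
  refine (integrable_perron_kernel hc.ne' hY).bdd_mul (c := ∑' n, ‖LSeries.term a (s + c) n‖) ?_
    (Eventually.of_forall fun τ => ?_)
  · refine Continuous.aestronglyMeasurable (continuous_iff_continuousAt.mpr fun τ => ?_)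
    have h1 : DifferentiableAt ℂ (LSeries a) (s + (c + τ * I)) :=
      (LSeries_analyticOnNhd a _ (by simpa using ha)).differentiableAt
    exact ContinuousAt.comp (f := fun τ : ℝ => (s + (c + τ * I) : ℂ)) h1.continuousAt
      (by fun_prop)
  · have hn : ∀ n, ‖LSeries.term a (s + (c + τ * I)) n‖ = ‖LSeries.term a (s + c) n‖ := by
      intro n; rw [LSeries.norm_term_eq, LSeries.norm_term_eq]; simp
    have hsn : Summable fun n => ‖LSeries.term a (s + (c + τ * I)) n‖ := by
      simp only [hn]; exact hs.norm
    simp only [← hn]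
    exact norm_tsum_le_tsum_norm hsn

/-- Perron's formula for partial sums of a Dirichlet series. -/
lemma sum_term_eq_integral {a : ℕ → ℂ} {s : ℂ} {c : ℝ} (hc : 0 < c)
    (ha : LSeries.abscissaOfAbsConv a < (s + c).re) {Y : ℕ} (hY : 1 ≤ Y) :
    2 * Real.pi * ∑ n ∈ Finset.Icc 1 Y, LSeries.term a s n =
      ∫ τ : ℝ, LSeries a (s + (c + τ * I)) * (cutKernel Y (c + τ * I) * ((c + τ * I : ℂ) ^ 2)⁻¹) := by
  have hs : LSeriesSummable a (s + c) := LSeriesSummable_of_abscissaOfAbsConv_lt_re ha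
  have hY0 : (0:ℝ) < Y := by exact_mod_cast hY
  have hY1 : (0:ℝ) < (Y : ℝ) + 1 := by positivity
  have hl := log_add_one_div_pos hY
  have h1 := (hasSum_log_perron hc hs hY1).sub (hasSum_log_perron hc hs hY0)
  rw [← integral_sub (integrable_LSeries_mul_vertical hc ha hY1)
    (integrable_LSeries_mul_vertical hc ha hY0)] at h1
  have h2 : HasSum (fun n : ℕ => LSeries.term a s n *
      (2 * Real.pi * (max (Real.log (((Y : ℝ) + 1) / n)) 0 : ℝ)) -
      LSeries.term a s n * (2 * Real.pi * (max (Real.log ((Y : ℝ) / n)) 0 : ℝ)))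
      (∑ n ∈ Finset.Icc 1 Y, LSeries.term a s n * (2 * Real.pi * Real.log (((Y : ℝ) + 1) / Y))) := by
    have hfin : ∀ n ∈ Finset.Icc 1 Y, LSeries.term a s n *
        (2 * Real.pi * (max (Real.log (((Y : ℝ) + 1) / n)) 0 : ℝ)) -
        LSeries.term a s n * (2 * Real.pi * (max (Real.log ((Y : ℝ) / n)) 0 : ℝ)) =
        LSeries.term a s n * (2 * Real.pi * Real.log (((Y : ℝ) + 1) / Y)) := by
      intro n hn
      rw [Finset.mem_Icc] at hn
      have hn0 : (0:ℝ) < n := by exact_mod_cast hn.1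
      have hnY : (n:ℝ) ≤ Y := by exact_mod_cast hn.2
      rw [max_eq_left (Real.log_nonneg (by rw [le_div_iff₀ hn0]; linarith)),
        max_eq_left (Real.log_nonneg (by rw [le_div_iff₀ hn0]; linarith)),
        Real.log_div hY1.ne' hn0.ne', Real.log_div hY0.ne' hn0.ne', Real.log_div hY1.ne' hY0.ne']
      push_cast
      ring
    rw [← Finset.sum_congr rfl hfin]
    refine hasSum_sum_of_ne_finset_zero fun n hn => ?_
    rcases eq_or_ne n 0 with rfl | hn'
    · simp
    have hn0 : (0:ℝ) < n := by exact_mod_cast Nat.pos_of_ne_zero hn'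
    have hnY : Y + 1 ≤ n := by
      rw [Finset.mem_Icc] at hn; omega
    have hnY' : (Y:ℝ) + 1 ≤ n := by exact_mod_cast hnY
    rw [max_eq_right (Real.log_nonpos (by positivity) (by rw [div_le_iff₀ hn0]; linarith)),
      max_eq_right (Real.log_nonpos (by positivity) (by rw [div_le_iff₀ hn0]; linarith))]
    simp
  have h3 := h2.unique h1
  rw [← Finset.sum_mul] at h3
  have hlc : (Real.log (((Y : ℝ) + 1) / Y) : ℂ) ≠ 0 := by exact_mod_cast hl.ne'
  calc _ = (∑ n ∈ Finset.Icc 1 Y, LSeries.term a s n) *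
        (2 * Real.pi * Real.log (((Y : ℝ) + 1) / Y)) / Real.log (((Y : ℝ) + 1) / Y) := by
        field_simp
    _ = _ := by
      rw [h3, ← integral_div]
      congr 1
      ext τ
      simp only [cutKernel]
      ring

lemma integrable_LSeries_mul_cutKernel {a : ℕ → ℂ} {s : ℂ} {c : ℝ} (hc : 0 < c)
    (ha : LSeries.abscissaOfAbsConv a < (s + c).re) {Y : ℕ} (hY : 1 ≤ Y) :
    Integrable (fun τ : ℝ => LSeries a (s + (c + τ * I)) *
      (cutKernel Y (c + τ * I) * ((c + τ * I : ℂ) ^ 2)⁻¹)) := by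
  have hY0 : (0:ℝ) < Y := by exact_mod_cast hY
  have hY1 : (0:ℝ) < (Y : ℝ) + 1 := by positivity
  refine (((integrable_LSeries_mul_vertical hc ha hY1).sub
    (integrable_LSeries_mul_vertical hc ha hY0)).div_const
      (Real.log (((Y : ℝ) + 1) / Y) : ℂ)).congr (Eventually.of_forall fun τ => ?_)
  simp only [cutKernel, Pi.sub_apply]
  ring

lemma differentiable_cutKernel {Y : ℕ} (hY : 1 ≤ Y) : Differentiable ℂ (cutKernel Y) := by
  have hY0 : ((Y : ℝ) : ℂ) ≠ 0 := by simp; omega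
  have hY1 : (((Y : ℝ) + 1 : ℝ) : ℂ) ≠ 0 := by
    have : (0:ℝ) < (Y : ℝ) + 1 := by positivity
    exact_mod_cast this.ne'
  intro w
  exact ((differentiableAt_id.const_cpow (Or.inl hY1)).sub
    (differentiableAt_id.const_cpow (Or.inl hY0))).div_const _

lemma hasDerivAt_cutKernel_zero {Y : ℕ} (hY : 1 ≤ Y) : HasDerivAt (cutKernel Y) 1 0 := by
  have hY0 : (0:ℝ) < Y := by exact_mod_cast hY
  have hY1 : (0:ℝ) < (Y : ℝ) + 1 := by positivity
  have h0 : ((Y : ℝ) : ℂ) ≠ 0 := by exact_mod_cast hY0.ne'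
  have h1 : (((Y : ℝ) + 1 : ℝ) : ℂ) ≠ 0 := by exact_mod_cast hY1.ne'
  have hlc : (Real.log (((Y : ℝ) + 1) / Y) : ℂ) ≠ 0 := by
    exact_mod_cast (log_add_one_div_pos hY).ne'
  have := (((hasDerivAt_id (0:ℂ)).const_cpow (c := (((Y : ℝ) + 1 : ℝ) : ℂ)) (Or.inl h1)).sub
    ((hasDerivAt_id (0:ℂ)).const_cpow (c := ((Y : ℝ) : ℂ)) (Or.inl h0))).div_const
      (Real.log (((Y : ℝ) + 1) / Y) : ℂ)
  have h2 : ((((Y : ℝ) + 1 : ℝ) : ℂ) ^ (id 0 : ℂ) * log (((Y : ℝ) + 1 : ℝ) : ℂ) * 1 -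
      ((Y : ℝ) : ℂ) ^ (id 0 : ℂ) * log ((Y : ℝ) : ℂ) * 1) / (Real.log (((Y : ℝ) + 1) / Y) : ℂ) = 1 := by
    simp only [id, cpow_zero, one_mul, mul_one]
    rw [← ofReal_log hY1.le, ← ofReal_log hY0.le, ← ofReal_sub, ← Real.log_div hY1.ne' hY0.ne',
      div_self hlc]
  rw [h2] at this
  exact this

lemma cutKernel_zero (Y : ℕ) : cutKernel Y 0 = 0 := by simp [cutKernel]

/-- There is an entire function agreeing with `(cutKernel Y - cutKernel Z) / w ^ 2` away from `0`. -/
lemma exists_entire_cutKernel_sub {Y Z : ℕ} (hY : 1 ≤ Y) (hZ : 1 ≤ Z) :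
    ∃ D : ℂ → ℂ, Differentiable ℂ D ∧
      ∀ w ≠ 0, D w = (cutKernel Y w - cutKernel Z w) * (w ^ 2)⁻¹ := by
  set f : ℂ → ℂ := fun w => cutKernel Y w - cutKernel Z w with hf
  have hfd : Differentiable ℂ f := (differentiable_cutKernel hY).sub (differentiable_cutKernel hZ)
  have hg : Differentiable ℂ (dslope f 0) := by
    rw [← differentiableOn_univ, Complex.differentiableOn_dslope univ_mem]
    exact hfd.differentiableOn
  have hh : Differentiable ℂ (dslope (dslope f 0) 0) := by
    rw [← differentiableOn_univ, Complex.differentiableOn_dslope univ_mem]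
    exact hg.differentiableOn
  refine ⟨_, hh, fun w hw => ?_⟩
  have hd : dslope f 0 0 = 0 := by
    rw [dslope_same]
    have := ((hasDerivAt_cutKernel_zero hY).sub (hasDerivAt_cutKernel_zero hZ)).deriv
    rwa [sub_self] at this
  rw [dslope_of_ne _ hw, slope_def_field, hd, dslope_of_ne _ hw, slope_def_field]
  simp only [hf, cutKernel_zero]
  field_simp
  ring

lemma norm_cutKernel_le {Y : ℕ} (hY : 1 ≤ Y) {w : ℂ} (h1 : w.re ≤ 1 / 2) :
    ‖cutKernel Y w‖ ≤ 6 * (Y : ℝ) ^ 2 := by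
  have hY' : (1:ℝ) ≤ Y := by exact_mod_cast hY
  have hl := inv_le_log_add_one_div hY
  have hl0 := log_add_one_div_pos hY
  have h2 : ‖(((Y + 1 : ℝ) : ℂ) ^ w - ((Y : ℝ) : ℂ) ^ w)‖ ≤ 3 * Y := by
    refine (norm_sub_le _ _).trans ?_
    rw [norm_cpow_eq_rpow_re_of_pos (by linarith), norm_cpow_eq_rpow_re_of_pos (by linarith)]
    have h3 : ((Y : ℝ) + 1) ^ w.re ≤ ((Y : ℝ) + 1) ^ (1:ℝ) :=
      Real.rpow_le_rpow_of_exponent_le (by linarith) (by linarith)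
    have h4 : ((Y : ℝ)) ^ w.re ≤ ((Y : ℝ)) ^ (1:ℝ) :=
      Real.rpow_le_rpow_of_exponent_le (by linarith) (by linarith)
    rw [Real.rpow_one] at h3 h4
    linarith
  rw [cutKernel, norm_div, norm_real, Real.norm_of_nonneg hl0.le, div_le_iff₀ hl0]
  calc _ ≤ 3 * (Y:ℝ) := h2
    _ = 6 * (Y : ℝ) ^ 2 * (1 / (2 * (Y : ℝ))) := by field_simp; ring
    _ ≤ _ := by gcongr

lemma norm_cutKernel_le_neg {Y : ℕ} (hY : 1 ≤ Y) {κ : ℝ} (hκ : 0 < κ) (hκ1 : κ ≤ 1) {w : ℂ}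
    (h1 : w.re = -κ) :
    ‖cutKernel Y w‖ ≤ 4 * (Y : ℝ) ^ (-(κ / 2)) * ‖w‖ ^ (1 - κ / 2) := by
  have hY' : (1:ℝ) ≤ Y := by exact_mod_cast hY
  have hY0 : (0:ℝ) < Y := by linarith
  have hl := inv_le_log_add_one_div hY
  have hl0 := log_add_one_div_pos hY
  set E : ℂ := (((Y + 1 : ℝ) : ℂ) ^ w - ((Y : ℝ) : ℂ) ^ w) with hE
  have hkE : ‖cutKernel Y w‖ ≤ 2 * Y * ‖E‖ := by
    rw [cutKernel, norm_div, norm_real, Real.norm_of_nonneg hl0.le, div_le_iff₀ hl0, ← hE]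
    calc ‖E‖ = 2 * Y * ‖E‖ * (1 / (2 * (Y : ℝ))) := by field_simp
      _ ≤ _ := by gcongr
  have hE1 : ‖E‖ ≤ 2 * (Y : ℝ) ^ (-κ) := by
    refine (norm_sub_le _ _).trans ?_
    rw [norm_cpow_eq_rpow_re_of_pos (by linarith), norm_cpow_eq_rpow_re_of_pos (by linarith), h1]
    have := Real.rpow_le_rpow_of_nonpos hY0 (show (Y : ℝ) ≤ Y + 1 by linarith) (show -κ ≤ 0 by linarith)
    linarith
  have hw0 : w ≠ 0 := by rintro rfl; simp at h1; linarith
  have hE2 : ‖E‖ ≤ ‖w‖ * (Y : ℝ) ^ (-κ - 1) := by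
    have hd : ∀ u ∈ Icc (Y:ℝ) (Y + 1), HasDerivWithinAt (fun u : ℝ => (u : ℂ) ^ w) (w * (u:ℂ) ^ (w - 1))
        (Icc (Y:ℝ) (Y+1)) u := by
      intro u hu
      exact (hasDerivAt_ofReal_cpow_const (by have := hu.1; linarith) hw0).hasDerivWithinAt
    have := (convex_Icc (Y:ℝ) (Y+1)).norm_image_sub_le_of_norm_hasDerivWithin_le (C := ‖w‖ * (Y : ℝ) ^ (-κ - 1)) hd (by
      intro u hu
      have hu0 : 0 < u := by have := hu.1; linarith
      rw [norm_mul, norm_cpow_eq_rpow_re_of_pos hu0]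
      simp only [sub_re, one_re, h1]
      gcongr ?_ * ?_
      exact Real.rpow_le_rpow_of_nonpos hY0 hu.1 (by linarith)) (left_mem_Icc.mpr (by linarith))
      (right_mem_Icc.mpr (by linarith))
    simpa [hE] using this
  have hA : ‖cutKernel Y w‖ ≤ 4 * (Y : ℝ) ^ (1 - κ) := by
    calc _ ≤ 2 * Y * (2 * (Y : ℝ) ^ (-κ)) := hkE.trans (by gcongr)
      _ = 4 * ((Y:ℝ) ^ (1:ℝ) * (Y : ℝ) ^ (-κ)) := by rw [Real.rpow_one]; ring
      _ = _ := by rw [← Real.rpow_add hY0]; ring_nf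
  have hB : ‖cutKernel Y w‖ ≤ 4 * (‖w‖ * (Y : ℝ) ^ (-κ)) := by
    calc _ ≤ 2 * Y * (‖w‖ * (Y : ℝ) ^ (-κ - 1)) := hkE.trans (by gcongr)
      _ = 2 * (‖w‖ * ((Y:ℝ) ^ (1:ℝ) * (Y : ℝ) ^ (-κ - 1))) := by rw [Real.rpow_one]; ring
      _ = 2 * (‖w‖ * (Y : ℝ) ^ (-κ)) := by rw [← Real.rpow_add hY0]; ring_nf
      _ ≤ _ := by
        have : 0 ≤ ‖w‖ * (Y : ℝ) ^ (-κ) := by positivity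
        linarith
  have hk0 : 0 ≤ ‖cutKernel Y w‖ := norm_nonneg _
  calc ‖cutKernel Y w‖ = ‖cutKernel Y w‖ ^ (κ / 2) * ‖cutKernel Y w‖ ^ (1 - κ / 2) := by
        rw [← Real.rpow_add_of_nonneg hk0 (by linarith) (by linarith)]; simp
    _ ≤ (4 * (Y : ℝ) ^ (1 - κ)) ^ (κ / 2) * (4 * (‖w‖ * (Y : ℝ) ^ (-κ))) ^ (1 - κ / 2) := by
        gcongr
        linarith
    _ = (4 ^ (κ / 2) * 4 ^ (1 - κ / 2)) * ((Y : ℝ) ^ ((1 - κ) * (κ / 2)) * (Y : ℝ) ^ (-κ * (1 - κ / 2)))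
          * ‖w‖ ^ (1 - κ / 2) := by
        rw [Real.mul_rpow (by norm_num) (by positivity), Real.mul_rpow (by norm_num) (by positivity),
          Real.mul_rpow (by positivity) (by positivity), ← Real.rpow_mul hY0.le, ← Real.rpow_mul hY0.le]
        ring
    _ = _ := by
        rw [← Real.rpow_add (by norm_num), ← Real.rpow_add hY0]
        rw [show κ / 2 + (1 - κ / 2) = 1 by ring, show (1 - κ) * (κ / 2) + -κ * (1 - κ / 2) = -(κ / 2) by ring,
          Real.rpow_one]

lemma norm_inv_sq_eq_rpow (w : ℂ) : ‖(w ^ 2)⁻¹‖ = ‖w‖ ^ (-2 : ℝ) := by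
  rw [norm_inv, norm_pow, Real.rpow_neg (norm_nonneg _), Real.rpow_ofNat]

lemma norm_entire_cut_le {Y Z : ℕ} (hZ : 1 ≤ Z) (hZY : Z ≤ Y) {D : ℂ → ℂ}
    (hD : ∀ w ≠ 0, D w = (cutKernel Y w - cutKernel Z w) * (w ^ 2)⁻¹) {w : ℂ} (hw : w ≠ 0)
    (hw2 : w.re ≤ 1 / 2) : ‖D w‖ ≤ 12 * (Y : ℝ) ^ 2 * ‖w‖ ^ (-2 : ℝ) := by
  rw [hD w hw, norm_mul, norm_inv_sq_eq_rpow]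
  have hZY' : (Z : ℝ) ≤ Y := by exact_mod_cast hZY
  gcongr
  calc _ ≤ ‖cutKernel Y w‖ + ‖cutKernel Z w‖ := norm_sub_le _ _
    _ ≤ 6 * (Y : ℝ) ^ 2 + 6 * (Z : ℝ) ^ 2 :=
      add_le_add (norm_cutKernel_le (hZ.trans hZY) hw2) (norm_cutKernel_le hZ hw2)
    _ ≤ 6 * (Y : ℝ) ^ 2 + 6 * (Y : ℝ) ^ 2 := by gcongr
    _ = _ := by ring

lemma norm_entire_cut_le_neg {Y Z : ℕ} (hZ : 1 ≤ Z) (hZY : Z ≤ Y) {D : ℂ → ℂ}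
    (hD : ∀ w ≠ 0, D w = (cutKernel Y w - cutKernel Z w) * (w ^ 2)⁻¹) {κ : ℝ} (hκ : 0 < κ)
    (hκ1 : κ ≤ 1) {w : ℂ} (hw : w ≠ 0)
    (hw2 : w.re = -κ) : ‖D w‖ ≤ 8 * (Z : ℝ) ^ (-(κ / 2)) * ‖w‖ ^ (-(1 + κ / 2)) := by
  rw [hD w hw, norm_mul, norm_inv_sq_eq_rpow]
  have hZ0 : (0 : ℝ) < Z := by exact_mod_cast hZ
  have hw0 : 0 < ‖w‖ := norm_pos_iff.mpr hw
  have hZY' : (Z : ℝ) ≤ Y := by exact_mod_cast hZY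
  have h1 : (Y : ℝ) ^ (-(κ / 2)) ≤ (Z : ℝ) ^ (-(κ / 2)) :=
    Real.rpow_le_rpow_of_nonpos hZ0 hZY' (by linarith)
  calc _ ≤ (‖cutKernel Y w‖ + ‖cutKernel Z w‖) * ‖w‖ ^ (-2 : ℝ) := by gcongr; exact norm_sub_le _ _
    _ ≤ (4 * (Z : ℝ) ^ (-(κ / 2)) * ‖w‖ ^ (1 - κ / 2) +
        4 * (Z : ℝ) ^ (-(κ / 2)) * ‖w‖ ^ (1 - κ / 2)) * ‖w‖ ^ (-2 : ℝ) := by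
      gcongr
      · exact (norm_cutKernel_le_neg (hZ.trans hZY) hκ hκ1 hw2).trans (by gcongr)
      · exact norm_cutKernel_le_neg hZ hκ hκ1 hw2
    _ = 8 * (Z : ℝ) ^ (-(κ / 2)) * (‖w‖ ^ (1 - κ / 2) * ‖w‖ ^ (-2 : ℝ)) := by ring
    _ = _ := by rw [← Real.rpow_add hw0]; ring_nf

lemma norm_integral_mul_entire_cut_le {κ : ℝ} (hκ : 0 < κ) (hκ1 : κ ≤ 1) :
    ∃ C > (0:ℝ), ∀ (f : ℂ → ℂ) (L : ℝ) (Y Z : ℕ) (D : ℂ → ℂ), 0 ≤ L → 1 ≤ Z → Z ≤ Y →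
      Differentiable ℂ D → (∀ w ≠ 0, D w = (cutKernel Y w - cutKernel Z w) * (w ^ 2)⁻¹) →
      (∀ w : ℂ, -κ ≤ w.re → w.re ≤ 1 / 2 → DifferentiableAt ℂ f w) →
      (∀ w : ℂ, -κ ≤ w.re → w.re ≤ 1 / 2 → ‖f w‖ ≤ L * (1 + |w.im|) ^ (κ / 4)) →
      Integrable (fun τ : ℝ => f ((1 / 2 : ℝ) + τ * I) * D ((1 / 2 : ℝ) + τ * I)) ∧
      ‖∫ τ : ℝ, f ((1 / 2 : ℝ) + τ * I) * D ((1 / 2 : ℝ) + τ * I)‖ ≤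
        C * L * (Z : ℝ) ^ (-(κ / 2)) := by
  set K : ℝ := (1 / |(-κ)| + 1) ^ (1 + κ / 2) with hK
  have hK0 : 0 ≤ K := by positivity
  set J : ℝ := ∫ τ : ℝ, (1 + |τ|) ^ (-(1 + κ / 4)) with hJ
  have hJ0 : 0 ≤ J := integral_nonneg fun τ => by positivity
  refine ⟨8 * K * J + 1, by positivity, fun f L Y Z D hL hZ hZY hDd hD hf hfb => ?_⟩
  have hcont : ∀ c : ℝ, -κ ≤ c → c ≤ 1 / 2 →
      Continuous (fun τ : ℝ => f (c + τ * I) * D (c + τ * I)) := by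
    intro c h1 h2
    refine continuous_iff_continuousAt.mpr fun τ => ?_
    have h3 : ContinuousAt f (c + τ * I) := (hf _ (by simpa using h1) (by simpa using h2)).continuousAt
    have h4 : ContinuousAt D (c + τ * I) := (hDd _).continuousAt
    exact (ContinuousAt.comp (f := fun τ : ℝ => (c + τ * I : ℂ)) h3 (by fun_prop)).mul
      (ContinuousAt.comp (f := fun τ : ℝ => (c + τ * I : ℂ)) h4 (by fun_prop))
  have hbnd : ∀ τ : ℝ, ‖f ((-κ : ℝ) + τ * I) * D ((-κ : ℝ) + τ * I)‖ ≤
      8 * K * L * (Z : ℝ) ^ (-(κ / 2)) * (1 + |τ|) ^ (-(1 + κ / 4)) := by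
    intro τ
    have h1 : 0 < 1 + |τ| := by positivity
    have hw := add_mul_I_ne_zero (c := -κ) (by linarith) τ
    have h2 := norm_rpow_neg_le (c := -κ) (by linarith) (p := 1 + κ / 2) (by linarith) τ
    have h3 := hfb ((-κ : ℝ) + τ * I) (by simp) (by simp; linarith)
    have h4 := norm_entire_cut_le_neg hZ hZY hD hκ hκ1 hw (by simp)
    simp only [add_im, ofReal_im, mul_im, ofReal_re, I_im, mul_one, I_re, mul_zero, add_zero,
      zero_add] at h3
    rw [norm_mul]
    calc _ ≤ (L * (1 + |τ|) ^ (κ / 4)) * (8 * (Z : ℝ) ^ (-(κ / 2)) *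
          (K * (1 + |τ|) ^ (-(1 + κ / 2)))) := by
          refine mul_le_mul h3 (h4.trans ?_) (norm_nonneg _) (by positivity)
          gcongr
      _ = 8 * K * L * (Z : ℝ) ^ (-(κ / 2)) * ((1 + |τ|) ^ (κ / 4) * (1 + |τ|) ^ (-(1 + κ / 2))) := by
          ring
      _ = _ := by rw [← Real.rpow_add h1]; ring_nf
  have hint1 : Integrable (fun τ : ℝ => f ((-κ : ℝ) + τ * I) * D ((-κ : ℝ) + τ * I)) :=
    Integrable.mono' ((integrable_one_add_abs_rpow (p := 1 + κ / 4) (by linarith)).const_mul _)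
      (hcont _ le_rfl (by linarith)).aestronglyMeasurable (Eventually.of_forall hbnd)
  have hint2 : Integrable (fun τ : ℝ => f ((1 / 2 : ℝ) + τ * I) * D ((1 / 2 : ℝ) + τ * I)) := by
    refine Integrable.mono' ((integrable_one_add_abs_rpow (p := 3 / 2) (by norm_num)).const_mul
      (L * (12 * (Y : ℝ) ^ 2 * (1 / |(1/2 : ℝ)| + 1) ^ (2:ℝ))))
      (hcont _ (by linarith) (by norm_num)).aestronglyMeasurable (Eventually.of_forall fun τ => ?_)
    have h1 : 1 ≤ 1 + |τ| := by linarith [abs_nonneg τ]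
    have hw := add_mul_I_ne_zero (c := 1 / 2) (by norm_num) τ
    have h2 := norm_rpow_neg_le (c := 1 / 2) (by norm_num) (p := 2) (by norm_num) τ
    have h3 := hfb ((1 / 2 : ℝ) + τ * I) (by simp; linarith) (by simp)
    have h4 := norm_entire_cut_le hZ hZY hD hw (by simp)
    simp only [add_im, ofReal_im, mul_im, ofReal_re, I_im, mul_one, I_re, mul_zero, add_zero,
      zero_add] at h3
    rw [norm_mul]
    calc _ ≤ (L * (1 + |τ|) ^ (κ / 4)) * (12 * (Y : ℝ) ^ 2 * ((1 / |(1/2 : ℝ)| + 1) ^ (2:ℝ) *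
          (1 + |τ|) ^ (-2 : ℝ))) := by
          refine mul_le_mul h3 (h4.trans ?_) (norm_nonneg _) (by positivity)
          gcongr
      _ = (L * (12 * (Y : ℝ) ^ 2 * (1 / |(1/2 : ℝ)| + 1) ^ (2:ℝ))) *
          ((1 + |τ|) ^ (κ / 4) * (1 + |τ|) ^ (-2 : ℝ)) := by ring
      _ ≤ _ := by
        rw [← Real.rpow_add (by linarith)]
        gcongr
        linarith
  refine ⟨hint2, ?_⟩
  rw [← integral_vertical_eq_of_differentiableOn (g := fun w => f w * D w) (a := -κ) (b := 1 / 2)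
    (by linarith) (fun z h1 h2 => (hf z h1 h2).mul (hDd z)) (M := 24 * L * (Y : ℝ) ^ 2) (p := 1)
    one_pos ?_ hint1 hint2]
  · refine (norm_integral_le_of_norm_le ((integrable_one_add_abs_rpow (p := 1 + κ / 4)
      (by linarith)).const_mul _) (Eventually.of_forall hbnd)).trans ?_
    rw [integral_const_mul, ← hJ]
    have : 0 ≤ L * (Z : ℝ) ^ (-(κ / 2)) := by positivity
    nlinarith
  · intro x τ hx1 hx2 hτ
    have hτ0 : 0 < |τ| := by linarith
    have hw : (x + τ * I : ℂ) ≠ 0 := by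
      intro h
      have := congrArg im h
      simp at this
      rw [this] at hτ; simp at hτ; linarith
    have h3 := hfb (x + τ * I) (by simpa using hx1) (by simpa using hx2)
    have h4 := norm_entire_cut_le hZ hZY hD hw (by simpa using hx2)
    have h5 : |τ| ≤ ‖(x + τ * I : ℂ)‖ := by simpa using Complex.abs_im_le_norm (x + τ * I : ℂ)
    simp only [add_im, ofReal_im, mul_im, ofReal_re, I_im, mul_one, I_re, mul_zero, add_zero,
      zero_add] at h3
    rw [norm_mul]
    have h6 : (1 + |τ|) ^ (κ / 4) ≤ 2 * |τ| := by
      calc _ ≤ (1 + |τ|) ^ (1:ℝ) := Real.rpow_le_rpow_of_exponent_le (by linarith) (by linarith)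
        _ ≤ _ := by rw [Real.rpow_one]; linarith
    calc _ ≤ (L * (2 * |τ|)) * (12 * (Y : ℝ) ^ 2 * |τ| ^ (-2 : ℝ)) := by
          refine mul_le_mul (h3.trans (by gcongr)) (h4.trans ?_) (norm_nonneg _) (by positivity)
          gcongr 12 * (Y : ℝ) ^ 2 * ?_
          exact Real.rpow_le_rpow_of_nonpos hτ0 h5 (by norm_num)
      _ = _ := by
        rw [Real.rpow_neg hτ0.le, Real.rpow_neg hτ0.le, Real.rpow_one, Real.rpow_ofNat]
        field_simp
        ring

lemma norm_integral_inv_mul_entire_cut_le {κ : ℝ} (hκ : 0 < κ) :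
    ∃ C > (0:ℝ), ∀ (s : ℂ) (Y Z : ℕ) (D : ℂ → ℂ), 1 ≤ Z → Z ≤ Y →
      (∀ w ≠ 0, D w = (cutKernel Y w - cutKernel Z w) * (w ^ 2)⁻¹) →
      1 / 2 + κ ≤ s.re → (Y : ℝ) ^ 4 ≤ |s.im| →
      ‖∫ τ : ℝ, (s + ((1 / 2 : ℝ) + τ * I) - 1)⁻¹ * D ((1 / 2 : ℝ) + τ * I)‖ ≤ C := by
  set J : ℝ := ∫ τ : ℝ, (1 + |τ|) ^ (-(3 / 2 : ℝ)) with hJ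
  have hJ0 : 0 ≤ J := integral_nonneg fun τ => by positivity
  set K1 : ℝ := (1 / |(1/2 : ℝ)| + 1) ^ (2:ℝ) with hK1
  set K2 : ℝ := (1 / κ) ^ (1 / 2 : ℝ) * (1 / κ + 1) ^ (1 / 2 : ℝ) with hK2
  have hK1' : 0 ≤ K1 := by positivity
  have hK2' : 0 ≤ K2 := by positivity
  refine ⟨12 * K1 * K2 * J + 1, by positivity, fun s Y Z D hZ hZY hD hs ht => ?_⟩
  have hY : (1:ℝ) ≤ Y := by exact_mod_cast hZ.trans hZY
  have hbnd : ∀ τ : ℝ, ‖(s + ((1 / 2 : ℝ) + τ * I) - 1)⁻¹ * D ((1 / 2 : ℝ) + τ * I)‖ ≤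
      12 * K1 * K2 * (1 + |τ|) ^ (-(3 / 2) : ℝ) := by
    intro τ
    have h1 : 0 < 1 + |τ| := by positivity
    have hw := add_mul_I_ne_zero (c := 1 / 2) (by norm_num) τ
    have h2 := norm_rpow_neg_le (c := 1 / 2) (by norm_num) (p := 2) (by norm_num) τ
    have h4 := norm_entire_cut_le hZ hZY hD hw (by simp)
    set z : ℂ := s + ((1 / 2 : ℝ) + τ * I) - 1 with hz
    have hzre : z.re = s.re - 1 / 2 := by simp [hz]; ring
    have hzim : z.im = s.im + τ := by simp [hz]
    have h5 : κ ≤ ‖z‖ := by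
      have := Complex.abs_re_le_norm z
      rw [hzre] at this
      linarith [le_abs_self (s.re - 1 / 2)]
    have h6 : |s.im + τ| ≤ ‖z‖ := by rw [← hzim]; exact Complex.abs_im_le_norm z
    have hz0 : 0 < ‖z‖ := hκ.trans_le h5
    have h7 : |s.im| ≤ (1 + |τ|) * ((1 / κ + 1) * ‖z‖) := by
      have h8 : 1 ≤ 1 / κ * ‖z‖ := by
        rw [div_mul_eq_mul_div, one_mul, le_div_iff₀ hκ]; linarith
      have h9 : |s.im| ≤ |s.im + τ| + |τ| := by
        have := abs_sub (s.im + τ) τ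
        simpa using this
      have h10 : 1 + |s.im + τ| ≤ (1 / κ + 1) * ‖z‖ := by linarith
      calc |s.im| ≤ (1 + |τ|) * (1 + |s.im + τ|) := by
            nlinarith [abs_nonneg τ, abs_nonneg (s.im + τ)]
        _ ≤ _ := by gcongr
    have h11 : ((Y:ℝ) ^ 2) ≤ (1 + |τ|) ^ (1/2 : ℝ) * ((1 / κ + 1) ^ (1/2 : ℝ) * ‖z‖ ^ (1 / 2 : ℝ)) := by
      rw [← Real.mul_rpow (by positivity) (by positivity), ← Real.mul_rpow (by positivity) (by positivity)]
      calc ((Y:ℝ) ^ 2) = ((Y : ℝ) ^ 4) ^ (1 / 2 : ℝ) := by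
            rw [← Real.rpow_natCast, ← Real.rpow_natCast, ← Real.rpow_mul (by linarith)]; norm_num
        _ ≤ _ := by
          gcongr
          exact ht.trans h7
    have h12 : 1 ≤ (1 / κ) ^ (1 / 2 : ℝ) * ‖z‖ ^ (1 / 2 : ℝ) := by
      rw [← Real.mul_rpow (by positivity) (by positivity)]
      refine Real.one_le_rpow ?_ (by norm_num)
      rw [div_mul_eq_mul_div, one_mul, le_div_iff₀ hκ]; linarith
    have h13 : (Y:ℝ) ^ 2 ≤ K2 * (1 + |τ|) ^ (1/2 : ℝ) * ‖z‖ := by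
      calc (Y:ℝ) ^ 2 ≤ (1 + |τ|) ^ (1/2 : ℝ) * ((1 / κ + 1) ^ (1/2 : ℝ) * ‖z‖ ^ (1 / 2 : ℝ)) * 1 := by
            rw [mul_one]; exact h11
        _ ≤ (1 + |τ|) ^ (1/2 : ℝ) * ((1 / κ + 1) ^ (1/2 : ℝ) * ‖z‖ ^ (1 / 2 : ℝ)) *
            ((1 / κ) ^ (1 / 2 : ℝ) * ‖z‖ ^ (1 / 2 : ℝ)) := by gcongr
        _ = K2 * (1 + |τ|) ^ (1/2 : ℝ) * (‖z‖ ^ (1 / 2 : ℝ) * ‖z‖ ^ (1 / 2 : ℝ)) := by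
            rw [hK2]; ring
        _ = _ := by rw [← Real.rpow_add hz0]; norm_num
    rw [norm_mul, norm_inv, inv_mul_le_iff₀ hz0]
    calc _ ≤ 12 * (Y:ℝ) ^ 2 * (K1 * (1 + |τ|) ^ (-2 : ℝ)) := h4.trans (by gcongr)
      _ ≤ 12 * (K2 * (1 + |τ|) ^ (1/2 : ℝ) * ‖z‖) * (K1 * (1 + |τ|) ^ (-2 : ℝ)) := by gcongr
      _ = ‖z‖ * (12 * K1 * K2 * ((1 + |τ|) ^ (1/2 : ℝ) * (1 + |τ|) ^ (-2 : ℝ))) := by ring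
      _ = _ := by rw [← Real.rpow_add h1]; norm_num
  refine (norm_integral_le_of_norm_le ((integrable_one_add_abs_rpow (p := 3 / 2)
      (by norm_num)).const_mul _) (Eventually.of_forall hbnd)).trans ?_
  rw [integral_const_mul]
  linarith

/-- The coefficients `χ(n) Λ(n)`. -/
def mangoldtTwist {N : ℕ} (χ : DirichletCharacter ℂ N) : ℕ → ℂ :=
  (fun n : ℕ => χ n) * fun n : ℕ => (ArithmeticFunction.vonMangoldt n : ℂ)

lemma abscissa_mangoldtTwist_lt {N : ℕ} (χ : DirichletCharacter ℂ N) {s : ℂ} (hs : 1 < s.re) :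
    LSeries.abscissaOfAbsConv (mangoldtTwist χ) < s.re := by
  refine lt_of_le_of_lt (LSeries.abscissaOfAbsConv_le_of_forall_lt_LSeriesSummable (x := 1)
    fun y hy => ?_) (by exact_mod_cast hs)
  exact DirichletCharacter.LSeriesSummable_twist_vonMangoldt χ (by simpa using hy)

lemma LSeries_mangoldtTwist_eq (hGRH : GRH) {N : ℕ} [NeZero N] (χ : DirichletCharacter ℂ N) {s : ℂ}
    (hs : 1 < s.re) :
    LSeries (mangoldtTwist χ) s =
      -(deriv (regL χ) s / regL χ s) + (if χ = 1 then 1 else 0) * (s - 1)⁻¹ := by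
  have hs1 : s ≠ 1 := by rintro rfl; simp at hs
  have hs1' : s - 1 ≠ 0 := sub_ne_zero.mpr hs1
  have hne : regL χ s ≠ 0 := regL_ne_zero hGRH χ (by linarith)
  have hL : DirichletCharacter.LFunction χ s ≠ 0 := by
    intro h
    rw [regL_eq_of_ne_one χ hs1, h, mul_zero] at hne
    exact hne rfl
  have h1 : LSeries (mangoldtTwist χ) s =
      -deriv (DirichletCharacter.LFunction χ) s / DirichletCharacter.LFunction χ s := by
    rw [mangoldtTwist, DirichletCharacter.LSeries_twist_vonMangoldt_eq χ hs,
      DirichletCharacter.deriv_LFunction_eq_deriv_LSeries χ hs,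
      DirichletCharacter.LFunction_eq_LSeries χ hs]
  have hLd : DifferentiableAt ℂ (DirichletCharacter.LFunction χ) s :=
    DirichletCharacter.differentiableAt_LFunction χ s (Or.inl hs1)
  have h2 : deriv (regL χ) s = (if χ = 1 then 1 else 0) * DirichletCharacter.LFunction χ s +
      (if χ = 1 then s - 1 else 1) * deriv (DirichletCharacter.LFunction χ) s := by
    have heq : regL χ =ᶠ[𝓝 s] fun z => (if χ = 1 then z - 1 else 1) *
        DirichletCharacter.LFunction χ z := by
      filter_upwards [isOpen_ne.mem_nhds hs1] with z hz using regL_eq_of_ne_one χ hz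
    rw [heq.deriv_eq]
    split_ifs with h
    · have := ((hasDerivAt_id s).sub_const 1).mul hLd.hasDerivAt
      exact this.deriv
    · simp
  rw [h1, h2, regL_eq_of_ne_one χ hs1]
  split_ifs with h
  · field_simp
    ring
  · simp [neg_div]

lemma norm_mangoldtTwist_term_le {N : ℕ} (χ : DirichletCharacter ℂ N) {s : ℂ} (hs : 1 / 2 ≤ s.re)
    (n : ℕ) : ‖LSeries.term (mangoldtTwist χ) s n‖ ≤ 2 := by
  rcases eq_or_ne n 0 with rfl | hn
  · simp
  have hn1 : (1:ℝ) ≤ n := by exact_mod_cast Nat.one_le_iff_ne_zero.mpr hn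
  rw [LSeries.norm_term_eq, if_neg hn, div_le_iff₀ (by positivity)]
  have h1 : ‖mangoldtTwist χ n‖ ≤ Real.log n := by
    simp only [mangoldtTwist, Pi.mul_apply, norm_mul, norm_real]
    rw [Real.norm_of_nonneg ArithmeticFunction.vonMangoldt_nonneg]
    calc _ ≤ 1 * Real.log n := mul_le_mul (χ.norm_le_one _)
          ArithmeticFunction.vonMangoldt_le_log ArithmeticFunction.vonMangoldt_nonneg zero_le_one
      _ = _ := one_mul _
  have h2 := Real.log_le_rpow_div (show (0:ℝ) ≤ n by linarith) (show (0:ℝ) < 1 / 2 by norm_num)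
  have h3 : (n:ℝ) ^ (1 / 2 : ℝ) ≤ (n:ℝ) ^ s.re := Real.rpow_le_rpow_of_exponent_le hn1 hs
  linarith

lemma norm_sum_mangoldtTwist_le_trivial {N : ℕ} (χ : DirichletCharacter ℂ N) {s : ℂ}
    (hs : 1 / 2 ≤ s.re) (Z : ℕ) :
    ‖∑ n ∈ Finset.Icc 1 Z, LSeries.term (mangoldtTwist χ) s n‖ ≤ 2 * Z := by
  refine (norm_sum_le_of_le _ fun n _ => norm_mangoldtTwist_term_le χ hs n).trans ?_
  simp [mul_comm]

lemma log_add_le {N : ℕ} (hN : 1 ≤ N) {κ : ℝ} (hκ : 0 < κ) (hκ1 : κ ≤ 1) (t τ : ℝ) :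
    Real.log (N * (|t + τ| + 2)) ≤
      (4 / κ) * (Real.log (N * (|t| + 2)) + 1) * (1 + |τ|) ^ (κ / 4) := by
  have hN' : (1:ℝ) ≤ N := by exact_mod_cast hN
  have h1 : (N:ℝ) * (|t + τ| + 2) ≤ (N * (|t| + 2)) * (1 + |τ|) := by
    have := abs_add_le t τ
    have h0 := abs_nonneg t
    have h0' := abs_nonneg τ
    rw [mul_assoc]
    gcongr
    nlinarith
  have hQ : 1 ≤ (N:ℝ) * (|t| + 2) := by nlinarith [abs_nonneg t]
  have hτ : 1 ≤ 1 + |τ| := by linarith [abs_nonneg τ]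
  have h2 := Real.log_le_log (by positivity) h1
  rw [Real.log_mul (x := N * (|t| + 2)) (by positivity) (by positivity)] at h2
  have h3 := Real.log_le_rpow_div (show 0 ≤ 1 + |τ| by linarith) (show 0 < κ / 4 by linarith)
  have h4 : 1 ≤ (1 + |τ|) ^ (κ / 4) := Real.one_le_rpow hτ (by linarith)
  have h5 : 1 ≤ 4 / κ := by rw [le_div_iff₀ hκ]; linarith
  have h6 : 0 ≤ Real.log (N * (|t| + 2)) := Real.log_nonneg hQ
  have h7 : Real.log (N * (|t| + 2)) ≤ (4 / κ) * Real.log (N * (|t| + 2)) * (1 + |τ|) ^ (κ / 4) := by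
    calc _ = 1 * Real.log (N * (|t| + 2)) * 1 := by ring
      _ ≤ _ := by gcongr
  have h8 : (1 + |τ|) ^ (κ / 4) / (κ / 4) = 4 / κ * (1 + |τ|) ^ (κ / 4) := by field_simp
  calc _ ≤ Real.log (N * (|t| + 2)) + Real.log (1 + |τ|) := h2
    _ ≤ (4 / κ) * Real.log (N * (|t| + 2)) * (1 + |τ|) ^ (κ / 4) + 4 / κ * (1 + |τ|) ^ (κ / 4) := by
      rw [← h8]; linarith
    _ = _ := by ring

/-- Conditional on GRH, partial sums of `χ(n) Λ(n) n^{-s}` to the right of the critical line are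
small when the imaginary part of `s` is large compared with the length of the sum. -/
theorem exists_norm_sum_mangoldtTwist_le (hGRH : GRH) {κ : ℝ} (hκ : 0 < κ) (hκ1 : κ ≤ 1 / 4)
    {η : ℝ} (hη : 0 < η) :
    ∃ C > (0:ℝ), ∀ (N : ℕ) [NeZero N] (χ : DirichletCharacter ℂ N) (s : ℂ) (Y : ℕ),
      1 / 2 + 2 * κ ≤ s.re → s.re ≤ 2 → (Y:ℝ) ^ 4 ≤ |s.im| →
      ‖∑ n ∈ Finset.Icc 1 Y, LSeries.term (mangoldtTwist χ) s n‖ ≤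
        η * Real.log (N * (|s.im| + 2)) + C := by
  obtain ⟨C0, hC0, hlog⟩ := exists_norm_logDeriv_regL_le hGRH hκ (by linarith)
  obtain ⟨C1, hC1, hshift⟩ := norm_integral_mul_entire_cut_le hκ (by linarith)
  obtain ⟨C2, hC2, hpole⟩ := norm_integral_inv_mul_entire_cut_le (κ := 2 * κ) (by linarith)
  set A : ℝ := C1 * (C0 * (4 / κ)) with hA
  have hA0 : 0 < A := by positivity
  obtain ⟨Z, hZ1, hZη⟩ : ∃ Z : ℕ, 1 ≤ Z ∧ A * (Z : ℝ) ^ (-(κ / 2)) ≤ η := by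
    have h1 : Tendsto (fun Z : ℕ => A * (Z : ℝ) ^ (-(κ / 2))) atTop (𝓝 (A * 0)) :=
      ((tendsto_rpow_neg_atTop (by linarith)).comp tendsto_natCast_atTop_atTop).const_mul A
    rw [mul_zero] at h1
    obtain ⟨Z, hZ⟩ := ((h1.eventually (ge_mem_nhds hη)).and (eventually_ge_atTop 1)).exists
    exact ⟨Z, hZ.2, hZ.1⟩
  refine ⟨2 * Z + η + C2, by positivity, fun N _ χ s Y hs1 hs2 hY => ?_⟩
  have hN : 1 ≤ N := NeZero.one_le
  have hN' : (1:ℝ) ≤ N := by exact_mod_cast hN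
  have hQ : 1 ≤ (N:ℝ) * (|s.im| + 2) := by nlinarith [abs_nonneg s.im]
  have hQ0 := Real.log_nonneg hQ
  rcases lt_or_ge Y Z with hYZ | hZY
  · have h1 := norm_sum_mangoldtTwist_le_trivial χ (s := s) (by linarith) Y
    have h2 : (Y : ℝ) ≤ Z := by exact_mod_cast hYZ.le
    have : 0 ≤ η * Real.log (N * (|s.im| + 2)) := by positivity
    linarith
  obtain ⟨D, hDd, hD⟩ := exists_entire_cutKernel_sub (hZ1.trans hZY) hZ1
  set a := mangoldtTwist χ with ha
  have habs : LSeries.abscissaOfAbsConv a < (s + (1 / 2 : ℝ)).re := by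
    refine abscissa_mangoldtTwist_lt χ ?_
    simp; linarith
  have h_int := fun X hX => integrable_LSeries_mul_cutKernel (a := a) (s := s) (c := 1 / 2)
    (by norm_num) habs (Y := X) hX
  have heq : (2 * Real.pi : ℂ) * (∑ n ∈ Finset.Icc 1 Y, LSeries.term a s n -
      ∑ n ∈ Finset.Icc 1 Z, LSeries.term a s n) =
      ∫ τ : ℝ, LSeries a (s + ((1 / 2 : ℝ) + τ * I)) * D ((1 / 2 : ℝ) + τ * I) := by
    rw [mul_sub, sum_term_eq_integral (by norm_num) habs (hZ1.trans hZY),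
      sum_term_eq_integral (by norm_num) habs hZ1, ← integral_sub (h_int Y (hZ1.trans hZY)) (h_int Z hZ1)]
    refine integral_congr_ae (Eventually.of_forall fun τ => ?_)
    simp only
    rw [hD _ (add_mul_I_ne_zero (by norm_num) τ)]
    ring
  have hintD : Integrable (fun τ : ℝ => LSeries a (s + ((1 / 2 : ℝ) + τ * I)) *
      D ((1 / 2 : ℝ) + τ * I)) := by
    refine ((h_int Y (hZ1.trans hZY)).sub (h_int Z hZ1)).congr (Eventually.of_forall fun τ => ?_)
    simp only [Pi.sub_apply]
    rw [hD _ (add_mul_I_ne_zero (by norm_num) τ)]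
    ring
  set f : ℂ → ℂ := fun w => -(deriv (regL χ) (s + w) / regL χ (s + w)) with hf
  set L : ℝ := C0 * (4 / κ) * (Real.log (N * (|s.im| + 2)) + 1) with hL
  obtain ⟨hfint, hfle⟩ := hshift f L Y Z D (by positivity) hZ1 hZY hDd hD (by
    intro w h1 h2
    have hne : regL χ (s + w) ≠ 0 := regL_ne_zero hGRH χ (by simp; linarith)
    have hd1 : DifferentiableAt ℂ (regL χ) (s + w) := differentiable_regL χ _
    have hd2 : DifferentiableAt ℂ (deriv (regL χ)) (s + w) :=
      ((differentiable_regL χ).contDiff (n := 2)).differentiable_deriv_two _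
    have hsw : DifferentiableAt ℂ (fun w => s + w) w := by fun_prop
    exact ((hd2.comp w hsw).div (hd1.comp w hsw) hne).neg) (by
    intro w h1 h2
    rw [hf, norm_neg]
    refine (hlog N χ (s + w) (by simp; linarith) (by simp; linarith)).trans ?_
    have := log_add_le hN hκ (by linarith) s.im w.im
    rw [add_im, hL]
    refine (mul_le_mul_of_nonneg_left this hC0.le).trans (le_of_eq ?_)
    ring)
  have hpl := hpole s Y Z D hZ1 hZY hD hs1 hY
  have hsplit : ∀ τ : ℝ, LSeries a (s + ((1 / 2 : ℝ) + τ * I)) * D ((1 / 2 : ℝ) + τ * I) =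
      f ((1 / 2 : ℝ) + τ * I) * D ((1 / 2 : ℝ) + τ * I) + (if χ = 1 then 1 else 0) *
        ((s + ((1 / 2 : ℝ) + τ * I) - 1)⁻¹ * D ((1 / 2 : ℝ) + τ * I)) := by
    intro τ
    rw [ha, LSeries_mangoldtTwist_eq hGRH χ (by simp; linarith)]
    ring
  have hint2 : Integrable (fun τ : ℝ => (if χ = 1 then 1 else 0 : ℂ) *
        ((s + ((1 / 2 : ℝ) + τ * I) - 1)⁻¹ * D ((1 / 2 : ℝ) + τ * I))) := by
    refine (hintD.sub hfint).congr (Eventually.of_forall fun τ => ?_)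
    simp only [Pi.sub_apply]
    rw [hsplit τ]
    ring
  simp only [hsplit] at heq
  rw [integral_add hfint hint2, integral_const_mul] at heq
  have h2 := congrArg norm heq
  rw [norm_mul] at h2
  have h3 : ‖(2 * Real.pi : ℂ)‖ = 2 * Real.pi := by
    rw [norm_mul, norm_real, Real.norm_of_nonneg Real.pi_pos.le]; simp
  rw [h3] at h2
  have h4 : ‖∑ n ∈ Finset.Icc 1 Y, LSeries.term a s n -
      ∑ n ∈ Finset.Icc 1 Z, LSeries.term a s n‖ ≤ C1 * L * (Z : ℝ) ^ (-(κ / 2)) + C2 := by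
    calc _ ≤ 2 * Real.pi * ‖∑ n ∈ Finset.Icc 1 Y, LSeries.term a s n -
          ∑ n ∈ Finset.Icc 1 Z, LSeries.term a s n‖ := by
          refine le_mul_of_one_le_left (norm_nonneg _) ?_
          linarith [Real.pi_gt_three]
      _ ≤ _ := by
        rw [h2]
        refine (norm_add_le _ _).trans (add_le_add hfle ?_)
        rw [norm_mul]
        calc _ ≤ 1 * C2 := by
              gcongr
              split_ifs <;> simp
          _ = _ := one_mul _
  have h5 : C1 * L * (Z : ℝ) ^ (-(κ / 2)) ≤ η * (Real.log (N * (|s.im| + 2)) + 1) := by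
    calc _ = (A * (Z : ℝ) ^ (-(κ / 2))) * (Real.log (N * (|s.im| + 2)) + 1) := by
          rw [hA, hL]; ring
      _ ≤ _ := by gcongr
  have h6 := norm_sum_mangoldtTwist_le_trivial χ (s := s) (by linarith) Z
  have h7 := norm_add_le (∑ n ∈ Finset.Icc 1 Y, LSeries.term a s n -
      ∑ n ∈ Finset.Icc 1 Z, LSeries.term a s n) (∑ n ∈ Finset.Icc 1 Z, LSeries.term a s n)
  rw [sub_add_cancel] at h7
  linarith

lemma summable_vonMangoldt_not_prime {σ : ℝ} (hσ : 1 / 2 < σ) :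
    Summable (fun n : ℕ => (if n.Prime then 0 else ArithmeticFunction.vonMangoldt n) * (n : ℝ) ^ (-σ)) := by
  set e : Nat.Primes × ℕ → ℕ := fun x => (x.1 : ℕ) ^ (x.2 + 2) with he
  have hinj : Function.Injective e := by
    rintro ⟨p, k⟩ ⟨q, l⟩ h
    have h1 : Nat.Primes.prodNatEquiv (p, k + 1) = Nat.Primes.prodNatEquiv (q, l + 1) := by
      apply Subtype.ext
      simpa [he] using h
    have h2 := Nat.Primes.prodNatEquiv.injective h1
    simp only [Prod.mk.injEq, add_left_inj] at h2
    rw [h2.1, h2.2]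
  have hsupp : ∀ n ∉ range e,
      (if n.Prime then 0 else ArithmeticFunction.vonMangoldt n) * (n : ℝ) ^ (-σ) = 0 := by
    intro n hn
    split_ifs with hp
    · simp
    · rw [ArithmeticFunction.vonMangoldt_eq_zero_iff.mpr, zero_mul]
      intro hpp
      obtain ⟨p, k, hp', hk, rfl⟩ := (isPrimePow_nat_iff _).mp hpp
      rcases Nat.lt_or_ge k 2 with hk2 | hk2
      · have : k = 1 := by omega
        subst this
        simp at hp
        exact hp hp'
      · exact hn ⟨(⟨p, hp'⟩, k - 2), by simp [he, Nat.sub_add_cancel hk2]⟩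
  rw [← hinj.summable_iff hsupp]
  set κ : ℝ := σ - 1 / 2 with hκ
  have hκ0 : 0 < κ := by linarith
  have hs1 : Summable (fun p : Nat.Primes => 1 / κ * (p : ℝ) ^ (-(1 + κ))) := by
    refine Summable.mul_left _ ?_
    rw [Nat.Primes.summable_rpow]
    linarith
  have hs2 : Summable (fun k : ℕ => ((2 : ℝ) ^ (-σ)) ^ k) :=
    summable_geometric_of_lt_one (by positivity)
      (Real.rpow_lt_one_of_one_lt_of_neg (by norm_num) (by linarith))
  refine Summable.of_nonneg_of_le (fun x => ?_) (fun x => ?_)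
    (hs1.mul_of_nonneg hs2 (fun p => by positivity) (fun k => by positivity))
  · simp only [Function.comp_apply]
    split_ifs
    · simp
    · exact mul_nonneg ArithmeticFunction.vonMangoldt_nonneg (by positivity)
  · obtain ⟨p, k⟩ := x
    have hp1 : (2:ℝ) ≤ (p : ℕ) := by exact_mod_cast p.2.two_le
    have hp0 : (0:ℝ) < (p : ℕ) := by linarith
    have hnp : ¬ (((p : ℕ) ^ (k + 2)).Prime) := Nat.Prime.not_prime_pow (by omega)
    simp only [Function.comp_apply, he, if_neg hnp]
    rw [ArithmeticFunction.vonMangoldt_apply_pow (by omega), ArithmeticFunction.vonMangoldt_apply_prime p.2]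
    push_cast
    rw [← Real.rpow_natCast, ← Real.rpow_mul hp0.le]
    have h1 : Real.log (p : ℕ) ≤ (p : ℝ) ^ κ / κ := Real.log_le_rpow_div hp0.le hκ0
    have h2 : ((p : ℕ) : ℝ) ^ (((k + 2 : ℕ) : ℝ) * -σ) = ((p : ℕ) : ℝ) ^ (-(2 * σ)) * (((p : ℕ) : ℝ) ^ (-σ)) ^ k := by
      rw [← Real.rpow_natCast (((p : ℕ) : ℝ) ^ (-σ)), ← Real.rpow_mul hp0.le, ← Real.rpow_add hp0]
      push_cast; ring_nf
    have h3 : ((p : ℕ) : ℝ) ^ (-σ) ≤ (2:ℝ) ^ (-σ) :=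
      Real.rpow_le_rpow_of_nonpos (by norm_num) hp1 (by linarith)
    rw [h2]
    calc _ ≤ (p : ℝ) ^ κ / κ * (((p : ℕ) : ℝ) ^ (-(2 * σ)) * ((2:ℝ) ^ (-σ)) ^ k) := by gcongr
      _ = 1 / κ * ((p : ℝ) ^ κ * ((p : ℕ) : ℝ) ^ (-(2 * σ))) * ((2:ℝ) ^ (-σ)) ^ k := by ring
      _ = _ := by
        rw [← Real.rpow_add hp0, hκ]
        ring_nf

/-- The truncation of `∑ χ(p) p^{-s}` to primes at most `Y`. -/
def primeSum {N : ℕ} (χ : DirichletCharacter ℂ N) (Y : ℕ) (s : ℂ) : ℂ :=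
  ∑ p ∈ Nat.primesBelow (Y + 1), χ p * (p : ℂ) ^ (-s)

/-- The Euler product of `χ` truncated to primes at most `Y`. -/
def smoothL {N : ℕ} (χ : DirichletCharacter ℂ N) (Y : ℕ) (s : ℂ) : ℂ :=
  ∏ p ∈ Nat.primesBelow (Y + 1), (1 - χ p * (p : ℂ) ^ (-s))⁻¹

lemma norm_char_mul_cpow_le {N : ℕ} (χ : DirichletCharacter ℂ N) {p : ℕ} (hp : 0 < p) (s : ℂ) :
    ‖χ p * (p : ℂ) ^ (-s)‖ ≤ (p : ℝ) ^ (-s.re) := by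
  rw [norm_mul, ← ofReal_natCast, norm_cpow_eq_rpow_re_of_pos (by exact_mod_cast hp), neg_re]
  calc _ ≤ 1 * (p : ℝ) ^ (-s.re) := by gcongr; exact χ.norm_le_one _
    _ = _ := one_mul _

lemma hasDerivAt_primeSum {N : ℕ} (χ : DirichletCharacter ℂ N) (Y : ℕ) (s : ℂ) :
    HasDerivAt (primeSum χ Y) (-∑ p ∈ Nat.primesBelow (Y + 1), χ p * Real.log p * (p : ℂ) ^ (-s)) s := by
  rw [← Finset.sum_neg_distrib]
  refine HasDerivAt.fun_sum fun p hp => ?_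
  have hp0 : p ≠ 0 := (Nat.prime_of_mem_primesBelow hp).ne_zero
  have := ((hasDerivAt_id s).neg.const_cpow (c := (p : ℂ)) (Or.inl (by exact_mod_cast hp0))).const_mul
    (χ p)
  have h : χ p * ((p : ℂ) ^ ((-id : ℂ → ℂ) s) * log p * -1) = -(χ p * Real.log p * (p : ℂ) ^ (-s)) := by
    rw [← natCast_log]
    simp only [id, Pi.neg_apply]
    ring
  rw [h] at this
  exact this

lemma exists_norm_deriv_primeSum_le (hGRH : GRH) {κ : ℝ} (hκ : 0 < κ) (hκ1 : κ ≤ 1 / 4)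
    {η : ℝ} (hη : 0 < η) :
    ∃ C > (0:ℝ), ∀ (N : ℕ) [NeZero N] (χ : DirichletCharacter ℂ N) (s : ℂ) (Y : ℕ),
      1 / 2 + 2 * κ ≤ s.re → s.re ≤ 2 → (Y:ℝ) ^ 4 ≤ |s.im| →
      ‖-∑ p ∈ Nat.primesBelow (Y + 1), χ p * Real.log p * (p : ℂ) ^ (-s)‖ ≤
        η * Real.log (N * (|s.im| + 2)) + C := by
  obtain ⟨C, hC, hbound⟩ := exists_norm_sum_mangoldtTwist_le hGRH hκ hκ1 hη
  have hsum := summable_vonMangoldt_not_prime (σ := 1 / 2 + 2 * κ) (by linarith)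
  set B := ∑' n : ℕ, (if n.Prime then 0 else ArithmeticFunction.vonMangoldt n) *
    (n : ℝ) ^ (-(1 / 2 + 2 * κ)) with hB
  have hnn : ∀ n : ℕ, 0 ≤ (if n.Prime then 0 else ArithmeticFunction.vonMangoldt n) *
    (n : ℝ) ^ (-(1 / 2 + 2 * κ)) := by
    intro n
    split_ifs
    · simp
    · exact mul_nonneg ArithmeticFunction.vonMangoldt_nonneg (by positivity)
  have hB0 : 0 ≤ B := tsum_nonneg hnn
  refine ⟨C + B, by linarith, fun N _ χ s Y hs1 hs2 hY => ?_⟩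
  have h1 := hbound N χ s Y hs1 hs2 hY
  have hterm : ∀ n : ℕ, n ≠ 0 → LSeries.term (mangoldtTwist χ) s n =
      χ n * ArithmeticFunction.vonMangoldt n * (n : ℂ) ^ (-s) := by
    intro n hn
    rw [LSeries.term_of_ne_zero hn, cpow_neg, div_eq_mul_inv]
    rfl
  have hprimes : Nat.primesBelow (Y + 1) = (Finset.Icc 1 Y).filter Nat.Prime := by
    ext p
    simp only [Nat.mem_primesBelow, Finset.mem_filter, Finset.mem_Icc]
    constructor
    · rintro ⟨h, hp⟩; exact ⟨⟨hp.one_le, by omega⟩, hp⟩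
    · rintro ⟨⟨-, h⟩, hp⟩; exact ⟨by omega, hp⟩
  have h2 : ∑ p ∈ Nat.primesBelow (Y + 1), χ p * Real.log p * (p : ℂ) ^ (-s) =
      ∑ n ∈ Finset.Icc 1 Y, LSeries.term (mangoldtTwist χ) s n -
      ∑ n ∈ (Finset.Icc 1 Y).filter (fun n => ¬ n.Prime), LSeries.term (mangoldtTwist χ) s n := by
    rw [hprimes, ← Finset.sum_filter_add_sum_filter_not (Finset.Icc 1 Y) Nat.Prime
      (LSeries.term (mangoldtTwist χ) s), add_sub_cancel_right]
    refine Finset.sum_congr rfl fun p hp => ?_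
    have hp' := (Finset.mem_filter.mp hp).2
    rw [hterm p hp'.ne_zero, ArithmeticFunction.vonMangoldt_apply_prime hp']
  have h3 : ‖∑ n ∈ (Finset.Icc 1 Y).filter (fun n => ¬ n.Prime),
      LSeries.term (mangoldtTwist χ) s n‖ ≤ B := by
    refine (norm_sum_le_of_le _ (n := fun n : ℕ => (if n.Prime then 0 else ArithmeticFunction.vonMangoldt n) *
      (n : ℝ) ^ (-(1 / 2 + 2 * κ))) fun n hn => ?_).trans (hsum.sum_le_tsum _ fun n _ => hnn n)
    obtain ⟨hn1, hnp⟩ := Finset.mem_filter.mp hn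
    have hn1' : 1 ≤ n := (Finset.mem_Icc.mp hn1).1
    have hn1'' : (1:ℝ) ≤ n := by exact_mod_cast hn1'
    rw [hterm n (by omega), if_neg hnp, mul_right_comm, norm_mul, norm_real,
      Real.norm_of_nonneg ArithmeticFunction.vonMangoldt_nonneg, mul_comm]
    refine mul_le_mul_of_nonneg_left ?_ ArithmeticFunction.vonMangoldt_nonneg
    exact (norm_char_mul_cpow_le χ (by omega) s).trans
      (Real.rpow_le_rpow_of_exponent_le hn1'' (by linarith))
  rw [norm_neg, h2]
  refine (norm_sub_le _ _).trans ?_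
  linarith

lemma norm_inv_one_sub_le {z : ℂ} {q : ℝ} (hz : ‖z‖ ≤ q) (hq : q ≤ 3 / 4) :
    ‖(1 - z)⁻¹‖ ≤ Real.exp (z.re + 2 * q ^ 2) := by
  have hz1 : ‖-z‖ < 1 := by rw [norm_neg]; linarith
  have h1 := Complex.norm_log_one_add_sub_self_le hz1
  have hne : 1 - z ≠ 0 := by
    intro h
    have : z = 1 := by linear_combination -h
    rw [this] at hz; simp at hz; linarith
  rw [norm_neg, ← sub_eq_add_neg, sub_neg_eq_add] at h1
  have h2 : ‖z‖ ^ 2 * (1 - ‖z‖)⁻¹ / 2 ≤ 2 * q ^ 2 := by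
    have h3 : (1 - ‖z‖)⁻¹ ≤ 4 := by
      rw [inv_le_comm₀ (by linarith) (by norm_num)]; linarith
    have h4 : ‖z‖ ^ 2 ≤ q ^ 2 := by gcongr
    have h5 : ‖z‖ ^ 2 * (1 - ‖z‖)⁻¹ ≤ q ^ 2 * 4 := by
      apply mul_le_mul h4 h3 _ (by positivity)
      rw [inv_nonneg]; linarith
    linarith
  have h3 := (Complex.abs_re_le_norm (log (1 - z) + z)).trans (h1.trans h2)
  rw [add_re, log_re] at h3
  have h4 : -Real.log ‖1 - z‖ ≤ z.re + 2 * q ^ 2 := by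
    have := (abs_le.mp h3).1
    linarith
  rw [norm_inv, ← Real.exp_log (norm_pos_iff.mpr hne), ← Real.exp_neg]
  exact Real.exp_le_exp.mpr h4

lemma two_rpow_neg_half_le {p : ℕ} (hp : 2 ≤ p) {σ : ℝ} (hσ : 1 / 2 ≤ σ) :
    (p : ℝ) ^ (-σ) ≤ 3 / 4 := by
  have hp' : (2:ℝ) ≤ p := by exact_mod_cast hp
  calc (p : ℝ) ^ (-σ) ≤ (2:ℝ) ^ (-σ) := Real.rpow_le_rpow_of_nonpos (by norm_num) hp' (by linarith)
    _ ≤ (2:ℝ) ^ (-(1/2) : ℝ) := Real.rpow_le_rpow_of_exponent_le (by norm_num) (by linarith)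
    _ = (Real.sqrt 2)⁻¹ := by rw [Real.rpow_neg (by norm_num), Real.sqrt_eq_rpow]
    _ ≤ 3 / 4 := by
      rw [inv_le_comm₀ (by positivity) (by norm_num)]
      apply Real.le_sqrt_of_sq_le
      norm_num

lemma exists_norm_smoothL_le_exp {κ : ℝ} (hκ : 0 < κ) : ∃ C > (0:ℝ), ∀ (N : ℕ)
    (χ : DirichletCharacter ℂ N) (s : ℂ) (Y : ℕ), 1 / 2 + κ ≤ s.re →
    ‖smoothL χ Y s‖ ≤ C * Real.exp ((primeSum χ Y s).re) := by
  have hsum : Summable (fun n : ℕ => 2 * ((n:ℝ) ^ (-(1 / 2 + κ))) ^ 2) := by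
    have : Summable (fun n : ℕ => (n:ℝ) ^ (-(1 + 2 * κ))) := Real.summable_nat_rpow.mpr (by linarith)
    refine (this.mul_left 2).congr fun n => ?_
    rw [← Real.rpow_natCast, ← Real.rpow_mul (by positivity)]
    congr 2; push_cast; ring
  refine ⟨Real.exp (∑' n : ℕ, 2 * ((n:ℝ) ^ (-(1 / 2 + κ))) ^ 2), Real.exp_pos _, fun N χ s Y hs => ?_⟩
  rw [smoothL, norm_prod, ← Real.exp_add]
  have h1 : ∀ p ∈ Nat.primesBelow (Y + 1), ‖(1 - χ p * (p : ℂ) ^ (-s))⁻¹‖ ≤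
      Real.exp ((χ p * (p : ℂ) ^ (-s)).re + 2 * ((p:ℝ) ^ (-(1 / 2 + κ))) ^ 2) := by
    intro p hp
    have hp' := Nat.prime_of_mem_primesBelow hp
    have hp1 : (1:ℝ) ≤ p := by exact_mod_cast hp'.one_le
    refine norm_inv_one_sub_le ((norm_char_mul_cpow_le χ hp'.pos s).trans ?_)
      (two_rpow_neg_half_le hp'.two_le (by linarith))
    exact Real.rpow_le_rpow_of_exponent_le hp1 (by linarith)
  refine (Finset.prod_le_prod (fun p _ => norm_nonneg _) h1).trans ?_
  rw [← Real.exp_sum, Finset.sum_add_distrib]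
  apply Real.exp_le_exp.mpr
  rw [add_comm, primeSum, re_sum]
  gcongr
  exact hsum.sum_le_tsum _ fun n _ => by positivity

lemma exists_norm_primeSum_two_le : ∃ C > (0:ℝ), ∀ (N : ℕ)
    (χ : DirichletCharacter ℂ N) (s : ℂ) (Y : ℕ), s.re = 2 → ‖primeSum χ Y s‖ ≤ C := by
  have hsum : Summable (fun n : ℕ => (n:ℝ) ^ (-2 : ℝ)) := Real.summable_nat_rpow.mpr (by norm_num)
  refine ⟨∑' n : ℕ, (n:ℝ) ^ (-2 : ℝ) + 1, ?_, fun N χ s Y hs => ?_⟩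
  · have : 0 ≤ ∑' n : ℕ, (n:ℝ) ^ (-2 : ℝ) := tsum_nonneg fun n => by positivity
    linarith
  · have h1 : ‖primeSum χ Y s‖ ≤ ∑ p ∈ Nat.primesBelow (Y + 1), (p:ℝ) ^ (-2 : ℝ) :=
      norm_sum_le_of_le _ fun p hp => by
        have := norm_char_mul_cpow_le χ (Nat.prime_of_mem_primesBelow hp).pos s
        rwa [hs] at this
    have h2 := hsum.sum_le_tsum (Nat.primesBelow (Y + 1)) fun n _ => by positivity
    linarith

lemma exists_norm_smoothL_two_le : ∃ C > (0:ℝ), ∀ (N : ℕ)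
    (χ : DirichletCharacter ℂ N) (s : ℂ) (Y : ℕ), s.re = 2 → ‖smoothL χ Y s‖ ≤ C := by
  obtain ⟨C1, hC1, h1⟩ := exists_norm_smoothL_le_exp (κ := 1) one_pos
  obtain ⟨C2, hC2, h2⟩ := exists_norm_primeSum_two_le
  refine ⟨C1 * Real.exp C2, by positivity, fun N χ s Y hs => (h1 N χ s Y (by linarith)).trans ?_⟩
  gcongr
  exact (Complex.re_le_norm _).trans (h2 N χ s Y hs)

/-- Conditional on GRH, truncated Euler products are small to the right of the critical line,
at heights large compared with the truncation. -/
theorem exists_norm_smoothL_le (hGRH : GRH) {κ : ℝ} (hκ : 0 < κ) (hκ1 : κ ≤ 1 / 4)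
    {η : ℝ} (hη : 0 < η) :
    ∃ C > (0:ℝ), ∀ (N : ℕ) [NeZero N] (χ : DirichletCharacter ℂ N) (s : ℂ) (Y : ℕ),
      1 / 2 + 2 * κ ≤ s.re → s.re ≤ 2 → (Y:ℝ) ^ 4 ≤ |s.im| →
      ‖smoothL χ Y s‖ ≤ C * ((N:ℝ) * (|s.im| + 2)) ^ η := by
  obtain ⟨C0, hC0, h0⟩ := exists_norm_deriv_primeSum_le hGRH hκ hκ1 (η := η / 2) (by linarith)
  obtain ⟨C1, hC1, h1⟩ := exists_norm_smoothL_le_exp (κ := 2 * κ) (by linarith)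
  obtain ⟨C2, hC2, h2⟩ := exists_norm_primeSum_two_le
  refine ⟨C1 * Real.exp (C2 + C0 * 2), by positivity, fun N _ χ s Y hs1 hs2 hY => ?_⟩
  have hN' : (1:ℝ) ≤ N := by exact_mod_cast (NeZero.one_le : 1 ≤ N)
  have hQ : 1 ≤ (N:ℝ) * (|s.im| + 2) := by nlinarith [abs_nonneg s.im]
  have hQ0 := Real.log_nonneg hQ
  have hmv := (convex_Icc s.re 2).norm_image_sub_le_of_norm_hasDerivWithin_le
    (f := fun u : ℝ => primeSum χ Y (u + s.im * I))
    (f' := fun u : ℝ => -∑ p ∈ Nat.primesBelow (Y + 1), χ p * Real.log p * (p : ℂ) ^ (-(u + s.im * I : ℂ)))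
    (C := η / 2 * Real.log (N * (|s.im| + 2)) + C0) (fun u hu => by
      have h3 := (hasDerivAt_primeSum χ Y (u + s.im * I)).comp_add_const (u : ℂ) (s.im * I)
      exact h3.comp_ofReal.hasDerivWithinAt) (fun u hu => by
      have := h0 N χ (u + s.im * I) Y (by simpa using hs1.trans hu.1) (by simpa using hu.2)
        (by simpa using hY)
      simpa using this) (right_mem_Icc.mpr hs2) (left_mem_Icc.mpr hs2)
  simp only [re_add_im] at hmv
  have h4 := h2 N χ ((2 : ℝ) + s.im * I) Y (by simp)
  have h5 : ‖s.re - 2‖ ≤ 2 := by rw [Real.norm_eq_abs, abs_le]; constructor <;> linarith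
  have h6 : ‖primeSum χ Y s‖ ≤ C2 + (η / 2 * Real.log (N * (|s.im| + 2)) + C0) * 2 := by
    have h7 := norm_add_le (primeSum χ Y s - primeSum χ Y ((2 : ℝ) + s.im * I))
      (primeSum χ Y ((2 : ℝ) + s.im * I))
    rw [sub_add_cancel] at h7
    have h8 : (η / 2 * Real.log (N * (|s.im| + 2)) + C0) * ‖s.re - 2‖ ≤
      (η / 2 * Real.log (N * (|s.im| + 2)) + C0) * 2 := by gcongr
    linarith
  refine (h1 N χ s Y hs1).trans ?_
  rw [mul_assoc, Real.rpow_def_of_pos (by linarith), ← Real.exp_add]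
  gcongr
  refine (Complex.re_le_norm _).trans (h6.trans (le_of_eq ?_))
  ring

lemma differentiableAt_smoothL {N : ℕ} (χ : DirichletCharacter ℂ N) (Y : ℕ) {s : ℂ} (hs : 0 < s.re) :
    DifferentiableAt ℂ (smoothL χ Y) s := by
  refine DifferentiableAt.fun_finsetProd fun p hp => ?_
  have hp' := Nat.prime_of_mem_primesBelow hp
  have hp0 : (p : ℂ) ≠ 0 := by exact_mod_cast hp'.ne_zero
  refine DifferentiableAt.inv (by
    exact (differentiableAt_const _).sub ((differentiableAt_const _).mul
      (differentiableAt_id.neg.const_cpow (Or.inl hp0)))) ?_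
  intro h
  have h1 : χ p * (p : ℂ) ^ (-s) = 1 := by linear_combination -h
  have h2 := norm_char_mul_cpow_le χ hp'.pos s
  rw [h1, norm_one] at h2
  have : (p:ℝ) ^ (-s.re) < 1 := Real.rpow_lt_one_of_one_lt_of_neg (by exact_mod_cast hp'.one_lt) (by linarith)
  linarith

/-- The truncated Euler product is the Dirichlet series over smooth numbers. -/
lemma hasSum_smoothL {N : ℕ} (χ : DirichletCharacter ℂ N) (Y : ℕ) {s : ℂ} (hs : 0 < s.re) :
    Summable (fun m : (Y + 1).smoothNumbers => ‖χ (m : ℕ) * ((m : ℕ) : ℂ) ^ (-s)‖) ∧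
    HasSum (fun m : (Y + 1).smoothNumbers => χ (m : ℕ) * ((m : ℕ) : ℂ) ^ (-s)) (smoothL χ Y s) := by
  let f : ℕ →* ℂ :=
    { toFun := fun n => χ n * (n : ℂ) ^ (-s)
      map_one' := by simp
      map_mul' := fun m n => by
        push_cast
        rw [natCast_mul_natCast_cpow, map_mul]
        ring }
  exact EulerProduct.summable_and_hasSum_smoothNumbers_prod_primesBelow_geometric (f := f) (fun {p} hp => by
    refine (norm_char_mul_cpow_le χ hp.pos s).trans_lt ?_
    exact Real.rpow_lt_one_of_one_lt_of_neg (by exact_mod_cast hp.one_lt) (by linarith)) (Y + 1)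

/-- A smooth function supported in a compact subset of the positive half-line. -/
def TestFn (A : ℝ → ℂ) : Prop :=
  ContDiff ℝ (⊤ : ℕ∞) A ∧ ∃ a b : ℝ, 0 < a ∧ a ≤ b ∧ ∀ u ∉ Icc a b, A u = 0

/-- The function `A` twisted by the additive character of frequency `l`. -/
def twist (l : ℝ) (A : ℝ → ℂ) (u : ℝ) : ℂ := A u * cexp (2 * Real.pi * I * l * u)

lemma norm_twist (l : ℝ) (A : ℝ → ℂ) (u : ℝ) : ‖twist l A u‖ = ‖A u‖ := by
  have : (2 * Real.pi * I * l * u : ℂ) = ((2 * Real.pi * l * u : ℝ) : ℂ) * I := by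
    push_cast; ring
  rw [twist, norm_mul, this, Complex.norm_exp_ofReal_mul_I, mul_one]

lemma hasDerivAt_cexp_linear (l u : ℝ) :
    HasDerivAt (fun u : ℝ => cexp (2 * Real.pi * I * l * u))
      (2 * Real.pi * I * l * cexp (2 * Real.pi * I * l * u)) u := by
  have h1 : HasDerivAt (fun z : ℂ => 2 * Real.pi * I * l * z) (2 * Real.pi * I * l) (u : ℂ) := by
    simpa using (hasDerivAt_id (u : ℂ)).const_mul (2 * Real.pi * I * l : ℂ)
  have := h1.cexp.comp_ofReal
  rwa [mul_comm (cexp _)] at this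

lemma TestFn.twisted {A : ℝ → ℂ} (hA : TestFn A) (l : ℝ) : TestFn (twist l A) := by
  obtain ⟨h1, a, b, ha, hab, h⟩ := hA
  refine ⟨?_, a, b, ha, hab, fun u hu => by simp [twist, h u hu]⟩
  refine h1.mul (ContDiff.cexp ?_)
  exact contDiff_const.mul Complex.ofRealCLM.contDiff

lemma TestFn.derivative {A : ℝ → ℂ} (hA : TestFn A) : TestFn (deriv A) := by
  obtain ⟨h1, a, b, ha, hab, h⟩ := hA
  refine ⟨?_, a, b, ha, hab, fun u hu => ?_⟩
  · exact ((contDiff_infty_iff_deriv (𝕜 := ℝ)).1 h1).2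
  · have : A =ᶠ[𝓝 u] fun _ => 0 := by
      filter_upwards [isClosed_Icc.isOpen_compl.mem_nhds hu] with v hv using h v hv
    rw [this.deriv_eq]; simp

lemma TestFn.exists_norm_le {A : ℝ → ℂ} (hA : TestFn A) : ∃ C > 0, ∀ u, ‖A u‖ ≤ C := by
  obtain ⟨h1, a, b, ha, hab, h⟩ := hA
  obtain ⟨C, hC⟩ := isCompact_Icc.exists_bound_of_continuousOn (s := Icc a b) h1.continuous.continuousOn
  refine ⟨max C 1, by positivity, fun u => ?_⟩
  by_cases hu : u ∈ Icc a b
  · exact (hC u hu).trans (le_max_left _ _)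
  · rw [h u hu]; simp

lemma TestFn.isBigO_nhdsGT {A : ℝ → ℂ} (hA : TestFn A) (c : ℝ) :
    A =O[𝓝[>] 0] fun x : ℝ => x ^ (-c) := by
  obtain ⟨h1, a, b, ha, hab, h⟩ := hA
  have : A =ᶠ[𝓝[>] 0] fun _ => 0 := by
    filter_upwards [mem_nhdsWithin_of_mem_nhds (Iio_mem_nhds ha)] with u hu
    exact h u fun h' => absurd h'.1 (not_le.2 hu)
  exact this.trans_isBigO (isBigO_zero _ _)

lemma TestFn.isBigO_atTop {A : ℝ → ℂ} (hA : TestFn A) (c : ℝ) :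
    A =O[atTop] fun x : ℝ => x ^ (-c) := by
  obtain ⟨h1, a, b, ha, hab, h⟩ := hA
  have : A =ᶠ[atTop] fun _ => 0 := by
    filter_upwards [eventually_gt_atTop b] with u hu
    exact h u fun h' => absurd h'.2 (not_le.2 hu)
  exact this.trans_isBigO (isBigO_zero _ _)

lemma TestFn.locallyIntegrableOn {A : ℝ → ℂ} (hA : TestFn A) : LocallyIntegrableOn A (Ioi 0) :=
  hA.1.continuous.locallyIntegrable.locallyIntegrableOn _

lemma TestFn.mellinConvergent {A : ℝ → ℂ} (hA : TestFn A) (s : ℂ) : MellinConvergent A s :=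
  mellinConvergent_of_isBigO_rpow hA.locallyIntegrableOn (hA.isBigO_atTop (s.re + 1)) (by linarith)
    (hA.isBigO_nhdsGT (s.re - 1)) (by linarith)

lemma TestFn.differentiable_mellin {A : ℝ → ℂ} (hA : TestFn A) : Differentiable ℂ (mellin A) :=
  fun s => mellin_differentiableAt_of_isBigO_rpow hA.locallyIntegrableOn
    (hA.isBigO_atTop (s.re + 1)) (by linarith) (hA.isBigO_nhdsGT (s.re - 1)) (by linarith)

lemma mellin_eq_intervalIntegral {F : ℝ → ℂ} {a b : ℝ} (ha : 0 < a) (hab : a ≤ b)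
    (h : ∀ u ∉ Icc a b, F u = 0) (s : ℂ) :
    mellin F s = ∫ u in a..b, (u : ℂ) ^ (s - 1) * F u := by
  rw [mellin, intervalIntegral.integral_of_le hab, ← integral_Icc_eq_integral_Ioc]
  refine (setIntegral_eq_of_subset_of_forall_sdiff_eq_zero measurableSet_Ioi
    (fun u hu => ha.trans_le hu.1) fun u hu => ?_)
  simp [h u hu.2]

lemma rpow_le_of_mem_Icc {a b u c R : ℝ} (ha : 0 < a) (hu : u ∈ Icc a b) (hc : |c| ≤ R) :
    u ^ c ≤ (max b a⁻¹) ^ R := by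
  have hu0 : 0 < u := ha.trans_le hu.1
  set M := max b a⁻¹
  have hM : 1 ≤ M := by
    rcases le_or_gt 1 u with h | h
    · exact h.trans (hu.2.trans (le_max_left _ _))
    · exact le_trans ((one_le_inv₀ ha).2 (hu.1.trans h.le)) (le_max_right _ _)
  have hM0 : 0 < M := by linarith
  rcases le_or_gt 0 c with h | h
  · calc u ^ c ≤ M ^ c := Real.rpow_le_rpow hu0.le (hu.2.trans (le_max_left _ _)) h
      _ ≤ M ^ R := Real.rpow_le_rpow_of_exponent_le hM ((le_abs_self c).trans hc)
  · calc u ^ c = u⁻¹ ^ (-c) := by rw [Real.inv_rpow hu0.le, Real.rpow_neg hu0.le, inv_inv]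
      _ ≤ M ^ (-c) := Real.rpow_le_rpow (by positivity)
          ((inv_anti₀ ha hu.1).trans (le_max_right _ _)) (by linarith)
      _ ≤ M ^ R := Real.rpow_le_rpow_of_exponent_le hM ((neg_le_abs c).trans hc)

lemma TestFn.exists_norm_mellin_twist_le {A : ℝ → ℂ} (hA : TestFn A) (R : ℝ) :
    ∃ C > 0, ∀ (l : ℝ) (s : ℂ), |s.re| ≤ R → ‖mellin (twist l A) s‖ ≤ C := by
  obtain ⟨K, hK, hK'⟩ := hA.exists_norm_le
  obtain ⟨h1, a, b, ha, hab, h⟩ := hA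
  set M := max b a⁻¹
  refine ⟨M ^ (R + 1) * K * |b - a| + 1, by positivity, fun l s hs => ?_⟩
  rw [mellin_eq_intervalIntegral ha hab (fun u hu => by simp [twist, h u hu]) s]
  refine (intervalIntegral.norm_integral_le_of_norm_le_const fun u hu => ?_).trans
    (le_add_of_nonneg_right zero_le_one)
  rw [uIoc_of_le hab] at hu
  have hu0 : 0 < u := ha.trans hu.1
  rw [norm_mul, norm_twist, norm_cpow_eq_rpow_re_of_pos hu0]
  refine mul_le_mul (rpow_le_of_mem_Icc ha ⟨hu.1.le, hu.2⟩ ?_) (hK' u) (norm_nonneg _) (by positivity)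
  have : |(s - 1).re| ≤ |s.re| + |(1:ℝ)| := by simpa using abs_sub s.re 1
  simpa using this.trans (by simpa using hs)

lemma TestFn.mellin_twist_recursion {A : ℝ → ℂ} (hA : TestFn A) (l : ℝ) (s : ℂ) :
    mellin (twist l (deriv A)) s + 2 * Real.pi * I * l * mellin (twist l A) s +
      (s - 1) * mellin (twist l A) (s - 1) = 0 := by
  have hD := hA.derivative
  have hsm := hA.1
  obtain ⟨h1, a, b, ha, hab, h⟩ := hA
  have ha' : 0 < a / 2 := by linarith
  have hab' : a / 2 ≤ b + 1 := by linarith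
  have hz : ∀ u, u ∉ Icc a b → deriv A u = 0 := fun u hu => by
    have : A =ᶠ[𝓝 u] fun _ => 0 := by
      filter_upwards [isClosed_Icc.isOpen_compl.mem_nhds hu] with v hv using h v hv
    rw [this.deriv_eq]; simp
  have hsub : ∀ u, u ∉ Icc (a / 2) (b + 1) → u ∉ Icc a b := fun u hu hu' =>
    hu ⟨by linarith [hu'.1], by linarith [hu'.2]⟩
  rw [mellin_eq_intervalIntegral ha' hab' (fun u hu => by simp [twist, hz u (hsub u hu)]) s,
    mellin_eq_intervalIntegral ha' hab' (fun u hu => by simp [twist, h u (hsub u hu)]) s,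
    mellin_eq_intervalIntegral ha' hab' (fun u hu => by simp [twist, h u (hsub u hu)]) (s - 1)]
  have hcp : ∀ w : ℂ, ContinuousOn (fun u : ℝ => (u : ℂ) ^ w) (uIcc (a / 2) (b + 1)) := by
    intro w u hu
    rw [uIcc_of_le hab'] at hu
    have hu0 : 0 < u := ha'.trans_le hu.1
    exact (((continuousAt_id.cpow continuousAt_const
      (Or.inl (by simpa using hu0))).comp continuous_ofReal.continuousAt)).continuousWithinAt
  have h_int : ∀ (w : ℂ) {B : ℝ → ℂ}, Continuous B →
      IntervalIntegrable (fun u : ℝ => (u : ℂ) ^ w * twist l B u) volume (a / 2) (b + 1) := by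
    intro w B hB
    refine ((hcp w).mul ?_).intervalIntegrable
    unfold twist
    fun_prop
  have hA0 := hsm.continuous
  have hA1 := hD.1.continuous
  rw [← intervalIntegral.integral_const_mul, ← intervalIntegral.integral_const_mul,
    ← intervalIntegral.integral_add (h_int _ hA1) ((h_int _ hA0).const_mul _),
    ← intervalIntegral.integral_add ((h_int _ hA1).add ((h_int _ hA0).const_mul _))
      ((h_int _ hA0).const_mul _)]
  rw [intervalIntegral.integral_eq_sub_of_hasDerivAt (f := fun u : ℝ => (u : ℂ) ^ (s - 1) * twist l A u)]
  · have e1 : A (b + 1) = 0 := h _ fun h' => by linarith [h'.2]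
    have e2 : A (a / 2) = 0 := h _ fun h' => by linarith [h'.1]
    simp [twist, e1, e2]
  · intro u hu
    rw [uIcc_of_le hab'] at hu
    have hu0 : 0 < u := ha'.trans_le hu.1
    have d1 : HasDerivAt (fun u : ℝ => (u : ℂ) ^ (s - 1)) ((s - 1) * (u : ℂ) ^ (s - 1 - 1)) u := by
      have := ((hasDerivAt_id (u : ℂ)).cpow_const (c := s - 1) (Or.inl (by simpa using hu0))).comp_ofReal
      simpa using this
    have d2 : HasDerivAt A (deriv A u) u :=
      ((hsm.differentiable (by simp)) u).hasDerivAt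
    have := d1.mul (d2.mul (hasDerivAt_cexp_linear l u))
    have e : (s - 1) * (u : ℂ) ^ (s - 1 - 1) * (A u * cexp (2 * Real.pi * I * l * u)) +
        (u : ℂ) ^ (s - 1) * (deriv A u * cexp (2 * Real.pi * I * l * u) +
          A u * (2 * Real.pi * I * l * cexp (2 * Real.pi * I * l * u))) =
        (u : ℂ) ^ (s - 1) * twist l (deriv A) u +
          2 * Real.pi * I * l * ((u : ℂ) ^ (s - 1) * twist l A u) +
          (s - 1) * ((u : ℂ) ^ (s - 1 - 1) * twist l A u) := by
      unfold twist; ring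
    simp only [Pi.mul_apply] at this
    rw [e] at this
    exact this
  · exact ((h_int _ hA1).add ((h_int _ hA0).const_mul _)).add ((h_int _ hA0).const_mul _)

lemma TestFn.exists_norm_mellin_twist_le_pow (k : ℕ) : ∀ {A : ℝ → ℂ}, TestFn A → ∀ R : ℝ,
    ∃ C > 0, ∀ (l : ℝ) (s : ℂ), l ≠ 0 → |s.re| ≤ R →
      ‖mellin (twist l A) s‖ ≤ C * ((k + 1 + ‖s‖) / |l|) ^ k := by
  induction k with
  | zero =>
    intro A hA R
    obtain ⟨C, hC, h⟩ := hA.exists_norm_mellin_twist_le R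
    exact ⟨C, hC, fun l s _ hs => by simpa using h l s hs⟩
  | succ k ih =>
    intro A hA R
    obtain ⟨C, hC, h⟩ := ih hA (R + 1)
    obtain ⟨D, hD, h'⟩ := ih hA.derivative (R + 1)
    refine ⟨C + D, by positivity, fun l s hl hs => ?_⟩
    have hl' : 0 < |l| := abs_pos.2 hl
    have h1 := h l (s - 1) hl (by
      have : |s.re - 1| ≤ |s.re| + |(1:ℝ)| := abs_sub s.re 1
      simpa using this.trans (by simpa using hs))
    have h2 := h' l s hl (by linarith)
    have hrec := hA.mellin_twist_recursion l s
    have hn : ‖s - 1‖ ≤ ‖s‖ + 1 := by simpa using norm_sub_le s 1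
    set Z := ((k + 1 : ℕ) + 1 + ‖s‖ : ℝ) with hZ
    have hZ0 : 1 ≤ Z := by rw [hZ]; push_cast; linarith [norm_nonneg s, (Nat.cast_nonneg k : (0:ℝ) ≤ k)]
    have e1 : ‖mellin (twist l A) (s - 1)‖ ≤ C * (Z / |l|) ^ k := by
      refine h1.trans ?_
      gcongr
      rw [hZ]; push_cast; linarith
    have e2 : ‖mellin (twist l (deriv A)) s‖ ≤ D * (Z / |l|) ^ k := by
      refine h2.trans ?_
      gcongr
      rw [hZ]; push_cast; linarith
    have e3 : ‖s - 1‖ ≤ Z := by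
      rw [hZ]; push_cast; linarith [(Nat.cast_nonneg k : (0:ℝ) ≤ k)]
    have e4 : 2 * Real.pi * I * l * mellin (twist l A) s =
        - (mellin (twist l (deriv A)) s + (s - 1) * mellin (twist l A) (s - 1)) := by
      linear_combination hrec
    have e5 : ‖2 * Real.pi * I * l * mellin (twist l A) s‖ =
        2 * Real.pi * |l| * ‖mellin (twist l A) s‖ := by
      simp [abs_of_pos Real.pi_pos]
    have e6 : 2 * Real.pi * |l| * ‖mellin (twist l A) s‖ ≤
        D * (Z / |l|) ^ k + Z * (C * (Z / |l|) ^ k) := by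
      rw [← e5, e4, norm_neg]
      refine (norm_add_le _ _).trans (add_le_add e2 ?_)
      rw [norm_mul]
      gcongr
    have e7 : |l| * ‖mellin (twist l A) s‖ ≤ Z * ((C + D) * (Z / |l|) ^ k) := by
      have p1 : |l| * ‖mellin (twist l A) s‖ ≤ 2 * Real.pi * |l| * ‖mellin (twist l A) s‖ := by
        have : (1:ℝ) ≤ 2 * Real.pi := by linarith [Real.pi_gt_three]
        rw [mul_assoc]
        exact le_mul_of_one_le_left (by positivity) this
      have p2 : D * (Z / |l|) ^ k ≤ Z * (D * (Z / |l|) ^ k) :=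
        le_mul_of_one_le_left (by positivity) hZ0
      calc _ ≤ _ := p1.trans (e6.trans (add_le_add_left p2 _))
        _ = _ := by ring
    calc ‖mellin (twist l A) s‖ ≤ Z * ((C + D) * (Z / |l|) ^ k) / |l| := by
          rw [le_div_iff₀ hl', mul_comm]; exact e7
      _ = _ := by rw [pow_succ]; field_simp

open scoped FourierTransform in
lemma TestFn.exists_schwartzMap {F : ℝ → ℂ} (hF : TestFn F) (σ : ℝ) :
    ∃ h : SchwartzMap ℝ ℂ, (∀ u, h u = Real.exp (-σ * u) • F (Real.exp (-u))) ∧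
      ∀ τ : ℝ, mellin F (σ + τ * I) = 𝓕 h (τ / (2 * Real.pi)) := by
  obtain ⟨h1, a, b, ha, hab, h⟩ := hF
  have hb : 0 < b := ha.trans_le hab
  set f : ℝ → ℂ := fun u => Real.exp (-σ * u) • F (Real.exp (-u))
  have hf : ContDiff ℝ (⊤ : ℕ∞) f :=
    (Real.contDiff_exp.comp (contDiff_const.mul contDiff_id)).smul
      (h1.comp (Real.contDiff_exp.comp contDiff_neg))
  have hc : HasCompactSupport f := by
    refine HasCompactSupport.intro (isCompact_Icc (a := -Real.log b) (b := -Real.log a)) fun u hu => ?_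
    have : F (Real.exp (-u)) = 0 := by
      refine h _ fun h' => hu ⟨?_, ?_⟩
      · have := (Real.le_log_iff_exp_le hb).2 h'.2; linarith
      · have := (Real.log_le_iff_le_exp ha).2 h'.1; linarith
    simp [f, this]
  refine ⟨hc.toSchwartzMap hf, fun u => rfl, fun τ => ?_⟩
  rw [mellin_eq_fourier, SchwartzMap.fourier_coe]
  have hre : (σ + τ * I : ℂ).re = σ := by simp
  have him : (σ + τ * I : ℂ).im = τ := by simp
  rw [hre, him]
  rfl

lemma TestFn.verticalIntegrable_mellin {F : ℝ → ℂ} (hF : TestFn F) (σ : ℝ) :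
    VerticalIntegrable (mellin F) σ := by
  obtain ⟨h, -, h2⟩ := hF.exists_schwartzMap σ
  refine Integrable.congr (f := fun τ : ℝ => (FourierTransform.fourier h) (τ / (2 * Real.pi))) ?_
    (Eventually.of_forall fun τ => (h2 τ).symm)
  exact (FourierTransform.fourier h).integrable.comp_div (by positivity)

lemma TestFn.exists_integral_norm_sq_mellin_twist {A : ℝ → ℂ} (hA : TestFn A) (σ : ℝ) :
    ∃ C > 0, ∀ l : ℝ, Integrable (fun τ : ℝ => ‖mellin (twist l A) (σ + τ * I)‖ ^ 2) ∧
      ∫ τ : ℝ, ‖mellin (twist l A) (σ + τ * I)‖ ^ 2 ≤ C := by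
  refine ⟨2 * Real.pi * (∫ u : ℝ, ‖Real.exp (-σ * u) • A (Real.exp (-u))‖ ^ 2) + 1, ?_, fun l => ?_⟩
  · have : 0 ≤ ∫ u : ℝ, ‖Real.exp (-σ * u) • A (Real.exp (-u))‖ ^ 2 :=
      integral_nonneg fun u => by positivity
    positivity
  obtain ⟨h, h1, h2⟩ := (hA.twisted l).exists_schwartzMap σ
  have hp : (2 * Real.pi) ≠ 0 := by positivity
  have e : (fun τ : ℝ => ‖mellin (twist l A) (σ + τ * I)‖ ^ 2) =
      fun τ : ℝ => (fun ξ => ‖FourierTransform.fourier h ξ‖ ^ 2) (τ / (2 * Real.pi)) := by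
    funext τ; rw [h2]
  rw [e]
  constructor
  · have h3 : MemLp (FourierTransform.fourier h : SchwartzMap ℝ ℂ) 2 volume := SchwartzMap.memLp _ 2 volume
    have h4 : Integrable fun ξ : ℝ => ‖(FourierTransform.fourier h : SchwartzMap ℝ ℂ) ξ‖ ^ 2 := by
      simpa using h3.integrable_norm_pow (by norm_num)
    exact h4.comp_div hp
  · rw [Measure.integral_comp_div (fun ξ : ℝ => ‖(FourierTransform.fourier h : SchwartzMap ℝ ℂ) ξ‖ ^ 2),
      h.integral_norm_sq_fourier,
      abs_of_pos (by positivity)]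
    have : ∀ u, ‖h u‖ ^ 2 = ‖Real.exp (-σ * u) • A (Real.exp (-u))‖ ^ 2 := by
      intro u; rw [h1, norm_smul, norm_smul, norm_twist]
    simp_rw [this]
    rw [smul_eq_mul]; linarith

lemma TestFn.continuous_mellin_vertical {F : ℝ → ℂ} (hF : TestFn F) (σ : ℝ) :
    Continuous fun τ : ℝ => mellin F (σ + τ * I) :=
  hF.differentiable_mellin.continuous.comp (by fun_prop)

lemma TestFn.exists_integral_mul_norm_sq_mellin_twist {A : ℝ → ℂ} (hA : TestFn A) (σ : ℝ) :
    ∃ C > 0, ∀ l : ℝ, 1 ≤ |l| →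
      Integrable (fun τ : ℝ => (l ^ 2 + τ ^ 2) * ‖mellin (twist l A) (σ + τ * I)‖ ^ 2) ∧
      ∫ τ : ℝ, (l ^ 2 + τ ^ 2) * ‖mellin (twist l A) (σ + τ * I)‖ ^ 2 ≤ C * l ^ 2 := by
  obtain ⟨C0, hC0, h0⟩ := hA.exists_integral_norm_sq_mellin_twist σ
  obtain ⟨C1, hC1, h1⟩ := hA.exists_integral_norm_sq_mellin_twist (σ + 1)
  obtain ⟨C2, hC2, h2⟩ := hA.derivative.exists_integral_norm_sq_mellin_twist (σ + 1)
  refine ⟨C0 + 2 * C2 + 8 * Real.pi ^ 2 * C1, by positivity, fun l hl => ?_⟩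
  have hl2 : 1 ≤ l ^ 2 := by rw [← sq_abs]; nlinarith
  set m0 : ℝ → ℝ := fun τ => ‖mellin (twist l A) (σ + τ * I)‖ ^ 2
  set m1 : ℝ → ℝ := fun τ => ‖mellin (twist l A) ((σ + 1 : ℝ) + τ * I)‖ ^ 2
  set m2 : ℝ → ℝ := fun τ => ‖mellin (twist l (deriv A)) ((σ + 1 : ℝ) + τ * I)‖ ^ 2
  obtain ⟨i0, b0⟩ := h0 l
  obtain ⟨i1, b1⟩ := h1 l
  obtain ⟨i2, b2⟩ := h2 l
  have key : ∀ τ, (l ^ 2 + τ ^ 2) * m0 τ ≤ l ^ 2 * m0 τ + 2 * m2 τ + 8 * Real.pi ^ 2 * l ^ 2 * m1 τ := by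
    intro τ
    have hr := hA.mellin_twist_recursion l (σ + τ * I + 1)
    have e1 : (σ + τ * I + 1 : ℂ) = (σ + 1 : ℝ) + τ * I := by push_cast; ring
    rw [add_sub_cancel_right, e1] at hr
    have e2 : (σ + τ * I) * mellin (twist l A) (σ + τ * I) =
        -(mellin (twist l (deriv A)) ((σ + 1 : ℝ) + τ * I) +
          2 * Real.pi * I * l * mellin (twist l A) ((σ + 1 : ℝ) + τ * I)) := by
      linear_combination hr
    have e3 : |τ| ≤ ‖(σ + τ * I : ℂ)‖ := by simpa using Complex.abs_im_le_norm (σ + τ * I : ℂ)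
    have e4 : |τ| * ‖mellin (twist l A) (σ + τ * I)‖ ≤
        ‖mellin (twist l (deriv A)) ((σ + 1 : ℝ) + τ * I)‖ +
          2 * Real.pi * |l| * ‖mellin (twist l A) ((σ + 1 : ℝ) + τ * I)‖ := by
      calc _ ≤ ‖(σ + τ * I : ℂ)‖ * ‖mellin (twist l A) (σ + τ * I)‖ := by gcongr
        _ = ‖mellin (twist l (deriv A)) ((σ + 1 : ℝ) + τ * I) +
          2 * Real.pi * I * l * mellin (twist l A) ((σ + 1 : ℝ) + τ * I)‖ := by
            rw [← norm_mul, e2, norm_neg]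
        _ ≤ _ := by
            refine (norm_add_le _ _).trans (add_le_add le_rfl (le_of_eq ?_))
            simp [abs_of_pos Real.pi_pos]
    have e5 := pow_le_pow_left₀ (by positivity) e4 2
    have e6 := add_sq_le (a := ‖mellin (twist l (deriv A)) ((σ + 1 : ℝ) + τ * I)‖)
      (b := 2 * Real.pi * |l| * ‖mellin (twist l A) ((σ + 1 : ℝ) + τ * I)‖)
    rw [mul_pow, sq_abs] at e5
    rw [mul_pow, mul_pow, mul_pow, sq_abs] at e6
    simp only [m0, m1, m2]
    linarith
  have j0 : Integrable fun τ => l ^ 2 * m0 τ := i0.const_mul _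
  have j1 : Integrable fun τ => 8 * Real.pi ^ 2 * l ^ 2 * m1 τ := i1.const_mul _
  have j2 : Integrable fun τ => 2 * m2 τ := i2.const_mul _
  have j3 : Integrable fun τ => l ^ 2 * m0 τ + 2 * m2 τ := j0.add j2
  have iM : Integrable fun τ => l ^ 2 * m0 τ + 2 * m2 τ + 8 * Real.pi ^ 2 * l ^ 2 * m1 τ :=
    j3.add j1
  have hcont : Continuous fun τ => (l ^ 2 + τ ^ 2) * m0 τ := by
    have := (hA.twisted l).continuous_mellin_vertical σ
    fun_prop
  have hI : Integrable fun τ => (l ^ 2 + τ ^ 2) * m0 τ := by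
    refine iM.mono' hcont.aestronglyMeasurable (Eventually.of_forall fun τ => ?_)
    rw [Real.norm_of_nonneg (by positivity)]
    exact key τ
  refine ⟨hI, (integral_mono hI iM key).trans ?_⟩
  rw [integral_add j3 j1, integral_add j0 j2, integral_const_mul, integral_const_mul,
    integral_const_mul]
  have p1 : l ^ 2 * (∫ τ, m0 τ) ≤ l ^ 2 * C0 := by gcongr
  have p2 : 2 * (∫ τ, m2 τ) ≤ 2 * C2 * l ^ 2 :=
    (mul_le_mul_of_nonneg_left b2 (by norm_num)).trans (le_mul_of_one_le_right (by positivity) hl2)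
  have p3 : 8 * Real.pi ^ 2 * l ^ 2 * (∫ τ, m1 τ) ≤ 8 * Real.pi ^ 2 * l ^ 2 * C1 := by gcongr
  linarith

lemma TestFn.exists_integral_norm_mellin_twist_mul_rpow {A : ℝ → ℂ} (hA : TestFn A) (σ : ℝ) {η : ℝ}
    (hη : 0 < η) (hη1 : η ≤ 1 / 4) :
    ∃ C > 0, ∀ l : ℝ, 1 ≤ |l| →
      Integrable (fun τ : ℝ => ‖mellin (twist l A) (σ + τ * I)‖ * (|τ| + 2) ^ η) ∧
      ∫ τ : ℝ, ‖mellin (twist l A) (σ + τ * I)‖ * (|τ| + 2) ^ η ≤ C * |l| ^ (1 / 2 + 2 * η) := by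
  obtain ⟨C, hC, h⟩ := hA.exists_integral_mul_norm_sq_mellin_twist σ
  set J := ∫ τ : ℝ, (1 + |τ|) ^ (-(1 + η)) with hJ
  have hJi : Integrable fun τ : ℝ => (1 + |τ|) ^ (-(1 + η)) := integrable_one_add_abs_rpow (by linarith)
  have hJ0 : 0 ≤ J := integral_nonneg fun τ => by positivity
  refine ⟨C + 8 * J, by positivity, fun l hl => ?_⟩
  obtain ⟨i, b⟩ := h l hl
  set T := |l| with hT
  have hT0 : 0 < T := by linarith
  set c : ℝ := T ^ (-(3 / 2) + 2 * η) with hc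
  have hc0 : 0 < c := by positivity
  set m : ℝ → ℝ := fun τ => ‖mellin (twist l A) (σ + τ * I)‖ with hm
  have hw : ∀ τ : ℝ, ((|τ| + 2) ^ η) ^ 2 ≤
      (8 * T ^ (-(1 - 3 * η)) * (1 + |τ|) ^ (-(1 + η))) * (l ^ 2 + τ ^ 2) := by
    intro τ
    have hu : 0 < 1 + |τ| := by positivity
    have hv : 0 < T + |τ| := by positivity
    have a1 : ((|τ| + 2) ^ η) ^ 2 ≤ 4 * (1 + |τ|) ^ (2 * η) := by
      have : ((|τ| + 2) ^ η) ^ 2 = (|τ| + 2) ^ (2 * η) := by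
        rw [mul_comm, Real.rpow_mul (by positivity), Real.rpow_ofNat]
      rw [this]
      calc (|τ| + 2) ^ (2 * η) ≤ (2 * (1 + |τ|)) ^ (2 * η) := by
            gcongr; linarith [abs_nonneg τ]
        _ = 2 ^ (2 * η) * (1 + |τ|) ^ (2 * η) := Real.mul_rpow (by norm_num) hu.le
        _ ≤ 4 * (1 + |τ|) ^ (2 * η) := by
            gcongr
            calc (2:ℝ) ^ (2 * η) ≤ 2 ^ (2:ℝ) := Real.rpow_le_rpow_of_exponent_le (by norm_num) (by linarith)
              _ = 4 := by norm_num
    have a2 : (T + |τ|) ^ 2 ≤ 2 * (l ^ 2 + τ ^ 2) := by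
      have := add_sq_le (a := T) (b := |τ|)
      rwa [sq_abs, hT, sq_abs] at this
    have a3 : T ^ (1 - 3 * η) * (1 + |τ|) ^ (1 + 3 * η) ≤ (T + |τ|) ^ 2 := by
      calc _ ≤ (T + |τ|) ^ (1 - 3 * η) * (T + |τ|) ^ (1 + 3 * η) := by
            refine mul_le_mul ?_ ?_ (by positivity) (by positivity)
            · exact Real.rpow_le_rpow hT0.le (by linarith [abs_nonneg τ]) (by linarith)
            · exact Real.rpow_le_rpow hu.le (by linarith) (by linarith)
        _ = (T + |τ|) ^ 2 := by
            rw [← Real.rpow_add hv, ← Real.rpow_natCast]; norm_num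
    have a4 : (1 + |τ|) ^ (2 * η) = T ^ (-(1 - 3 * η)) * (1 + |τ|) ^ (-(1 + η)) *
        (T ^ (1 - 3 * η) * (1 + |τ|) ^ (1 + 3 * η)) := by
      rw [mul_mul_mul_comm, ← Real.rpow_add hT0, ← Real.rpow_add hu]
      rw [show -(1 - 3 * η) + (1 - 3 * η) = 0 by ring, Real.rpow_zero, one_mul]
      congr 1; ring
    calc _ ≤ _ := a1
      _ = 4 * (T ^ (-(1 - 3 * η)) * (1 + |τ|) ^ (-(1 + η)) *
        (T ^ (1 - 3 * η) * (1 + |τ|) ^ (1 + 3 * η))) := by rw [a4]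
      _ ≤ 4 * (T ^ (-(1 - 3 * η)) * (1 + |τ|) ^ (-(1 + η)) * (2 * (l ^ 2 + τ ^ 2))) := by
          refine mul_le_mul_of_nonneg_left ?_ (by norm_num)
          exact mul_le_mul_of_nonneg_left (a3.trans a2) (by positivity)
      _ = _ := by ring
  have key : ∀ τ, m τ * (|τ| + 2) ^ η ≤ c * ((l ^ 2 + τ ^ 2) * m τ ^ 2) +
      c⁻¹ * (8 * T ^ (-(1 - 3 * η))) * (1 + |τ|) ^ (-(1 + η)) := by
    intro τ
    have hq : 0 < l ^ 2 + τ ^ 2 := by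
      have : 0 < l ^ 2 := by rw [← sq_abs]; positivity
      positivity
    set w := (|τ| + 2) ^ η
    set W := 8 * T ^ (-(1 - 3 * η)) * (1 + |τ|) ^ (-(1 + η))
    have h1 : w ^ 2 ≤ W * (l ^ 2 + τ ^ 2) := hw τ
    have h2 : w ^ 2 / (l ^ 2 + τ ^ 2) ≤ W := by rw [div_le_iff₀ hq]; exact h1
    have h3 : m τ * w ≤ c * ((l ^ 2 + τ ^ 2) * m τ ^ 2) + c⁻¹ * (w ^ 2 / (l ^ 2 + τ ^ 2)) := by
      have hcq : 0 < c * (l ^ 2 + τ ^ 2) := by positivity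
      have e : c * ((l ^ 2 + τ ^ 2) * m τ ^ 2) + c⁻¹ * (w ^ 2 / (l ^ 2 + τ ^ 2)) - m τ * w =
          ((c * (l ^ 2 + τ ^ 2) * m τ - w / 2) ^ 2 + 3 / 4 * w ^ 2) / (c * (l ^ 2 + τ ^ 2)) := by
        field_simp; ring
      have : 0 ≤ ((c * (l ^ 2 + τ ^ 2) * m τ - w / 2) ^ 2 + 3 / 4 * w ^ 2) / (c * (l ^ 2 + τ ^ 2)) := by
        positivity
      linarith
    calc _ ≤ _ := h3
      _ ≤ c * ((l ^ 2 + τ ^ 2) * m τ ^ 2) + c⁻¹ * W := by gcongr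
      _ = _ := by simp only [W]; ring
  have iM := (i.const_mul c).add (hJi.const_mul (c⁻¹ * (8 * T ^ (-(1 - 3 * η)))))
  have hcont : Continuous fun τ => m τ * (|τ| + 2) ^ η := by
    have := (hA.twisted l).continuous_mellin_vertical σ
    exact this.norm.mul ((by fun_prop : Continuous fun τ : ℝ => |τ| + 2).rpow_const
      fun τ => Or.inr hη.le)
  have hI : Integrable fun τ => m τ * (|τ| + 2) ^ η := by
    refine iM.mono' hcont.aestronglyMeasurable (Eventually.of_forall fun τ => ?_)
    rw [Real.norm_of_nonneg (by positivity)]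
    exact key τ
  refine ⟨hI, (integral_mono hI iM key).trans ?_⟩
  simp only [Pi.add_apply]
  rw [integral_add (i.const_mul c) (hJi.const_mul _), integral_const_mul, integral_const_mul, ← hJ]
  have q1 : c * l ^ 2 = T ^ (1 / 2 + 2 * η) := by
    rw [← sq_abs, ← hT, hc, ← Real.rpow_natCast, ← Real.rpow_add hT0]
    congr 1; push_cast; ring
  have q2 : c⁻¹ * T ^ (-(1 - 3 * η)) ≤ T ^ (1 / 2 + 2 * η) := by
    rw [hc, ← Real.rpow_neg hT0.le, ← Real.rpow_add hT0]
    exact Real.rpow_le_rpow_of_exponent_le hl (by linarith)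
  calc c * (∫ τ : ℝ, (l ^ 2 + τ ^ 2) * m τ ^ 2) + c⁻¹ * (8 * T ^ (-(1 - 3 * η))) * J
      ≤ c * (C * l ^ 2) + c⁻¹ * (8 * T ^ (-(1 - 3 * η))) * J := by gcongr
    _ = C * (c * l ^ 2) + 8 * J * (c⁻¹ * T ^ (-(1 - 3 * η))) := by ring
    _ ≤ C * T ^ (1 / 2 + 2 * η) + 8 * J * T ^ (1 / 2 + 2 * η) := by
        rw [q1]; gcongr
    _ = _ := by ring

/-- A vertical integral over a segment is controlled by shifting the segment to the right. -/
lemma norm_vertical_integral_le_of_shift {G : ℂ → ℂ} {σ₀ σ₁ T₀ B₁ B₂ : ℝ} (hσ : σ₀ ≤ σ₁)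
    (hT : 0 ≤ T₀) (hG : DifferentiableOn ℂ G (uIcc σ₀ σ₁ ×ℂ uIcc (-T₀) T₀))
    (h₁ : ∀ τ ∈ Icc (-T₀) T₀, ‖G (σ₁ + τ * I)‖ ≤ B₁)
    (h₂ : ∀ σ ∈ Icc σ₀ σ₁, ∀ τ, |τ| = T₀ → ‖G (σ + τ * I)‖ ≤ B₂) :
    ‖∫ τ in (-T₀)..T₀, G (σ₀ + τ * I)‖ ≤ 2 * T₀ * B₁ + 2 * (σ₁ - σ₀) * B₂ := by
  have hz : (σ₀ + (-T₀) * I : ℂ).re = σ₀ ∧ (σ₀ + (-T₀) * I : ℂ).im = -T₀ := by simp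
  have hw : (σ₁ + T₀ * I : ℂ).re = σ₁ ∧ (σ₁ + T₀ * I : ℂ).im = T₀ := by simp
  have := Complex.integral_boundary_rect_eq_zero_of_differentiableOn G (σ₀ + (-T₀) * I : ℂ)
    (σ₁ + T₀ * I : ℂ) (by rw [hz.1, hz.2, hw.1, hw.2]; exact hG)
  rw [hz.1, hz.2, hw.1, hw.2] at this
  have e : I * (∫ τ in (-T₀)..T₀, G (σ₀ + τ * I)) =
      (∫ x in σ₀..σ₁, G (x + (-T₀ : ℝ) * I)) - (∫ x in σ₀..σ₁, G (x + T₀ * I)) +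
        I * ∫ τ in (-T₀)..T₀, G (σ₁ + τ * I) := by
    simp only [smul_eq_mul] at this
    linear_combination -this
  have n : ‖∫ τ in (-T₀)..T₀, G (σ₀ + τ * I)‖ = ‖I * (∫ τ in (-T₀)..T₀, G (σ₀ + τ * I))‖ := by simp
  have b1 : ‖∫ x in σ₀..σ₁, G (x + (-T₀ : ℝ) * I)‖ ≤ B₂ * |σ₁ - σ₀| := by
    refine intervalIntegral.norm_integral_le_of_norm_le_const fun x hx => ?_
    rw [uIoc_of_le hσ] at hx
    exact h₂ x ⟨hx.1.le, hx.2⟩ (-T₀) (by rw [abs_neg, abs_of_nonneg hT])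
  have b2 : ‖∫ x in σ₀..σ₁, G (x + T₀ * I)‖ ≤ B₂ * |σ₁ - σ₀| := by
    refine intervalIntegral.norm_integral_le_of_norm_le_const fun x hx => ?_
    rw [uIoc_of_le hσ] at hx
    exact h₂ x ⟨hx.1.le, hx.2⟩ T₀ (abs_of_nonneg hT)
  have b3 : ‖I * ∫ τ in (-T₀)..T₀, G (σ₁ + τ * I)‖ ≤ B₁ * |T₀ - (-T₀)| := by
    rw [norm_mul, norm_I, one_mul]
    refine intervalIntegral.norm_integral_le_of_norm_le_const fun x hx => ?_
    rw [uIoc_of_le (by linarith)] at hx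
    exact h₁ x ⟨hx.1.le, hx.2⟩
  rw [abs_of_nonneg (by linarith)] at b1 b2 b3
  rw [n, e]
  refine (norm_add_le _ _).trans ?_
  have := norm_sub_le (∫ x in σ₀..σ₁, G (x + (-T₀ : ℝ) * I)) (∫ x in σ₀..σ₁, G (x + T₀ * I))
  linarith

lemma tsum_smooth_eq_integral {N : ℕ} [NeZero N] (χ : DirichletCharacter ℂ N) (Y : ℕ) {F : ℝ → ℂ}
    (hF : TestFn F) {X σ : ℝ} (hX : 0 < X) (hσ : 0 < σ) :
    ∑' m : (Y + 1).smoothNumbers, χ (m : ℕ) * F ((m : ℕ) / X) =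
      (1 / (2 * Real.pi) : ℝ) • ∫ τ : ℝ, smoothL χ Y (σ + τ * I) * (X : ℂ) ^ (σ + τ * I : ℂ) *
        mellin F (σ + τ * I) := by
  have hs : ∀ τ : ℝ, 0 < (σ + τ * I : ℂ).re := fun τ => by simpa using hσ
  set f : (Y + 1).smoothNumbers → ℝ → ℂ := fun m τ =>
    χ (m : ℕ) * ((m : ℕ) : ℂ) ^ (-(σ + τ * I : ℂ)) * ((X : ℂ) ^ (σ + τ * I : ℂ) *
      mellin F (σ + τ * I)) with hf
  have hm0 : ∀ m : (Y + 1).smoothNumbers, 0 < (m : ℕ) := fun m =>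
    Nat.pos_of_ne_zero (Nat.ne_zero_of_mem_smoothNumbers m.2)
  have hv : Integrable fun τ : ℝ => mellin F (σ + τ * I) := hF.verticalIntegrable_mellin σ
  have hcv : ∀ {u : ℝ}, 0 < u → Continuous fun τ : ℝ => (u : ℂ) ^ (σ + τ * I : ℂ) := fun {u} hu =>
    Continuous.const_cpow (by fun_prop) (Or.inl (by exact_mod_cast hu.ne'))
  have hcv' : ∀ {u : ℝ}, 0 < u → Continuous fun τ : ℝ => (u : ℂ) ^ (-(σ + τ * I : ℂ)) := fun {u} hu =>
    Continuous.const_cpow (by fun_prop) (Or.inl (by exact_mod_cast hu.ne'))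
  have hnorm : ∀ m τ, ‖f m τ‖ = ‖χ (m : ℕ) * ((m : ℕ) : ℂ) ^ (-(σ : ℂ))‖ *
      (X ^ σ * ‖mellin F (σ + τ * I)‖) := by
    intro m τ
    have h1 : ‖((m : ℕ) : ℂ) ^ (-(σ + τ * I : ℂ))‖ = ‖((m : ℕ) : ℂ) ^ (-(σ : ℂ))‖ := by
      rw [norm_natCast_cpow_of_pos (hm0 m), norm_natCast_cpow_of_pos (hm0 m)]
      simp
    rw [hf]
    simp only [norm_mul, h1, norm_cpow_vertical hX]
  have h_int : ∀ m, Integrable (f m) := by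
    intro m
    refine Integrable.mono' ((hv.norm.const_mul (X ^ σ)).const_mul
      (‖χ (m : ℕ) * ((m : ℕ) : ℂ) ^ (-(σ : ℂ))‖)) ?_ (Eventually.of_forall fun τ => (hnorm m τ).le)
    refine Continuous.aestronglyMeasurable ?_
    have c1 := hcv' (u := ((m : ℕ) : ℝ)) (by exact_mod_cast hm0 m)
    have c2 := hF.continuous_mellin_vertical σ
    simp only [ofReal_natCast] at c1
    exact (continuous_const.mul c1).mul ((hcv hX).mul c2)
  have hsum : Summable fun m => ∫ τ, ‖f m τ‖ := by
    simp_rw [hnorm, integral_const_mul]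
    refine Summable.mul_right _ ?_
    exact (hasSum_smoothL χ Y (s := (σ : ℂ)) (by simpa using hσ)).1
  have key := (hasSum_integral_of_summable_integral_norm h_int hsum).tsum_eq
  have e1 : ∀ τ : ℝ, ∑' m, f m τ = smoothL χ Y (σ + τ * I) * (X : ℂ) ^ (σ + τ * I : ℂ) *
      mellin F (σ + τ * I) := by
    intro τ
    rw [hf, tsum_mul_right, (hasSum_smoothL χ Y (hs τ)).2.tsum_eq, mul_assoc]
  simp_rw [e1] at key
  rw [← key, ← tsum_const_smul'']
  refine tsum_congr fun m => ?_
  have hmX : 0 < ((m : ℕ) : ℝ) / X := div_pos (by exact_mod_cast hm0 m) hX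
  have inv := mellinInv_mellin_eq σ F hmX (hF.mellinConvergent σ) (hF.verticalIntegrable_mellin σ)
    hF.1.continuous.continuousAt
  rw [← inv, mellinInv, mul_smul_comm, ← integral_const_mul]
  congr 1
  refine integral_congr_ae (Eventually.of_forall fun τ => ?_)
  simp only [hf, smul_eq_mul]
  have : (((m : ℕ) / X : ℝ) : ℂ) ^ (-(σ + τ * I : ℂ)) =
      ((m : ℕ) : ℂ) ^ (-(σ + τ * I : ℂ)) * (X : ℂ) ^ (σ + τ * I : ℂ) := by
    rw [div_eq_mul_inv, ofReal_mul, mul_cpow_ofReal_nonneg (by positivity) (by positivity), ofReal_inv,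
      inv_cpow, cpow_neg (X : ℂ), inv_inv]
    · simp
    · rw [arg_ofReal_of_nonneg hX.le]; exact Real.pi_ne_zero.symm
  rw [this]; ring

lemma exists_norm_tsum_smooth_le (hGRH : GRH) {A : ℝ → ℂ} (hA : TestFn A) {κ η : ℝ} (hκ : 0 < κ)
    (hκ1 : κ ≤ 1 / 4) (hη : 0 < η) (hη1 : η ≤ 1 / 4) (k : ℕ) :
    ∃ C > 0, ∀ (N : ℕ) [NeZero N] (χ : DirichletCharacter ℂ N) (Y : ℕ) (X l : ℝ), 1 ≤ X → 1 ≤ |l| →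
      (Y : ℝ) ^ 4 ≤ |l| ^ (1 / 2 : ℝ) →
      ‖∑' m : (Y + 1).smoothNumbers, χ (m : ℕ) * twist l A ((m : ℕ) / X)‖ ≤
        C * (X ^ (1 / 2 + 2 * κ) * (N : ℝ) ^ η * |l| ^ (1 / 2 + 2 * η) +
          X ^ 2 * N * |l| ^ (1 - k / 2 : ℝ)) := by
  obtain ⟨C1, hC1, h1⟩ := exists_norm_smoothL_le hGRH hκ hκ1 hη
  obtain ⟨C2, hC2, h2⟩ := exists_norm_smoothL_two_le
  obtain ⟨C3, hC3, h3⟩ := hA.exists_norm_mellin_twist_le_pow k 2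
  obtain ⟨C4, hC4, h4⟩ := hA.exists_integral_norm_mellin_twist_mul_rpow (1 / 2 + 2 * κ) hη hη1
  refine ⟨C1 * C4 + (2 * C2 + 9 * C1) * (C3 * (k + 4) ^ k), by positivity, fun N _ χ Y X l hX hl hY => ?_⟩
  set T := |l| with hT
  set T₀ := T ^ (1 / 2 : ℝ) with hT₀
  have hTp : 0 < T := by linarith
  have hT₀1 : 1 ≤ T₀ := Real.one_le_rpow hl (by norm_num)
  have hT₀T : T₀ ≤ T := by
    calc T₀ ≤ T ^ (1:ℝ) := Real.rpow_le_rpow_of_exponent_le hl (by norm_num)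
      _ = T := Real.rpow_one T
  have hTsq : T₀ * T₀ = T := by rw [hT₀, ← Real.rpow_add hTp]; norm_num
  have hX0 : 0 < X := by linarith
  have hN : (1:ℝ) ≤ N := by exact_mod_cast NeZero.one_le
  have hl0 : l ≠ 0 := abs_pos.1 hTp
  set σ : ℝ := 1 / 2 + 2 * κ with hσ
  have hσ1 : σ ≤ 1 := by rw [hσ]; linarith
  have hσ0 : 0 < σ := by positivity
  set F := twist l A with hFdef
  have hF : TestFn F := hA.twisted l
  set G : ℂ → ℂ := fun s => smoothL χ Y s * (X : ℂ) ^ s * mellin F s with hG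
  rw [tsum_smooth_eq_integral χ Y hF hX0 hσ0]
  have hpi : ‖(1 / (2 * Real.pi) : ℝ)‖ ≤ 1 := by
    rw [Real.norm_of_nonneg (by positivity), div_le_one (by positivity)]
    linarith [Real.pi_gt_three]
  rw [norm_smul]
  refine (mul_le_of_le_one_left (norm_nonneg _) hpi).trans ?_
  change ‖∫ τ : ℝ, G (σ + τ * I)‖ ≤ _
  have hGd : ∀ s : ℂ, 0 < s.re → DifferentiableAt ℂ G s := by
    intro s hs
    refine ((differentiableAt_smoothL χ Y hs).mul ?_).mul (hF.differentiable_mellin s)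
    exact DifferentiableAt.const_cpow differentiableAt_id (Or.inl (by exact_mod_cast hX0.ne'))
  have hGc : Continuous fun τ : ℝ => G (σ + τ * I) := by
    refine continuous_iff_continuousAt.2 fun τ => ?_
    have := (hGd (σ + τ * I) (by simpa using hσ0)).continuousAt
    exact ContinuousAt.comp (f := fun τ : ℝ => (σ + τ * I : ℂ)) this (by fun_prop)
  obtain ⟨hWi, hWb⟩ := h4 l hl
  have hout : ∀ τ ∉ Ioc (-T₀) T₀, ‖G (σ + τ * I)‖ ≤ C1 * X ^ σ * (N : ℝ) ^ η *
      (‖mellin F (σ + τ * I)‖ * (|τ| + 2) ^ η) := by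
    intro τ hτ
    have hτ' : T₀ ≤ |τ| := by
      by_contra! hlt
      exact hτ ⟨(abs_lt.1 hlt).1, (abs_lt.1 hlt).2.le⟩
    have := h1 N χ (σ + τ * I) Y (by simp [hσ]) (by simp; linarith) (by simpa using hY.trans hτ')
    simp only [add_im, ofReal_im, mul_im, ofReal_re, I_im, mul_one, I_re, mul_zero, add_zero, zero_add] at this
    rw [Real.mul_rpow (by positivity) (by positivity)] at this
    rw [hG]
    simp only [norm_mul, norm_cpow_vertical hX0]
    calc _ ≤ C1 * ((N : ℝ) ^ η * (|τ| + 2) ^ η) * X ^ σ * ‖mellin F (σ + τ * I)‖ := by gcongr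
      _ = _ := by ring
  have hWi' := hWi.const_mul (C1 * X ^ σ * (N : ℝ) ^ η)
  have houti : IntegrableOn (fun τ : ℝ => G (σ + τ * I)) (Ioc (-T₀) T₀)ᶜ :=
    Integrable.mono' hWi'.integrableOn hGc.aestronglyMeasurable
      ((ae_restrict_iff' measurableSet_Ioc.compl).2 (Eventually.of_forall fun τ hτ => hout τ hτ))
  have hini : IntegrableOn (fun τ : ℝ => G (σ + τ * I)) (Ioc (-T₀) T₀) :=
    (hGc.integrableOn_Icc).mono_set Ioc_subset_Icc_self
  have hGi : Integrable fun τ : ℝ => G (σ + τ * I) := by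
    have := hini.union houti
    rwa [union_compl_self, integrableOn_univ] at this
  have hbout : ‖∫ τ in (Ioc (-T₀) T₀)ᶜ, G (σ + τ * I)‖ ≤
      C1 * C4 * (X ^ σ * (N : ℝ) ^ η * T ^ (1 / 2 + 2 * η)) := by
    calc _ ≤ ∫ τ in (Ioc (-T₀) T₀)ᶜ, C1 * X ^ σ * (N : ℝ) ^ η *
          (‖mellin F (σ + τ * I)‖ * (|τ| + 2) ^ η) :=
          norm_integral_le_of_norm_le hWi'.integrableOn
            ((ae_restrict_iff' measurableSet_Ioc.compl).2 (Eventually.of_forall fun τ hτ => hout τ hτ))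
      _ ≤ ∫ τ : ℝ, C1 * X ^ σ * (N : ℝ) ^ η * (‖mellin F (σ + τ * I)‖ * (|τ| + 2) ^ η) :=
          setIntegral_le_integral hWi' (Eventually.of_forall fun τ => by positivity)
      _ = C1 * X ^ σ * (N : ℝ) ^ η * ∫ τ : ℝ, ‖mellin F (σ + τ * I)‖ * (|τ| + 2) ^ η := integral_const_mul _ _
      _ ≤ C1 * X ^ σ * (N : ℝ) ^ η * (C4 * T ^ (1 / 2 + 2 * η)) := by gcongr
      _ = _ := by ring
  have hM : ∀ s : ℂ, 0 ≤ s.re → s.re ≤ 2 → |s.im| ≤ T₀ →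
      ‖mellin F s‖ ≤ C3 * (k + 4) ^ k * T ^ (-(k / 2 : ℝ)) := by
    intro s hs0 hs2 him
    have hsn : ‖s‖ ≤ 2 + T₀ := by
      have := Complex.norm_le_abs_re_add_abs_im s
      rw [abs_of_nonneg hs0] at this
      linarith
    have := h3 l s hl0 (by rw [abs_of_nonneg hs0]; exact hs2)
    refine this.trans ?_
    have h5 : (k + 1 + ‖s‖) / T ≤ (k + 4) * T ^ (-(1 / 2 : ℝ)) := by
      rw [div_le_iff₀ hTp, Real.rpow_neg hTp.le, ← hT₀]
      have : (k + 4 : ℝ) * T₀⁻¹ * T = (k + 4) * T₀ := by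
        rw [← hTsq]; field_simp
      rw [this]
      nlinarith [(Nat.cast_nonneg k : (0:ℝ) ≤ k)]
    calc C3 * ((k + 1 + ‖s‖) / T) ^ k ≤ C3 * ((k + 4) * T ^ (-(1 / 2 : ℝ))) ^ k := by gcongr
      _ = C3 * (k + 4) ^ k * T ^ (-(k / 2 : ℝ)) := by
          rw [mul_pow, ← Real.rpow_natCast (T ^ _), ← Real.rpow_mul hTp.le, mul_assoc]
          congr 3; ring
  set D := C3 * (k + 4) ^ k * T ^ (-(k / 2 : ℝ)) with hD
  have hD0 : 0 ≤ D := by positivity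
  have hXs : ∀ s : ℂ, s.re ≤ 2 → ‖(X : ℂ) ^ s‖ ≤ X ^ 2 := by
    intro s hs
    rw [norm_cpow_eq_rpow_re_of_pos hX0, ← Real.rpow_natCast]
    exact Real.rpow_le_rpow_of_exponent_le hX (by simpa using hs)
  have hin : ‖∫ τ in (-T₀)..T₀, G (σ + τ * I)‖ ≤
      2 * T₀ * (C2 * X ^ 2 * D) + 2 * (2 - σ) * (C1 * (3 * N * T) * X ^ 2 * D) := by
    refine norm_vertical_integral_le_of_shift (σ₁ := 2) (by linarith) (by linarith) ?_ ?_ ?_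
    · intro s hs
      refine (hGd s ?_).differentiableWithinAt
      have := hs.1
      rw [uIcc_of_le (by linarith)] at this
      exact hσ0.trans_le this.1
    · intro τ hτ
      have hre : ((2 : ℝ) + τ * I : ℂ).re = 2 := by simp
      have him : ((2 : ℝ) + τ * I : ℂ).im = τ := by simp
      rw [hG]
      simp only [norm_mul]
      have a1 := h2 N χ ((2 : ℝ) + τ * I) Y hre
      have a2 := hXs ((2 : ℝ) + τ * I) hre.le
      have a3 := hM ((2 : ℝ) + τ * I) (by rw [hre]; norm_num) hre.le (by rw [him]; exact abs_le.2 hτ)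
      gcongr
    · intro x hx τ hτ
      have hre : (x + τ * I : ℂ).re = x := by simp
      have him : (x + τ * I : ℂ).im = τ := by simp
      rw [hG]
      simp only [norm_mul]
      have a1 := h1 N χ (x + τ * I) Y (by rw [hre]; exact hx.1) (by rw [hre]; exact hx.2)
        (by rw [him, hτ]; exact hY)
      rw [him, hτ] at a1
      have a2 := hXs (x + τ * I) (by rw [hre]; exact hx.2)
      have a3 := hM (x + τ * I) (by rw [hre]; linarith [hx.1]) (by rw [hre]; exact hx.2)
        (by rw [him]; exact hτ.le)
      have a4 : ((N : ℝ) * (T₀ + 2)) ^ η ≤ 3 * N * T := by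
        have b1 : 1 ≤ (N : ℝ) * (T₀ + 2) := by nlinarith
        calc ((N : ℝ) * (T₀ + 2)) ^ η ≤ ((N : ℝ) * (T₀ + 2)) ^ (1:ℝ) :=
              Real.rpow_le_rpow_of_exponent_le b1 (by linarith)
          _ = (N : ℝ) * (T₀ + 2) := Real.rpow_one _
          _ ≤ N * (3 * T) := by gcongr; linarith
          _ = 3 * N * T := by ring
      have a5 : ‖smoothL χ Y (x + τ * I)‖ ≤ C1 * (3 * N * T) := a1.trans (by gcongr)
      gcongr
  have hfin : 2 * T₀ * (C2 * X ^ 2 * D) + 2 * (2 - σ) * (C1 * (3 * N * T) * X ^ 2 * D) ≤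
      (2 * C2 + 9 * C1) * (C3 * (k + 4) ^ k) * (X ^ 2 * N * T ^ (1 - k / 2 : ℝ)) := by
    have e : T ^ (1 - k / 2 : ℝ) = T * T ^ (-(k / 2 : ℝ)) := by
      rw [sub_eq_add_neg, Real.rpow_add hTp, Real.rpow_one]
    have p1 : T₀ ≤ N * T := hT₀T.trans (le_mul_of_one_le_left hTp.le hN)
    have p2 : 2 * (2 - σ) ≤ 3 := by rw [hσ]; linarith
    calc _ ≤ 2 * (N * T) * (C2 * X ^ 2 * D) + 3 * (C1 * (3 * N * T) * X ^ 2 * D) := by gcongr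
      _ = _ := by rw [hD, e]; ring
  rw [← integral_add_compl (s := Ioc (-T₀) T₀) measurableSet_Ioc hGi, ← intervalIntegral.integral_of_le (by linarith)]
  refine (norm_add_le _ _).trans ?_
  have h5 := add_le_add (hin.trans hfin) hbout
  refine h5.trans ?_
  have u1 : 0 ≤ X ^ σ * (N : ℝ) ^ η * T ^ (1 / 2 + 2 * η) := by positivity
  have u2 : 0 ≤ X ^ 2 * N * T ^ (1 - k / 2 : ℝ) := by positivity
  have c1 : 0 ≤ C1 * C4 := by positivity
  have c2 : 0 ≤ (2 * C2 + 9 * C1) * (C3 * (k + 4) ^ k) := by positivity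
  have := mul_nonneg c1 u2
  have := mul_nonneg c2 u1
  linarith

lemma summable_subtype_of_eventually_zero {S : Set ℕ} {H : ℕ → ℂ} {M : ℕ} (hH : ∀ n > M, H n = 0) :
    Summable fun m : S => H m :=
  (summable_of_ne_finset_zero (s := Finset.range (M + 1)) fun n hn =>
    hH n (by simpa using hn)).subtype S

lemma sum_char_unit_mul_conj {r : ℕ} [NeZero r] (b c : (ZMod r)ˣ) :
    ∑ χ : DirichletCharacter ℂ r, χ (↑b⁻¹ : ZMod r) * (starRingEnd ℂ) (χ (↑c⁻¹ : ZMod r)) =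
      if b = c then (r.totient : ℂ) else 0 := by
  have h := DirichletCharacter.sum_char_inv_mul_char_eq ℂ (a := (b : ZMod r)) b.isUnit (c : ZMod r)
  simp only [Units.val_inj] at h
  rw [← h]
  refine Finset.sum_congr rfl fun χ _ => ?_
  have h1 : (b : ZMod r)⁻¹ = (↑b⁻¹ : ZMod r) := ZMod.inv_coe_unit b
  have h2 : (starRingEnd ℂ) (χ (↑c⁻¹ : ZMod r)) = χ (c : ZMod r) := by
    have hn : ‖χ (c : ZMod r)‖ = 1 := χ.unit_norm_eq_one c
    have hm : χ (↑c⁻¹ : ZMod r) * χ (c : ZMod r) = 1 := by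
      rw [← map_mul]; simp
    have : χ (↑c⁻¹ : ZMod r) = (χ (c : ZMod r))⁻¹ := eq_inv_of_mul_eq_one_left hm
    rw [this, map_inv₀, Complex.inv_def, Complex.conj_conj, Complex.normSq_conj, Complex.normSq_eq_norm_sq, hn]
    simp
  rw [h1, h2]

/-- The Fourier coefficient of a function on the unit group of `ZMod r`. -/
def unitCoeff {r : ℕ} [NeZero r] (f : (ZMod r)ˣ → ℂ) (χ : DirichletCharacter ℂ r) : ℂ :=
  ∑ b : (ZMod r)ˣ, χ (↑b⁻¹ : ZMod r) * f b

lemma sum_unitCoeff_mul {r : ℕ} [NeZero r] (f : (ZMod r)ˣ → ℂ) (c : (ZMod r)ˣ) :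
    ∑ χ : DirichletCharacter ℂ r, unitCoeff f χ * χ (c : ZMod r) = r.totient * f c := by
  have : ∀ χ : DirichletCharacter ℂ r, unitCoeff f χ * χ (c : ZMod r) =
      ∑ b : (ZMod r)ˣ, f b * (χ ((b : ZMod r)⁻¹) * χ (c : ZMod r)) := by
    intro χ
    rw [unitCoeff, Finset.sum_mul]
    refine Finset.sum_congr rfl fun b _ => ?_
    rw [ZMod.inv_coe_unit]; ring
  simp_rw [this]
  rw [Finset.sum_comm]
  simp_rw [← Finset.mul_sum]
  have h : ∀ b : (ZMod r)ˣ, ∑ χ : DirichletCharacter ℂ r, χ ((b : ZMod r)⁻¹) * χ (c : ZMod r) =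
      if b = c then (r.totient : ℂ) else 0 := fun b => by
    rw [DirichletCharacter.sum_char_inv_mul_char_eq ℂ b.isUnit]; simp only [Units.val_inj]
  simp_rw [h]
  simp [mul_comm]

lemma sum_norm_sq_unitCoeff {r : ℕ} [NeZero r] (f : (ZMod r)ˣ → ℂ) :
    ∑ χ : DirichletCharacter ℂ r, ‖unitCoeff f χ‖ ^ 2 = r.totient * ∑ b, ‖f b‖ ^ 2 := by
  have : (∑ χ : DirichletCharacter ℂ r, (‖unitCoeff f χ‖ ^ 2 : ℂ)) = r.totient * ∑ b, (‖f b‖ ^ 2 : ℂ) := by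
    have e : ∀ χ : DirichletCharacter ℂ r, (‖unitCoeff f χ‖ ^ 2 : ℂ) =
        ∑ b : (ZMod r)ˣ, ∑ c : (ZMod r)ˣ, f b * (starRingEnd ℂ) (f c) *
          (χ (↑b⁻¹ : ZMod r) * (starRingEnd ℂ) (χ (↑c⁻¹ : ZMod r))) := by
      intro χ
      rw [← Complex.mul_conj', unitCoeff, map_sum, Finset.sum_mul_sum]
      refine Finset.sum_congr rfl fun b _ => Finset.sum_congr rfl fun c _ => ?_
      rw [map_mul]; ring
    simp_rw [e]
    rw [Finset.sum_comm, Finset.mul_sum]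
    refine Finset.sum_congr rfl fun b _ => ?_
    rw [Finset.sum_comm]
    simp_rw [← Finset.mul_sum, sum_char_unit_mul_conj]
    simp [← Complex.mul_conj', mul_comm, mul_left_comm]
  exact_mod_cast this

lemma sum_norm_unitCoeff_le {r : ℕ} [NeZero r] {f : (ZMod r)ˣ → ℂ} (hf : ∀ b, ‖f b‖ ≤ 1) :
    ∑ χ : DirichletCharacter ℂ r, ‖unitCoeff f χ‖ ≤ r.totient * Real.sqrt r := by
  have h1 : (∑ χ : DirichletCharacter ℂ r, ‖unitCoeff f χ‖) ^ 2 ≤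
      (r.totient * Real.sqrt r) ^ 2 := by
    have hc : (Finset.univ : Finset (DirichletCharacter ℂ r)).card = r.totient := by
      rw [Finset.card_univ, ← Nat.card_eq_fintype_card]
      exact DirichletCharacter.card_eq_totient_of_hasEnoughRootsOfUnity ℂ r
    have hb : ∑ b : (ZMod r)ˣ, ‖f b‖ ^ 2 ≤ r.totient := by
      calc ∑ b : (ZMod r)ˣ, ‖f b‖ ^ 2 ≤ ∑ b : (ZMod r)ˣ, (1:ℝ) :=
            Finset.sum_le_sum fun b _ => pow_le_one₀ (norm_nonneg _) (hf b)
        _ = r.totient := by simp [ZMod.card_units_eq_totient]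
    have ht : (r.totient : ℝ) ≤ r := by exact_mod_cast Nat.totient_le r
    calc _ ≤ _ := sq_sum_le_card_mul_sum_sq
      _ = r.totient * (r.totient * ∑ b, ‖f b‖ ^ 2) := by rw [hc, sum_norm_sq_unitCoeff]
      _ ≤ r.totient * (r.totient * r) := by gcongr; exact hb.trans ht
      _ = _ := by rw [mul_pow, Real.sq_sqrt (by positivity)]; ring
  exact le_of_sq_le_sq h1 (by positivity)

/-- The exponential `e(am/r)`. -/
def ratExp (a : ℤ) (r m : ℕ) : ℂ := cexp (2 * Real.pi * I * (a * m / r))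

lemma ratExp_mul_left (a : ℤ) {d r : ℕ} (hd : d ≠ 0) (m : ℕ) :
    ratExp a (d * r) (d * m) = ratExp a r m := by
  have hd' : (d : ℂ) ≠ 0 := by exact_mod_cast hd
  unfold ratExp
  push_cast
  rw [show (a : ℂ) * (d * m) / (d * r) = a * m / r by
    rw [mul_left_comm, mul_div_mul_left _ _ hd']]

lemma norm_tsum_coprime_le {r : ℕ} [NeZero r] (a : ℤ) {S : Set ℕ} {H : ℕ → ℂ} {M : ℕ}
    (hH : ∀ n > M, H n = 0) {B : ℝ}
    (hB : ∀ χ : DirichletCharacter ℂ r, ‖∑' m : S, χ (m : ℕ) * H m‖ ≤ B) :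
    ‖∑' m : S, (if Nat.Coprime m r then ratExp a r m * H m else 0)‖ ≤ Real.sqrt r * B := by
  set f : (ZMod r)ˣ → ℂ := fun b => ZMod.stdAddChar ((a : ZMod r) * (b : ZMod r)) with hf
  have hf1 : ∀ b, ‖f b‖ ≤ 1 := fun b => (AddChar.norm_apply _ _).le
  have hφ : (0 : ℝ) < r.totient := by exact_mod_cast Nat.totient_pos.2 (NeZero.pos r)
  have hφ' : (r.totient : ℂ) ≠ 0 := by exact_mod_cast hφ.ne'
  have hpt : ∀ m : ℕ, (if Nat.Coprime m r then ratExp a r m * H m else 0) =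
      (r.totient : ℂ)⁻¹ * ∑ χ : DirichletCharacter ℂ r, unitCoeff f χ * (χ (m : ℕ) * H m) := by
    intro m
    simp_rw [← mul_assoc]
    rw [← Finset.sum_mul]
    split_ifs with hm
    · have e := sum_unitCoeff_mul f (ZMod.unitOfCoprime m hm)
      rw [ZMod.coe_unitOfCoprime] at e
      rw [e]
      have : f (ZMod.unitOfCoprime m hm) = ratExp a r m := by
        have h := ZMod.stdAddChar_coe (N := r) (a * m)
        push_cast at h
        rw [hf, ratExp]
        simp only [ZMod.coe_unitOfCoprime]
        rw [h]; ring_nf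
      rw [this]; field_simp
    · have : ∀ χ : DirichletCharacter ℂ r, χ (m : ZMod r) = 0 := fun χ =>
        χ.map_nonunit (by rwa [ZMod.isUnit_iff_coprime])
      simp [this]
  have hsum : ∀ χ : DirichletCharacter ℂ r, Summable fun m : S => unitCoeff f χ * (χ (m : ℕ) * H m) :=
    fun χ => (summable_subtype_of_eventually_zero (H := fun m => χ (m : ℕ) * H m) (M := M)
      fun n hn => by simp [hH n hn]).mul_left _
  simp_rw [hpt]
  rw [tsum_mul_left, Summable.tsum_finsetSum fun χ _ => hsum χ]
  simp_rw [tsum_mul_left]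
  rw [norm_mul, norm_inv, Complex.norm_natCast]
  have hB0 : 0 ≤ B := (norm_nonneg _).trans (hB 1)
  calc _ ≤ (r.totient : ℝ)⁻¹ * ∑ χ : DirichletCharacter ℂ r, ‖unitCoeff f χ‖ * B := by
        gcongr
        refine (norm_sum_le _ _).trans (Finset.sum_le_sum fun χ _ => ?_)
        rw [norm_mul]
        gcongr
        exact hB χ
    _ = (r.totient : ℝ)⁻¹ * (∑ χ : DirichletCharacter ℂ r, ‖unitCoeff f χ‖) * B := by
        rw [← Finset.sum_mul, mul_assoc]
    _ ≤ (r.totient : ℝ)⁻¹ * (r.totient * Real.sqrt r) * B := by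
        gcongr; exact sum_norm_unitCoeff_le hf1
    _ = _ := by field_simp

lemma norm_tsum_ratExp_le {q : ℕ} [NeZero q] (a : ℤ) (Y : ℕ) {H : ℕ → ℂ} {M : ℕ}
    (hH : ∀ n > M, H n = 0) {B : ℕ → ℝ}
    (hB : ∀ d ∈ q.divisors, ∀ [NeZero (q / d)], ∀ χ : DirichletCharacter ℂ (q / d),
      ‖∑' m : (Y + 1).smoothNumbers, χ (m : ℕ) * H (d * m)‖ ≤ B d) :
    ‖∑' n : (Y + 1).smoothNumbers, ratExp a q n * H n‖ ≤
      ∑ d ∈ q.divisors, Real.sqrt (q / d : ℕ) * B d := by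
  have hq : q ≠ 0 := NeZero.ne q
  have hpt : ∀ n : ℕ, ratExp a q n * H n =
      ∑ d ∈ q.divisors, if n.gcd q = d then ratExp a q n * H n else 0 := by
    intro n
    rw [Finset.sum_ite_eq, if_pos (Nat.mem_divisors.2 ⟨Nat.gcd_dvd_right _ _, hq⟩)]
  have hsum : ∀ d, Summable fun n : (Y + 1).smoothNumbers =>
      if (n : ℕ).gcd q = d then ratExp a q n * H n else 0 := fun d =>
    summable_subtype_of_eventually_zero (M := M)
      (H := fun n => if n.gcd q = d then ratExp a q n * H n else 0)
      fun n hn => by simp [hH n hn]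
  have e : ∑' n : (Y + 1).smoothNumbers, ratExp a q n * H n = ∑ d ∈ q.divisors,
      ∑' n : (Y + 1).smoothNumbers, if (n : ℕ).gcd q = d then ratExp a q n * H n else 0 := by
    rw [← Summable.tsum_finsetSum fun d _ => hsum d]
    exact tsum_congr fun n => hpt n
  rw [e]
  refine (norm_sum_le _ _).trans (Finset.sum_le_sum fun d hd => ?_)
  have hdq := Nat.dvd_of_mem_divisors hd
  have hd0 : d ≠ 0 := (Nat.pos_of_mem_divisors hd).ne'
  have hr0 : q / d ≠ 0 := (Nat.div_pos (Nat.divisor_le hd) (Nat.pos_of_ne_zero hd0)).ne'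
  have : NeZero (q / d) := ⟨hr0⟩
  have hqd : d * (q / d) = q := Nat.mul_div_cancel' hdq
  have hBd := hB d hd
  have hB0 : 0 ≤ B d := (norm_nonneg _).trans (hBd 1)
  by_cases hds : d ∈ (Y + 1).smoothNumbers
  · have e2 : ∑' n : (Y + 1).smoothNumbers, (if (n : ℕ).gcd q = d then ratExp a q n * H n else 0) =
        ∑' m : (Y + 1).smoothNumbers,
          if Nat.Coprime m (q / d) then ratExp a (q / d) m * H (d * m) else 0 := by
      set g : (Y + 1).smoothNumbers → (Y + 1).smoothNumbers := fun m =>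
        ⟨d * m, Nat.mul_mem_smoothNumbers hds m.2⟩ with hg
      have hginj : Function.Injective g := by
        intro m m' h
        have := congrArg Subtype.val h
        exact Subtype.ext (Nat.eq_of_mul_eq_mul_left (Nat.pos_of_ne_zero hd0) this)
      rw [← hginj.tsum_eq]
      · refine tsum_congr fun m => ?_
        have h1 : (d * (m : ℕ)).gcd q = d ↔ Nat.Coprime m (q / d) := by
          conv_lhs => rw [← hqd]
          rw [Nat.gcd_mul_left, Nat.coprime_iff_gcd_eq_one]
          exact Nat.mul_eq_left hd0
        simp only [hg, h1]
        congr 1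
        rw [← ratExp_mul_left a hd0 m, hqd]
      · intro n hn
        have hgcd : (n : ℕ).gcd q = d := by
          by_contra hne
          exact hn (by simp [hne])
        have hdn : d ∣ (n : ℕ) := hgcd ▸ Nat.gcd_dvd_left _ _
        refine ⟨⟨n / d, Nat.mem_smoothNumbers_of_dvd n.2 (Nat.div_dvd_of_dvd hdn)⟩, Subtype.ext ?_⟩
        exact Nat.mul_div_cancel' hdn
    rw [e2]
    exact norm_tsum_coprime_le a (H := fun m => H (d * m)) (M := M)
      (fun n hn => hH _ (hn.trans_le (Nat.le_mul_of_pos_left _ (Nat.pos_of_ne_zero hd0)))) hBd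
  · have : ∀ n : (Y + 1).smoothNumbers, (if (n : ℕ).gcd q = d then ratExp a q n * H n else 0) = 0 := by
      intro n
      rw [if_neg]
      rintro rfl
      exact hds (Nat.mem_smoothNumbers_of_dvd n.2 (Nat.gcd_dvd_left _ _))
    simp only [this, tsum_zero, norm_zero]
    positivity

lemma testFn_ofReal {Φ : ℝ → ℝ} (hsmooth : ContDiff ℝ (⊤ : ℕ∞) Φ) (hcompact : HasCompactSupport Φ)
    (hsupp : tsupport Φ ⊆ Ioi 0) : TestFn fun u => (Φ u : ℂ) := by
  refine ⟨Complex.ofRealCLM.contDiff.comp hsmooth, ?_⟩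
  rcases (tsupport Φ).eq_empty_or_nonempty with h | h
  · refine ⟨1, 1, one_pos, le_rfl, fun u _ => ?_⟩
    have : Φ u = 0 := image_eq_zero_of_notMem_tsupport (by simp [h])
    simp [this]
  · obtain ⟨a, ha, hamin⟩ := hcompact.isCompact.exists_isLeast h
    obtain ⟨b, hb, hbmax⟩ := hcompact.isCompact.exists_isGreatest h
    refine ⟨a, b, hsupp ha, hamin hb, fun u hu => ?_⟩
    have : Φ u = 0 := image_eq_zero_of_notMem_tsupport fun hm => hu ⟨hamin hm, hbmax hm⟩
    simp [this]

lemma setOf_smooth_eq_smoothNumbers {y : ℝ} (hy : 0 ≤ y) :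
    {n : ℕ | 0 < n ∧ ∀ p : ℕ, p.Prime → p ∣ n → (p : ℝ) ≤ y} = (⌊y⌋₊ + 1).smoothNumbers := by
  ext n
  rw [Nat.mem_smoothNumbers_iff_forall_le, mem_ofPred_eq]
  constructor
  · rintro ⟨h0, h⟩
    refine ⟨h0.ne', fun p _ hp hpn => ?_⟩
    exact Nat.lt_succ_of_le (Nat.le_floor (h p hp hpn))
  · rintro ⟨h0, h⟩
    refine ⟨Nat.pos_of_ne_zero h0, fun p hp hpn => ?_⟩
    exact (Nat.le_floor_iff hy).1 (Nat.lt_succ_iff.1 (h p (Nat.le_of_dvd (Nat.pos_of_ne_zero h0) hpn) hp hpn))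

lemma Esum_eq_tsum_ratExp {x y : ℝ} (hx : x ≠ 0) (hy : 0 ≤ y) (Φ : ℝ → ℝ) (a : ℤ) (q : ℕ) (γ : ℝ) :
    Esum x y Φ (a / q + γ) = ∑' n : (⌊y⌋₊ + 1).smoothNumbers,
      ratExp a q n * twist (γ * x) (fun u => (Φ u : ℂ)) ((n : ℕ) / x) := by
  rw [← setOf_smooth_eq_smoothNumbers hy]
  refine tsum_congr fun n => ?_
  have hx' : (x : ℂ) ≠ 0 := by exact_mod_cast hx
  rw [ratExp, twist, mul_left_comm, ← Complex.exp_add, mul_comm]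
  congr 2
  push_cast
  field_simp

lemma exists_sum_divisors_rpow_le {s : ℝ} (hs : 1 < s) :
    ∃ Z > 0, ∀ q : ℕ, ∑ d ∈ q.divisors, (d : ℝ) ^ (-s) ≤ Z := by
  have h : Summable fun n : ℕ => (n : ℝ) ^ (-s) := Real.summable_nat_rpow.2 (by linarith)
  refine ⟨(∑' n : ℕ, (n : ℝ) ^ (-s)) + 1, ?_, fun q => ?_⟩
  · have : 0 ≤ ∑' n : ℕ, (n : ℝ) ^ (-s) := tsum_nonneg fun n => by positivity
    linarith
  · have := h.sum_le_tsum q.divisors fun n _ => by positivity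
    linarith

lemma major_term_le {x T q η : ℝ} (hη : 0 < η) (hx : 1 ≤ x) (hq : 1 ≤ q) (hT : 0 < T)
    (hqT : q * T ≤ Real.sqrt x) :
    q ^ (1 / 2 + η) * x ^ (1 / 2 + 2 * η) * T ^ (1 / 2 + 2 * η) ≤ x ^ (3 / 4 + 3 * η) := by
  have hx0 : 0 < x := by linarith
  calc _ ≤ q ^ (1 / 2 + 2 * η) * x ^ (1 / 2 + 2 * η) * T ^ (1 / 2 + 2 * η) := by
        gcongr
        linarith
    _ = x ^ (1 / 2 + 2 * η) * (q * T) ^ (1 / 2 + 2 * η) := by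
        rw [Real.mul_rpow (by linarith) hT.le]; ring
    _ ≤ x ^ (1 / 2 + 2 * η) * Real.sqrt x ^ (1 / 2 + 2 * η) := by gcongr
    _ = _ := by
        rw [Real.sqrt_eq_rpow, ← Real.rpow_mul hx0.le, ← Real.rpow_add hx0]
        congr 1; ring

lemma divisor_term_le {x T q d η e : ℝ} (hη : 0 < η) (hη1 : η ≤ 1 / 4) (hx : 1 ≤ x)
    (hq : 1 ≤ q) (hT : 0 < T) (hqx : q ≤ Real.sqrt x) (hqT : q * T ≤ Real.sqrt x) (hd : 1 ≤ d)
    (he : T ^ e ≤ x ^ (-4 : ℝ)) :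
    Real.sqrt (q / d) * ((x / d) ^ (1 / 2 + 2 * η) * (q / d) ^ η * T ^ (1 / 2 + 2 * η)
      + (x / d) ^ 2 * (q / d) * T ^ e) ≤ d ^ (-(1 + 3 * η)) * (2 * x ^ (3 / 4 + 3 * η)) := by
  have hx0 : 0 < x := by linarith
  have hq0 : 0 < q := by linarith
  have hd0 : 0 < d := by linarith
  have h1 : Real.sqrt (q / d) * ((x / d) ^ (1 / 2 + 2 * η) * (q / d) ^ η * T ^ (1 / 2 + 2 * η))
      ≤ d ^ (-(1 + 3 * η)) * x ^ (3 / 4 + 3 * η) := by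
    calc _ = d ^ (-(1 + 3 * η)) *
          (q ^ (1 / 2 + η) * x ^ (1 / 2 + 2 * η) * T ^ (1 / 2 + 2 * η)) := by
          rw [Real.sqrt_eq_rpow, Real.div_rpow hq0.le hd0.le, Real.div_rpow hq0.le hd0.le,
            Real.div_rpow hx0.le hd0.le, Real.rpow_neg hd0.le,
            show 1 + 3 * η = 1 / 2 + η + (1 / 2 + 2 * η) by ring,
            Real.rpow_add hd0 (1 / 2 + η), Real.rpow_add hd0 (1 / 2) η, Real.rpow_add hq0]
          generalize d ^ (1 / 2 + 2 * η) = D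
          ring
      _ ≤ _ := by gcongr; exact major_term_le hη hx hq hT hqT
  have h2 : Real.sqrt (q / d) * ((x / d) ^ 2 * (q / d) * T ^ e)
      ≤ d ^ (-(1 + 3 * η)) * x ^ (3 / 4 + 3 * η) := by
    have hsx : Real.sqrt x ≤ x := Real.sqrt_le_iff.2 ⟨by linarith, by nlinarith⟩
    have hd2 : (d ^ 2)⁻¹ ≤ d ^ (-(1 + 3 * η)) := by
      rw [← Real.rpow_natCast, ← Real.rpow_neg hd0.le]
      exact Real.rpow_le_rpow_of_exponent_le hd (by push_cast; linarith)
    have hs1 : Real.sqrt (q / d) ≤ x :=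
      (Real.sqrt_le_sqrt ((div_le_self hq0.le hd).trans (hqx.trans hsx))).trans hsx
    have hs2 : q / d ≤ x := (div_le_self hq0.le hd).trans (hqx.trans hsx)
    calc _ ≤ x * ((x / d) ^ 2 * x * x ^ (-4 : ℝ)) := by gcongr
      _ = (d ^ 2)⁻¹ * 1 := by
          rw [Real.rpow_neg hx0.le, show (4 : ℝ) = (4 : ℕ) by norm_num, Real.rpow_natCast]
          field_simp
      _ ≤ d ^ (-(1 + 3 * η)) * x ^ (3 / 4 + 3 * η) := by
          gcongr
          exact Real.one_le_rpow hx (by positivity)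
  rw [mul_add]
  linarith

lemma exp_log_rpow_pow_four_le {x δ : ℝ} (hδ : 0 < δ) (h1 : 1 ≤ Real.log x)
    (h2 : (8 / δ) ^ 2 ≤ Real.log x) (hx : 0 < x) :
    Real.exp ((Real.log x) ^ ((1 : ℝ) / 2 - δ)) ^ 4 ≤ (x ^ δ) ^ (1 / 2 : ℝ) := by
  rw [← Real.exp_nat_mul, ← Real.rpow_mul hx.le, Real.rpow_def_of_pos hx, Real.exp_le_exp]
  set L := Real.log x
  have h3 : L ^ ((1 : ℝ) / 2 - δ) ≤ Real.sqrt L := by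
    rw [Real.sqrt_eq_rpow]
    exact Real.rpow_le_rpow_of_exponent_le h1 (by linarith)
  have h4 : 8 / δ ≤ Real.sqrt L := Real.le_sqrt_of_sq_le h2
  have h5 : Real.sqrt L * Real.sqrt L = L := Real.mul_self_sqrt (by linarith)
  have h6 : 8 ≤ Real.sqrt L * δ := (div_le_iff₀ hδ).1 h4
  push_cast
  nlinarith [Real.sqrt_nonneg L]

theorem exponential_sum_minor_arc_bound (hGRH : GRH)
    (Φ : ℝ → ℝ) (hsmooth : ContDiff ℝ (⊤ : ℕ∞) Φ) (hcompact : HasCompactSupport Φ)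
    (hsupp : tsupport Φ ⊆ Set.Ioi 0) (δ ε : ℝ) (hδ : 0 < δ) (hε : 0 < ε) :
    ∃ C > (0 : ℝ), ∃ x₀ : ℝ, ∀ x ≥ x₀, ∀ y : ℝ,
      (Real.log x) ^ (2 + δ) ≤ y → y ≤ Real.exp ((Real.log x) ^ ((1 : ℝ) / 2 - δ)) →
      ∀ (α γ : ℝ) (a : ℤ) (q : ℕ), α ∈ Set.Icc (0 : ℝ) 1 →
        Int.gcd a (q : ℤ) = 1 → 1 ≤ q → (q : ℝ) ≤ Real.sqrt x →
        α = (a : ℝ) / (q : ℝ) + γ →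
        x ^ (δ - 1) ≤ |γ| → |γ| ≤ 1 / ((q : ℝ) * Real.sqrt x) →
        ‖Esum x y Φ α‖ ≤ C * x ^ ((3 : ℝ) / 4 + ε) := by
  have hA := testFn_ofReal hsmooth hcompact hsupp
  set A : ℝ → ℂ := fun u => (Φ u : ℂ) with hAdef
  obtain ⟨-, A₁, A₂, hA1, hA12, hA0⟩ := id hA
  set η : ℝ := min (ε / 3) (1 / 4) with hηdef
  have hη : 0 < η := by positivity
  have hη1 : η ≤ 1 / 4 := min_le_right _ _
  have hηε : η ≤ ε / 3 := min_le_left _ _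
  obtain ⟨k, hk⟩ := exists_nat_ge (2 + 8 / δ)
  obtain ⟨C, hC, hbound⟩ := exists_norm_tsum_smooth_le hGRH hA hη hη1 hη hη1 k
  obtain ⟨Z, hZ, hZsum⟩ := exists_sum_divisors_rpow_le (s := 1 + 3 * η) (by linarith)
  refine ⟨2 * C * Z, by positivity, Real.exp (max 1 ((8 / δ) ^ 2)), ?_⟩
  intro x hx y hy1 hy2 α γ a q _ _ hq hqx hα hγ1 hγ2
  have hx0 : 0 < x := (Real.exp_pos _).trans_le hx
  have hlog : max 1 ((8 / δ) ^ 2) ≤ Real.log x := (Real.le_log_iff_exp_le hx0).2 hx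
  have hlog1 : 1 ≤ Real.log x := (le_max_left _ _).trans hlog
  have hx1 : 1 ≤ x := by
    by_contra! h
    linarith [Real.log_neg hx0 h]
  have hy0 : 0 ≤ y := le_trans (by positivity) hy1
  have hqpos : (0 : ℝ) < q := by exact_mod_cast hq
  have hq1 : (1 : ℝ) ≤ q := by exact_mod_cast hq
  have : NeZero q := ⟨by omega⟩
  have hsx : Real.sqrt x ≤ x := Real.sqrt_le_iff.2 ⟨by linarith, by nlinarith⟩
  have hsx0 : 0 < Real.sqrt x := Real.sqrt_pos.2 hx0
  have hT : |γ * x| = |γ| * x := by rw [abs_mul, abs_of_pos hx0]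
  have hTlow : x ^ δ ≤ |γ * x| := by
    calc x ^ δ = x ^ (δ - 1) * x := by
          rw [← Real.rpow_add_one hx0.ne']; congr 1; ring
      _ ≤ _ := by rw [hT]; gcongr
  have hxδ : 1 ≤ x ^ δ := Real.one_le_rpow hx1 hδ.le
  have hT1 : 1 ≤ |γ * x| := hxδ.trans hTlow
  have hT0 : 0 < |γ * x| := by linarith
  have hqT : q * |γ * x| ≤ Real.sqrt x := by
    rw [hT]
    calc q * (|γ| * x) ≤ q * (1 / (q * Real.sqrt x) * x) := by gcongr
      _ = x / Real.sqrt x := by field_simp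
      _ = Real.sqrt x := Real.div_sqrt
  have hY : ((⌊y⌋₊ : ℕ) : ℝ) ^ 4 ≤ |γ * x| ^ (1 / 2 : ℝ) := by
    calc ((⌊y⌋₊ : ℕ) : ℝ) ^ 4 ≤ Real.exp ((Real.log x) ^ ((1 : ℝ) / 2 - δ)) ^ 4 := by
          gcongr; exact (Nat.floor_le hy0).trans hy2
      _ ≤ (x ^ δ) ^ (1 / 2 : ℝ) :=
          exp_log_rpow_pow_four_le hδ hlog1 ((le_max_right _ _).trans hlog) hx0
      _ ≤ _ := by gcongr
  have he : |γ * x| ^ (1 - k / 2 : ℝ) ≤ x ^ (-4 : ℝ) := by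
    have h8 : 0 < 8 / δ := by positivity
    have h9 : δ * (8 / δ) = 8 := by field_simp
    calc |γ * x| ^ (1 - k / 2 : ℝ) ≤ (x ^ δ) ^ (1 - k / 2 : ℝ) :=
          Real.rpow_le_rpow_of_nonpos (by positivity) hTlow (by linarith)
      _ = x ^ (δ * (1 - k / 2)) := by rw [← Real.rpow_mul hx0.le]
      _ ≤ _ := Real.rpow_le_rpow_of_exponent_le hx1 (by nlinarith)
  rw [hα, Esum_eq_tsum_ratExp hx0.ne' hy0]
  have hH : ∀ n > ⌈A₂ * x⌉₊, twist (γ * x) A ((n : ℕ) / x) = 0 := by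
    intro n hn
    have : A ((n : ℕ) / x) = 0 := hA0 _ fun h => by
      have h2 : (n : ℝ) ≤ A₂ * x := (div_le_iff₀ hx0).1 h.2
      exact absurd (Nat.lt_of_ceil_lt hn) (by linarith)
    simp [twist, this]
  refine (norm_tsum_ratExp_le a ⌊y⌋₊ hH (B := fun d => C *
    ((x / d) ^ (1 / 2 + 2 * η) * ((q : ℝ) / d) ^ η * |γ * x| ^ (1 / 2 + 2 * η)
      + (x / d) ^ 2 * ((q : ℝ) / d) * |γ * x| ^ (1 - k / 2 : ℝ))) ?_).trans ?_
  · intro d hd _ χ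
    have hd0 : 0 < d := Nat.pos_of_mem_divisors hd
    have hdr : (0 : ℝ) < d := by exact_mod_cast hd0
    have hdq : (d : ℝ) ≤ q := by exact_mod_cast Nat.divisor_le hd
    have h := hbound (q / d) χ ⌊y⌋₊ (x / d) (γ * x)
      ((one_le_div hdr).2 (hdq.trans (hqx.trans hsx))) hT1 hY
    rw [Nat.cast_div (Nat.dvd_of_mem_divisors hd) hdr.ne'] at h
    refine le_trans (le_of_eq ?_) h
    congr 1
    refine tsum_congr fun m => ?_
    congr 2
    push_cast
    field_simp
  · calc _ ≤ ∑ d ∈ q.divisors, (d : ℝ) ^ (-(1 + 3 * η)) * (2 * C * x ^ (3 / 4 + 3 * η)) := by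
          refine Finset.sum_le_sum fun d hd => ?_
          have hd1 : (1 : ℝ) ≤ d := by exact_mod_cast Nat.pos_of_mem_divisors hd
          have h := divisor_term_le hη hη1 hx1 hq1 hT0 hqx hqT hd1 he
          rw [Nat.cast_div (Nat.dvd_of_mem_divisors hd) (by linarith)]
          rw [mul_left_comm]
          exact (mul_le_mul_of_nonneg_left h hC.le).trans_eq (by ring)
      _ = (∑ d ∈ q.divisors, (d : ℝ) ^ (-(1 + 3 * η))) * (2 * C * x ^ (3 / 4 + 3 * η)) := by
          rw [Finset.sum_mul]
      _ ≤ Z * (2 * C * x ^ (3 / 4 + ε)) := by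
          gcongr
          · exact hZsum q
          · linarith
      _ = _ := by ring
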